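/- Fix a real constant C > 0. For an integral binary quartic form f define its height h_C(f) = max(|I(f)|, |J(f)|/C). Let N_C(V^{(1)};X) be the number of GL_2(ℤ)-equivalence classes of irreducible integral binary quartic forms f having exactly 2 distinct real roots in P^1(ℂ) (and one pair of complex conjugate roots) and h_C(f) < X. Then N_C(V^{(1)};X) = (2C·ζ(2)/27)·X^2 + o(X^2) as X → ∞; that is, N_C(V^{(1)};X)/X^2 → 2C·ζ(2)/27. -/

import Mathlib

open Filter

/-- An integral binary quartic form `a x⁴ + b x³y + c x²y² + d xy³ + e y⁴`. -/
structure BQF where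
  a : ℤ
  b : ℤ
  c : ℤ
  d : ℤ
  e : ℤ

namespace BQF

/-- The invariant `I` of a binary quartic form. -/
def I (f : BQF) : ℤ := 12 * f.a * f.e - 3 * f.b * f.d + f.c ^ 2

/-- The invariant `J` of a binary quartic form. -/
def J (f : BQF) : ℤ :=
  72 * f.a * f.c * f.e + 9 * f.b * f.c * f.d - 27 * f.a * f.d ^ 2 -
    27 * f.e * f.b ^ 2 - 2 * f.c ^ 3

/-- Evaluation of the form at a pair of integers. -/
def evalZ (f : BQF) (x y : ℤ) : ℤ :=
  f.a * x ^ 4 + f.b * x ^ 3 * y + f.c * x ^ 2 * y ^ 2 + f.d * x * y ^ 3 + f.e * y ^ 4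

/-- Evaluation of the form at a pair of reals. -/
noncomputable def evalR (f : BQF) (x y : ℝ) : ℝ :=
  (f.a : ℝ) * x ^ 4 + (f.b : ℝ) * x ^ 3 * y + (f.c : ℝ) * x ^ 2 * y ^ 2 +
    (f.d : ℝ) * x * y ^ 3 + (f.e : ℝ) * y ^ 4

/-- `GL₂(ℤ)`-equivalence: `g = γ · f` where `(γ · f)(x,y) = f((x,y)γ)` for some
integer matrix `γ` with unit (i.e. `±1`) determinant. -/
def Equivalent (f g : BQF) : Prop :=
  ∃ γ : Matrix (Fin 2) (Fin 2) ℤ, IsUnit γ.det ∧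
    ∀ x y : ℤ, g.evalZ x y = f.evalZ (x * γ 0 0 + y * γ 1 0) (x * γ 0 1 + y * γ 1 1)

/-- Irreducibility of the form over `ℚ`: it has no factor of positive degree with
rational coefficients.  Equivalently, `a ≠ 0` (no root at infinity, i.e. no factor `y`)
and the dehomogenized quartic polynomial is irreducible over `ℚ`. -/
def Irred (f : BQF) : Prop :=
  f.a ≠ 0 ∧
    Irreducible (Polynomial.C (f.a : ℚ) * Polynomial.X ^ 4 +
      Polynomial.C (f.b : ℚ) * Polynomial.X ^ 3 +
      Polynomial.C (f.c : ℚ) * Polynomial.X ^ 2 +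
      Polynomial.C (f.d : ℚ) * Polynomial.X + Polynomial.C (f.e : ℚ))

/-- The set of real roots of `f`; for a form with `a ≠ 0` all roots of `f` in `ℙ¹(ℝ)`
have the shape `(z : 1)` with `z` real. -/
def realRoots (f : BQF) : Set ℝ := {z : ℝ | f.evalR z 1 = 0}

end BQF

/-- The number of `GL₂(ℤ)`-equivalence classes of integral binary quartic forms
satisfying the predicate `P`. -/
noncomputable def classCount (P : BQF → Prop) : ℕ :=
  Nat.card (Quot fun f g : {h : BQF // P h} => BQF.Equivalent f.1 g.1)


open Filter
noncomputable section

def ee (x : ℝ) : ℂ := Complex.exp (Complex.I * ((2 * Real.pi * x : ℝ) : ℂ))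

lemma ee_add (x y : ℝ) : ee (x + y) = ee x * ee y := by
  unfold ee; rw [← Complex.exp_add]; congr 1; push_cast; ring

lemma ee_norm (x : ℝ) : ‖ee x‖ = 1 := by
  unfold ee; rw [mul_comm]; exact Complex.norm_exp_ofReal_mul_I _

lemma ee_conj (x : ℝ) : (starRingEnd ℂ) (ee x) = ee (-x) := by
  unfold ee; rw [← Complex.exp_conj]; congr 1; rw [map_mul, Complex.conj_I, Complex.conj_ofReal]; push_cast; ring

lemma ee_nat (x : ℝ) (k : ℕ) : ee (k * x) = ee x ^ k := by
  unfold ee; rw [← Complex.exp_nat_mul]; congr 1; push_cast; ring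

lemma vdc_id (z : ℕ → ℂ) (hz : ∀ j, ‖z j‖ = 1) (N : ℕ) :
    ‖∑ j ∈ Finset.range N, z j‖ ^ 2 = N + ∑ h ∈ Finset.range N,
      ∑ k ∈ Finset.range (N - (h + 1)), 2 * (z (k + h + 1) * (starRingEnd ℂ) (z k)).re := by
  induction N with
  | zero => simp
  | succ N ih =>
    have e1 : ‖∑ j ∈ Finset.range (N+1), z j‖ ^ 2 = ‖∑ j ∈ Finset.range N, z j‖ ^ 2 + 1
        + 2 * (z N * (starRingEnd ℂ) (∑ j ∈ Finset.range N, z j)).re := by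
      rw [Finset.sum_range_succ, ← Complex.normSq_eq_norm_sq, ← Complex.normSq_eq_norm_sq,
        Complex.normSq_add, Complex.normSq_eq_norm_sq (z N), hz]
      have : (((∑ j ∈ Finset.range N, z j)) * (starRingEnd ℂ) (z N)).re
        = (z N * (starRingEnd ℂ) (∑ j ∈ Finset.range N, z j)).re := by
        simp only [Complex.mul_re, Complex.conj_re, Complex.conj_im]; ring
      rw [this]; ring
    rw [e1, ih, Finset.sum_range_succ (n := N)]
    have e2 : ∀ h ∈ Finset.range N, ∑ k ∈ Finset.range (N + 1 - (h + 1)),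
        2 * (z (k + h + 1) * (starRingEnd ℂ) (z k)).re =
        ∑ k ∈ Finset.range (N - (h + 1)), 2 * (z (k + h + 1) * (starRingEnd ℂ) (z k)).re
        + 2 * (z N * (starRingEnd ℂ) (z (N - 1 - h))).re := by
      intro h hh
      have hh := Finset.mem_range.1 hh
      have : N + 1 - (h + 1) = (N - (h + 1)) + 1 := by omega
      rw [this, Finset.sum_range_succ]
      have e3 : N - (h+1) + h + 1 = N := by omega
      have e4 : N - (h+1) = N - 1 - h := by omega
      rw [e3, e4]
    rw [Finset.sum_congr rfl e2, Finset.sum_add_distrib, ← Finset.mul_sum]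
    have e5 : ∑ h ∈ Finset.range N, (z N * (starRingEnd ℂ) (z (N - 1 - h))).re
       = (z N * (starRingEnd ℂ) (∑ j ∈ Finset.range N, z j)).re := by
      rw [Finset.sum_range_reflect (fun j => (z N * (starRingEnd ℂ) (z j)).re), map_sum,
        Finset.mul_sum, Complex.re_sum]
    rw [e5]; simp; ring

lemma weyl1 (A B c : ℝ) (hA : A ≠ 0) (N : ℕ) (hN : 4 * |A| * N ≤ 1) :
    ‖∑ j ∈ Finset.range N, ee (A * j ^ 2 + B * j + c)‖ ^ 2 ≤
      N + (1 / (2 * |A|)) * (1 + Real.log N) := by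
  have hA' : 0 < |A| := abs_pos.2 hA
  rw [vdc_id _ (fun j => ee_norm _)]
  gcongr
  have key : ∀ h ∈ Finset.range N, ∑ k ∈ Finset.range (N - (h + 1)),
      2 * (ee (A * ((k + h + 1 : ℕ) : ℝ) ^ 2 + B * ((k + h + 1 : ℕ) : ℝ) + c) *
        (starRingEnd ℂ) (ee (A * (k : ℝ) ^ 2 + B * k + c))).re ≤ 1 / (2 * |A|) * ((h : ℝ) + 1)⁻¹ := by
    intro h hh
    have hh : h + 1 ≤ N := Finset.mem_range.1 hh
    have hh' : (h : ℝ) + 1 ≤ N := by exact_mod_cast hh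
    set r := ee (2 * A * (h + 1)) with hr
    set M := N - (h + 1)
    have e1 : ∀ k : ℕ, ee (A * ((k + h + 1 : ℕ) : ℝ) ^ 2 + B * ((k + h + 1 : ℕ) : ℝ) + c) *
        (starRingEnd ℂ) (ee (A * (k : ℝ) ^ 2 + B * k + c))
        = ee (A * (h + 1) ^ 2 + B * (h + 1)) * r ^ k := by
      intro k
      rw [ee_conj, ← ee_add, hr, ← ee_nat, ← ee_add]; congr 1; push_cast; ring
    have hr1 : 8 * |A| * (h + 1) ≤ ‖r - 1‖ := by
      have : r = Complex.exp (Complex.I * ((2 * Real.pi * (2 * A * (h + 1)) : ℝ) : ℂ)) := rfl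
      rw [this, Complex.norm_exp_I_mul_ofReal_sub_one]
      have e : 2 * Real.pi * (2 * A * (h + 1)) / 2 = 2 * Real.pi * A * (h + 1) := by ring
      rw [e, Real.norm_eq_abs, abs_mul]
      have h0 : 0 ≤ 2 * Real.pi * |A| * (h + 1) := by positivity
      have h1 : 2 * Real.pi * |A| * (h + 1) ≤ Real.pi / 2 := by
        have : |A| * (h+1) ≤ 1 / 4 := by nlinarith
        nlinarith [Real.pi_pos]
      have h2 := Real.mul_le_sin h0 h1
      have h3 : |Real.sin (2 * Real.pi * A * (h + 1))| = |Real.sin (2 * Real.pi * |A| * (h + 1))| := by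
        rcases abs_choice A with h' | h' <;> rw [h']
        rw [show 2 * Real.pi * -A * ((h:ℝ) + 1) = -(2 * Real.pi * A * (h + 1)) by ring, Real.sin_neg, abs_neg]
      rw [h3]
      have h4 := le_abs_self (Real.sin (2 * Real.pi * |A| * (h + 1)))
      have h5 : 2 / Real.pi * (2 * Real.pi * |A| * (h + 1)) = 4 * |A| * (h + 1) := by
        field_simp; ring
      rw [abs_of_pos (by norm_num : (0:ℝ) < 2)]
      linarith
    have hpos : 0 < ‖r - 1‖ := lt_of_lt_of_le (by positivity) hr1
    have hne : r ≠ 1 := by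
      intro h; rw [h] at hpos; simp at hpos
    rw [← Finset.mul_sum]
    have e3 : ∑ k ∈ Finset.range M, (ee (A * ((k + h + 1 : ℕ) : ℝ) ^ 2 + B * ((k + h + 1 : ℕ) : ℝ) + c) *
        (starRingEnd ℂ) (ee (A * (k : ℝ) ^ 2 + B * k + c))).re
        = (ee (A * (h + 1) ^ 2 + B * (h + 1)) * ((r ^ M - 1) / (r - 1))).re := by
      rw [← geom_sum_eq hne, Finset.mul_sum, Complex.re_sum]
      exact Finset.sum_congr rfl (fun k _ => by rw [e1])
    rw [e3]
    have e4 : (ee (A * (h + 1) ^ 2 + B * (h + 1)) * ((r ^ M - 1) / (r - 1))).re ≤ 2 / (8 * |A| * (h + 1)) := by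
      refine (Complex.re_le_norm _).trans ?_
      rw [norm_mul, ee_norm, one_mul, norm_div]
      refine div_le_div₀ (by norm_num) ?_ (by positivity) hr1
      refine (norm_sub_le _ _).trans ?_
      rw [norm_pow, hr, ee_norm]; norm_num
    refine (mul_le_mul_of_nonneg_left e4 (by norm_num)).trans (le_of_eq ?_)
    field_simp; norm_num
  refine (Finset.sum_le_sum key).trans ?_
  rw [← Finset.mul_sum]
  refine mul_le_mul_of_nonneg_left ?_ (by positivity)
  have := harmonic_le_one_add_log N
  simpa [harmonic] using this

lemma weyl2 (A B c : ℝ) (hA : A ≠ 0) (hA4 : |A| ≤ 1 / 4) (N : ℕ) :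
    ‖∑ j ∈ Finset.range N, ee (A * j ^ 2 + B * j + c)‖ ≤
      (8 * |A| * N + 1) * √((1 + Real.log (1 / |A|)) / |A|) := by
  have hA' : 0 < |A| := abs_pos.2 hA
  set Bd := √((1 + Real.log (1 / |A|)) / |A|) with hBd
  set N0 := ⌊1 / (4 * |A|)⌋₊ with hN0
  have hN0le : (N0 : ℝ) ≤ 1 / (4 * |A|) := Nat.floor_le (by positivity)
  have hge1 : 1 ≤ 1 / (4 * |A|) := by rw [le_div_iff₀ (by positivity)]; linarith
  have hN01 : 1 ≤ N0 := by rw [hN0]; exact Nat.le_floor (by simpa using hge1)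
  have hN01' : (1:ℝ) ≤ N0 := by exact_mod_cast hN01
  have hN0ge : 1 / (8 * |A|) ≤ N0 := by
    have := Nat.lt_floor_add_one (1 / (4 * |A|))
    have e : 1 / (4 * |A|) = 2 * (1 / (8 * |A|)) := by field_simp; norm_num
    rw [← hN0] at this
    linarith
  have short : ∀ (M : ℕ) (B c : ℝ), M ≤ N0 → ‖∑ j ∈ Finset.range M, ee (A * j ^ 2 + B * j + c)‖ ≤ Bd := by
    intro M B c hM
    have hM' : (M:ℝ) ≤ 1 / (4 * |A|) := le_trans (by exact_mod_cast hM) hN0le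
    apply Real.le_sqrt_of_sq_le
    have h4 : 4 * |A| * M ≤ 1 := by
      rw [le_div_iff₀ (by positivity)] at hM'; linarith
    refine (weyl1 A B c hA M h4).trans ?_
    have hlog : Real.log M ≤ Real.log (1 / |A|) := by
      rcases Nat.eq_zero_or_pos M with h | h
      · rw [h]; simp only [Nat.cast_zero, Real.log_zero]; apply Real.log_nonneg
        rw [le_div_iff₀ hA']; linarith
      · apply Real.log_le_log (by exact_mod_cast h)
        refine hM'.trans ?_
        gcongr; linarith
    have hl0 : 0 ≤ Real.log (1 / |A|) := by
      apply Real.log_nonneg; rw [le_div_iff₀ hA']; linarith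
    have h5 : (1 + Real.log (1 / |A|)) / |A| = 1 / |A| * (1 + Real.log (1 / |A|)) := by ring
    have h6 : 1 / (4 * |A|) = (1/4) * (1 / |A|) := by field_simp
    have h7 : 1 / (2 * |A|) = (1/2) * (1 / |A|) := by field_simp
    have h8 : 0 < 1 / |A| := by positivity
    rw [h5, h7]
    rw [h6] at hM'
    have := mul_le_mul_of_nonneg_left hlog h8.le
    nlinarith
  have main : ∀ q : ℕ, ∀ (M : ℕ) (B c : ℝ), M ≤ (q + 1) * N0 →
      ‖∑ j ∈ Finset.range M, ee (A * j ^ 2 + B * j + c)‖ ≤ (q + 1) * Bd := by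
    intro q
    induction q with
    | zero => intro M B c hM; simpa using short M B c (by simpa using hM)
    | succ q ih =>
      intro M B c hM
      by_cases hle : M ≤ N0
      · refine (short M B c hle).trans ?_
        have : 0 ≤ Bd := Real.sqrt_nonneg _
        push_cast; nlinarith
      · obtain ⟨M', rfl⟩ : ∃ M', M = N0 + M' := ⟨M - N0, by omega⟩
        rw [Finset.sum_range_add]
        refine (norm_add_le _ _).trans ?_
        have h1 := short N0 B c le_rfl
        have h2 := ih M' (B + 2 * A * N0) (c + A * N0 ^ 2 + B * N0) (by
          have : (q + 1 + 1) * N0 = N0 + (q + 1) * N0 := by ring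
          omega)
        have e : ∀ j : ℕ, A * (j:ℝ) ^ 2 + (B + 2 * A * N0) * j + (c + A * N0 ^ 2 + B * N0)
           = A * ((N0 + j : ℕ) : ℝ) ^ 2 + B * ((N0 + j : ℕ) : ℝ) + c := by
          intro j; push_cast; ring
        simp only [e] at h2
        push_cast at *
        linarith
  have h := main (N / N0) N B c (by
    have := Nat.div_add_mod N N0
    have := Nat.mod_lt N (show N0 > 0 by omega)
    nlinarith)
  refine h.trans (mul_le_mul_of_nonneg_right ?_ (Real.sqrt_nonneg _))
  have h1 : ((N / N0 : ℕ) : ℝ) ≤ N / N0 := Nat.cast_div_le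
  have h2 : (N:ℝ) / N0 ≤ 8 * |A| * N := by
    rw [div_le_iff₀ (by linarith)]
    have : 1 ≤ 8 * |A| * N0 := by
      rw [div_le_iff₀ (by positivity)] at hN0ge; linarith
    have hn : (0:ℝ) ≤ N := Nat.cast_nonneg N
    nlinarith
  linarith
end

open Filter
noncomputable section

def b2 (x : ℝ) : ℝ := Int.fract x ^ 2 - Int.fract x + 6⁻¹

lemma b2_hasSum (x : ℝ) : HasSum (fun n : ℕ => 1 / (n : ℝ) ^ 2 * Real.cos (2 * Real.pi * (n * x)))
    (Real.pi ^ 2 * b2 x) := by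
  have h := hasSum_one_div_nat_pow_mul_cos (k := 1) one_ne_zero (x := Int.fract x)
    ⟨Int.fract_nonneg x, (Int.fract_lt_one x).le⟩
  have e : (Polynomial.map (algebraMap ℚ ℝ) (Polynomial.bernoulli 2)).eval (Int.fract x) = b2 x := bernoulliFun_two _
  simp only [mul_one] at h
  rw [e] at h
  convert h using 1
  · funext n
    congr 1
    have : 2 * Real.pi * n * Int.fract x = 2 * Real.pi * (n * x) - ((n * ⌊x⌋ : ℤ) : ℝ) * (2 * Real.pi) := by
      rw [Int.fract]; push_cast; ring
    rw [this, Real.cos_sub_int_mul_two_pi]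
  · simp only [Nat.factorial]; push_cast; ring

lemma fract_lower (t ε : ℝ) (h0 : 0 < ε) (h1 : ε < 1) :
    (b2 (t + ε) - b2 t) / (2 * ε) - ε / 2 ≤ Int.fract t - 1 / 2 := by
  have hx0 := Int.fract_nonneg t
  have hx1 := Int.fract_lt_one t
  have key : b2 (t + ε) - b2 t ≤ 2 * ε * (Int.fract t - 1 / 2) + ε ^ 2 := by
    by_cases h : Int.fract t + ε < 1
    · have : Int.fract (t + ε) = Int.fract t + ε := by
        rw [Int.fract_eq_iff]; refine ⟨by linarith, h, ⌊t⌋, ?_⟩; rw [Int.fract]; ring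
      unfold b2; rw [this]; nlinarith
    · have : Int.fract (t + ε) = Int.fract t + ε - 1 := by
        rw [Int.fract_eq_iff]; refine ⟨by linarith, by linarith, ⌊t⌋ + 1, ?_⟩; rw [Int.fract]; push_cast; ring
      unfold b2; rw [this]; nlinarith
  have : (b2 (t + ε) - b2 t) / (2 * ε) ≤ Int.fract t - 1 / 2 + ε / 2 := by
    rw [div_le_iff₀ (by positivity)]; nlinarith
  linarith

lemma fract_upper (t ε : ℝ) (h0 : 0 < ε) (h1 : ε < 1) :
    Int.fract t - 1 / 2 ≤ (b2 t - b2 (t - ε)) / (2 * ε) + ε / 2 := by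
  have hx0 := Int.fract_nonneg t
  have hx1 := Int.fract_lt_one t
  have key : 2 * ε * (Int.fract t - 1 / 2) - ε ^ 2 ≤ b2 t - b2 (t - ε) := by
    by_cases h : ε ≤ Int.fract t
    · have : Int.fract (t - ε) = Int.fract t - ε := by
        rw [Int.fract_eq_iff]; refine ⟨by linarith, by linarith, ⌊t⌋, ?_⟩; rw [Int.fract]; ring
      unfold b2; rw [this]; nlinarith
    · have : Int.fract (t - ε) = Int.fract t - ε + 1 := by
        rw [Int.fract_eq_iff]; refine ⟨by linarith, by linarith, ⌊t⌋ - 1, ?_⟩; rw [Int.fract]; push_cast; ring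
      unfold b2; rw [this]; nlinarith
  have : Int.fract t - 1 / 2 - ε / 2 ≤ (b2 t - b2 (t - ε)) / (2 * ε) := by
    rw [le_div_iff₀ (by positivity)]; nlinarith
  linarith

lemma weyl_lim {ι : Type*} {l : Filter ι} {A B c lam : ι → ℝ} {N : ι → ℕ} {A0 K : ℝ}
    (hlam : Tendsto lam l atTop) (hA : Tendsto (fun i => lam i * A i) l (nhds A0)) (hA0 : A0 ≠ 0)
    (hN : ∀ᶠ i in l, (N i : ℝ) ≤ K * lam i) :
    Tendsto (fun i => (∑ j ∈ Finset.range (N i), Real.cos (2 * Real.pi * (A i * j ^ 2 + B i * j + c i))) / lam i)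
      l (nhds 0) := by
  have hx : Tendsto (fun i => |A i| * lam i) l (nhds |A0|) := by
    refine (hA.abs).congr' ?_
    filter_upwards [hlam.eventually_gt_atTop 0] with i hi
    rw [abs_mul, abs_of_pos hi, mul_comm]
  have hpos : 0 < |A0| := abs_pos.2 hA0
  have hx0 : Tendsto (fun i => |A i|) l (nhds 0) := by
    have := hx.mul (tendsto_inv_atTop_zero.comp hlam)
    rw [mul_zero] at this
    refine this.congr' ?_
    filter_upwards [hlam.eventually_gt_atTop 0] with i hi
    simp only [Function.comp]; field_simp
  have hG : Tendsto (fun i => (8 * K * (|A i| * lam i) + 1) *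
      √((|A i| - |A i| * Real.log |A i|) / (|A i| * lam i) ^ 2)) l (nhds 0) := by
    have h1 : Tendsto (fun i => |A i| * Real.log |A i|) l (nhds 0) := by
      have := (Real.continuous_mul_log.tendsto 0).comp hx0
      simpa only [zero_mul, Function.comp_def] using this
    have h2 := ((hx0.sub h1).div (hx.pow 2) (by positivity)).sqrt
    have h3 := ((hx.const_mul (8 * K)).add_const 1).mul h2
    simpa using h3
  refine squeeze_zero_norm' ?_ hG
  filter_upwards [hN, hlam.eventually_gt_atTop 0, hx.eventually (lt_mem_nhds (half_lt_self hpos)),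
    hx0.eventually (gt_mem_nhds (show (0:ℝ) < 1/4 by norm_num))] with i hNi hl hxi hx4
  have hAi : 0 < |A i| := by
    by_contra h
    have : |A i| = 0 := le_antisymm (not_lt.1 h) (abs_nonneg _)
    rw [this] at hxi; simp at hxi; linarith
  have hw := weyl2 (A i) (B i) (c i) (abs_pos.1 hAi) hx4.le (N i)
  have hre : |∑ j ∈ Finset.range (N i), Real.cos (2 * Real.pi * (A i * j ^ 2 + B i * j + c i))|
      ≤ ‖∑ j ∈ Finset.range (N i), ee (A i * j ^ 2 + B i * j + c i)‖ := by
    refine le_trans (le_of_eq ?_) (Complex.abs_re_le_norm _)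
    rw [Complex.re_sum]
    congr 1
    refine Finset.sum_congr rfl (fun j _ => ?_)
    unfold ee; rw [mul_comm Complex.I, Complex.exp_ofReal_mul_I_re]
  rw [norm_div, Real.norm_eq_abs, Real.norm_eq_abs, abs_of_pos hl, div_le_iff₀ hl]
  refine (hre.trans hw).trans ?_
  have e1 : √((1 + Real.log (1 / |A i|)) / |A i|) =
     √((|A i| - |A i| * Real.log |A i|) / (|A i| * lam i) ^ 2) * lam i := by
    have e2 : (1 + Real.log (1 / |A i|)) / |A i| =
        (|A i| - |A i| * Real.log |A i|) / (|A i| * lam i) ^ 2 * lam i ^ 2 := by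
      rw [one_div, Real.log_inv]; field_simp; rw [sub_eq_add_neg]
    rw [e2, Real.sqrt_mul' _ (sq_nonneg _), Real.sqrt_sq hl.le]
  rw [e1, ← mul_assoc]
  refine mul_le_mul_of_nonneg_right (mul_le_mul_of_nonneg_right ?_ (Real.sqrt_nonneg _)) hl.le
  nlinarith

lemma b2_lim {ι : Type*} {l : Filter ι} {A B c lam : ι → ℝ} {N : ι → ℕ} {A0 K : ℝ}
    (hlam : Tendsto lam l atTop) (hA : Tendsto (fun i => lam i * A i) l (nhds A0)) (hA0 : A0 ≠ 0)
    (hN : ∀ᶠ i in l, (N i : ℝ) ≤ K * lam i) :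
    Tendsto (fun i => (∑ j ∈ Finset.range (N i), b2 (A i * j ^ 2 + B i * j + c i)) / lam i)
      l (nhds 0) := by
  set F : ι → ℕ → ℝ := fun i n => 1 / (n:ℝ) ^ 2 * ((∑ j ∈ Finset.range (N i),
    Real.cos (2 * Real.pi * (n * (A i * j ^ 2 + B i * j + c i)))) / lam i) with hF
  have h1 : ∀ i, HasSum (F i) (Real.pi ^ 2 * ((∑ j ∈ Finset.range (N i), b2 (A i * j ^ 2 + B i * j + c i)) / lam i)) := by
    intro i
    have := (hasSum_sum (fun j (_ : j ∈ Finset.range (N i)) => b2_hasSum (A i * j ^ 2 + B i * j + c i))).div_const (lam i)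
    rw [← Finset.mul_sum, mul_div_assoc] at this
    have e : F i = fun n : ℕ => (∑ j ∈ Finset.range (N i), 1 / (n:ℝ) ^ 2 *
        Real.cos (2 * Real.pi * (n * (A i * j ^ 2 + B i * j + c i)))) / lam i := by
      funext n; rw [← Finset.mul_sum, mul_div_assoc]
    rw [e]; exact this
  have h2 : Tendsto (fun i => ∑' n, F i n) l (nhds (∑' n : ℕ, (0:ℝ))) := by
    refine tendsto_tsum_of_dominated_convergence (bound := fun n : ℕ => 1 / (n:ℝ)^2 * K) ?_ ?_ ?_
    · exact (Real.summable_one_div_nat_pow.2 (by norm_num)).mul_right K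
    · intro n
      rcases Nat.eq_zero_or_pos n with h | h
      · simp [hF, h, tendsto_const_nhds]
      have hn : (0:ℝ) < n := by exact_mod_cast h
      have := (weyl_lim (A := fun i => n * A i) (B := fun i => n * B i) (c := fun i => n * c i)
        (A0 := n * A0) hlam ?_ (by positivity) hN).const_mul (1 / (n:ℝ)^2)
      · rw [mul_zero] at this
        refine this.congr (fun i => ?_)
        simp only [hF]
        congr 2
        refine Finset.sum_congr rfl (fun j _ => ?_)
        congr 1; ring
      · exact (hA.const_mul (n:ℝ)).congr (fun i => by ring)
    · filter_upwards [hN, hlam.eventually_gt_atTop 0] with i hNi hl n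
      simp only [hF]
      rw [norm_mul, Real.norm_eq_abs (1 / _), abs_of_nonneg (by positivity), norm_div, Real.norm_eq_abs (lam i), abs_of_pos hl]
      refine mul_le_mul_of_nonneg_left ?_ (by positivity)
      rw [div_le_iff₀ hl]
      refine le_trans ?_ hNi
      refine (norm_sum_le _ _).trans ?_
      refine (Finset.sum_le_card_nsmul _ _ 1 (fun j _ => Real.abs_cos_le_one _)).trans ?_
      simp
  rw [tsum_zero] at h2
  have h3 := h2.const_mul ((Real.pi ^ 2)⁻¹)
  rw [mul_zero] at h3
  refine h3.congr (fun i => ?_)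
  rw [(h1 i).tsum_eq]
  field_simp

lemma fract_lim {ι : Type*} {l : Filter ι} {A B c lam : ι → ℝ} {N : ι → ℕ} {A0 K : ℝ}
    (hlam : Tendsto lam l atTop) (hA : Tendsto (fun i => lam i * A i) l (nhds A0)) (hA0 : A0 ≠ 0)
    (hN : ∀ᶠ i in l, (N i : ℝ) ≤ K * lam i) :
    Tendsto (fun i => (∑ j ∈ Finset.range (N i), (Int.fract (A i * j ^ 2 + B i * j + c i) - 1 / 2)) / lam i)
      l (nhds 0) := by
  rw [Metric.tendsto_nhds]
  intro ε' hε'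
  set K' := max K 1
  have hK' : 0 < K' := lt_of_lt_of_le one_pos (le_max_right _ _)
  obtain ⟨ε, h0, h1, hε⟩ : ∃ ε : ℝ, 0 < ε ∧ ε < 1 ∧ K' * ε < ε' := by
    refine ⟨min (1/2) (ε' / (2 * K')), by positivity, lt_of_le_of_lt (min_le_left _ _) (by norm_num), ?_⟩
    calc K' * min (1/2) (ε' / (2 * K')) ≤ K' * (ε' / (2 * K')) := by gcongr; exact min_le_right _ _
      _ = ε' / 2 := by field_simp
      _ < ε' := by linarith
  have t0 := b2_lim (B := B) (c := c) hlam hA hA0 hN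
  have t1 := b2_lim (B := B) (c := fun i => c i + ε) hlam hA hA0 hN
  have t2 := b2_lim (B := B) (c := fun i => c i - ε) hlam hA hA0 hN
  have u1 := (t1.sub t0).div_const (2 * ε)
  have u2 := (t0.sub t2).div_const (2 * ε)
  simp only [sub_zero, zero_div] at u1 u2
  rw [Metric.tendsto_nhds] at u1 u2
  filter_upwards [u1 (ε'/2) (by positivity), u2 (ε'/2) (by positivity), hN, hlam.eventually_gt_atTop 0] with i h3 h4 hNi hl
  rw [Real.dist_eq, sub_zero, abs_lt] at *
  have hNK : (N i : ℝ) / lam i ≤ K' := by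
    rw [div_le_iff₀ hl]; exact hNi.trans (by gcongr; exact le_max_left _ _)
  have hNε : (N i : ℝ) / lam i * (ε / 2) ≤ K' * (ε / 2) := by gcongr
  have lo : ((∑ j ∈ Finset.range (N i), b2 (A i * j ^ 2 + B i * j + (c i + ε))) / lam i
      - (∑ j ∈ Finset.range (N i), b2 (A i * j ^ 2 + B i * j + c i)) / lam i) / (2 * ε)
      - (N i : ℝ) / lam i * (ε / 2) ≤
      (∑ j ∈ Finset.range (N i), (Int.fract (A i * j ^ 2 + B i * j + c i) - 1 / 2)) / lam i := by
    have := Finset.sum_le_sum (fun j (_ : j ∈ Finset.range (N i)) =>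
      fract_lower (A i * j ^ 2 + B i * j + c i) ε h0 h1)
    rw [Finset.sum_sub_distrib, ← Finset.sum_div, Finset.sum_sub_distrib] at this
    simp only [Finset.sum_const, Finset.card_range, nsmul_eq_mul, add_assoc] at this ⊢
    refine le_trans (le_of_eq ?_) (div_le_div_of_nonneg_right this hl.le)
    ring
  have hi : (∑ j ∈ Finset.range (N i), (Int.fract (A i * j ^ 2 + B i * j + c i) - 1 / 2)) / lam i ≤
     ((∑ j ∈ Finset.range (N i), b2 (A i * j ^ 2 + B i * j + c i)) / lam i -
     (∑ j ∈ Finset.range (N i), b2 (A i * j ^ 2 + B i * j + (c i - ε))) / lam i) / (2 * ε)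
      + (N i : ℝ) / lam i * (ε / 2) := by
    have := Finset.sum_le_sum (fun j (_ : j ∈ Finset.range (N i)) =>
      fract_upper (A i * j ^ 2 + B i * j + c i) ε h0 h1)
    rw [Finset.sum_add_distrib, ← Finset.sum_div, Finset.sum_sub_distrib (f := fun j : ℕ => b2 (A i * (j:ℝ) ^ 2 + B i * j + c i))] at this
    simp only [Finset.sum_const, Finset.card_range, nsmul_eq_mul, add_sub_assoc, add_assoc] at this ⊢
    refine le_trans (div_le_div_of_nonneg_right this hl.le) (le_of_eq ?_)
    ring
  constructor <;> linarith [h3.1, h3.2, h4.1, h4.2]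
end

open Filter
noncomputable section

def strip (p q h : ℝ) (θ : ℝ → ℝ) : Finset (ℤ × ℤ) :=
  ((Finset.Icc ⌈p⌉ ⌊q⌋).sigma fun d => Finset.Icc (⌊θ d - h⌋ + 1) (⌈θ d + h⌉ - 1)).map
    (Equiv.sigmaEquivProd ℤ ℤ).toEmbedding

lemma mem_strip {p q h : ℝ} {θ : ℝ → ℝ} {x : ℤ × ℤ} :
    x ∈ strip p q h θ ↔ p ≤ x.1 ∧ x.1 ≤ q ∧ |x.2 - θ x.1| < h := by
  obtain ⟨d, e⟩ := x
  simp only [strip, Finset.mem_map_equiv, Finset.mem_sigma, Finset.mem_Icc]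
  simp only [Equiv.sigmaEquivProd, Equiv.coe_fn_symm_mk]
  rw [Int.ceil_le, Int.le_floor, Int.add_one_le_iff, Int.floor_lt, Int.le_sub_one_iff, Int.lt_ceil, abs_lt, and_assoc]
  constructor
  · rintro ⟨h1, h2, h3, h4⟩; exact ⟨h1, h2, by linarith, by linarith⟩
  · rintro ⟨h1, h2, h3, h4⟩; exact ⟨h1, h2, by linarith, by linarith⟩

lemma card_window (x h : ℝ) (hh : 0 < h) : ((Finset.Icc (⌊x - h⌋ + 1) (⌈x + h⌉ - 1)).card : ℝ) =
    2 * h + (Int.fract (-x - h) - 1 / 2) + (Int.fract (x - h) - 1 / 2) := by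
  rw [Int.card_Icc]
  have h1 : (⌈x + h⌉ : ℝ) = x + h + Int.fract (-x - h) := by
    have : ⌈x + h⌉ = -⌊-x - h⌋ := by rw [← Int.ceil_neg]; congr 1; ring
    rw [this, Int.fract]; push_cast; ring
  have h2 : (⌊x - h⌋ : ℝ) = x - h - Int.fract (x - h) := by rw [Int.fract]; ring
  have h0 : 0 ≤ ⌈x + h⌉ - 1 + 1 - (⌊x - h⌋ + 1) := by
    have : ⌊x - h⌋ < ⌈x + h⌉ := by
      rw [Int.lt_ceil]; exact (Int.floor_le _).trans_lt (by linarith)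
    omega
  have h3 : (((⌈x + h⌉ - 1 + 1 - (⌊x - h⌋ + 1)).toNat : ℤ) : ℝ) = ⌈x + h⌉ - 1 + 1 - (⌊x - h⌋ + 1) := by
    rw [Int.toNat_of_nonneg h0]; push_cast; ring
  rw [Int.cast_natCast] at h3
  rw [h3, h1, h2]; ring

lemma card_strip (p q h : ℝ) (θ : ℝ → ℝ) (hh : 0 < h) : ((strip p q h θ).card : ℝ) =
    ∑ j ∈ Finset.range (⌊q⌋ + 1 - ⌈p⌉).toNat, (2 * h + (Int.fract (-θ (⌈p⌉ + j) - h) - 1 / 2)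
      + (Int.fract (θ (⌈p⌉ + j) - h) - 1 / 2)) := by
  rw [strip, Finset.card_map, Finset.card_sigma, Int.Icc_eq_finset_map]
  push_cast
  rw [Finset.sum_map]
  refine Finset.sum_congr rfl (fun j _ => ?_)
  rw [card_window _ _ hh]
  simp [addLeftEmbedding]

lemma strip_le (p q h : ℝ) (θ : ℝ → ℝ) (hh : 0 < h) (hpq : p ≤ q + 1) :
    ((strip p q h θ).card : ℝ) ≤ (q - p + 1) * (2 * h + 1) := by
  rw [card_strip _ _ _ _ hh]
  have := Finset.sum_le_card_nsmul (Finset.range (⌊q⌋ + 1 - ⌈p⌉).toNat) (fun j : ℕ => (2 * h + (Int.fract (-θ (⌈p⌉ + j) - h) - 1 / 2)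
      + (Int.fract (θ (⌈p⌉ + j) - h) - 1 / 2))) (2 * h + 1) (fun j _ => by
        linarith [Int.fract_lt_one (-θ (⌈p⌉ + j) - h), Int.fract_lt_one (θ (⌈p⌉ + j) - h)])
  refine this.trans ?_
  rw [nsmul_eq_mul, Finset.card_range]
  refine mul_le_mul_of_nonneg_right ?_ (by linarith)
  have h3 : (((⌊q⌋ + 1 - ⌈p⌉).toNat : ℤ) : ℝ) ≤ q - p + 1 := by
    rw [Int.toNat_eq_max]; push_cast
    refine max_le ?_ (by linarith)
    linarith [Int.floor_le q, Int.le_ceil p]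
  exact_mod_cast h3

lemma strip_lim {ι : Type*} {l : Filter ι} {A B c lam h : ι → ℝ} {A0 h0 p q : ℝ} {P Q : ι → ℝ}
    (hlam : Tendsto lam l atTop) (hA : Tendsto (fun i => lam i * A i) l (nhds A0)) (hA0 : A0 ≠ 0)
    (hh : Tendsto h l (nhds h0)) (hh0 : 0 < h0) (hpq : p ≤ q)
    (hP : ∀ i, P i = lam i * p) (hQ : ∀ i, Q i = lam i * q) :
    Tendsto (fun i => ((strip (P i) (Q i) (h i) (fun d => A i * d ^ 2 + B i * d + c i)).card : ℝ) / lam i) l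
      (nhds (2 * h0 * (q - p))) := by
  set N : ι → ℕ := fun i => (⌊Q i⌋ + 1 - ⌈P i⌉).toNat with hN
  have hNb : ∀ᶠ i in l, lam i * (q - p) - 1 ≤ N i ∧ (N i : ℝ) ≤ lam i * (q - p) + 1 := by
    filter_upwards [hlam.eventually_gt_atTop 0] with i hl
    have e : ((N i : ℤ) : ℝ) = max ((⌊Q i⌋ : ℝ) + 1 - ⌈P i⌉) 0 := by
      rw [hN]; simp only []; rw [Int.toNat_eq_max]; push_cast; rfl
    rw [Int.cast_natCast] at e
    rw [e]
    have := Int.floor_le (Q i); have := Int.lt_floor_add_one (Q i)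
    have := Int.le_ceil (P i); have := Int.ceil_lt_add_one (P i)
    have := hP i; have := hQ i
    have : 0 ≤ lam i * (q - p) := by apply mul_nonneg hl.le; linarith
    constructor
    · refine le_trans ?_ (le_max_left _ _); nlinarith
    · apply max_le <;> nlinarith
  have hinv : Tendsto (fun i => (lam i)⁻¹) l (nhds 0) := tendsto_inv_atTop_zero.comp hlam
  have hNlim : Tendsto (fun i => (N i : ℝ) / lam i) l (nhds (q - p)) := by
    have e1 : Tendsto (fun i => (q - p) - (lam i)⁻¹) l (nhds (q - p)) := by simpa using hinv.const_sub (q - p)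
    have e2 : Tendsto (fun i => (q - p) + (lam i)⁻¹) l (nhds (q - p)) := by simpa using hinv.const_add (q - p)
    refine tendsto_of_tendsto_of_tendsto_of_le_of_le' e1 e2 ?_ ?_
    · filter_upwards [hNb, hlam.eventually_gt_atTop 0] with i hi hl
      rw [le_div_iff₀ hl, sub_mul, inv_mul_cancel₀ hl.ne']; linarith [hi.1]
    · filter_upwards [hNb, hlam.eventually_gt_atTop 0] with i hi hl
      rw [div_le_iff₀ hl, add_mul, inv_mul_cancel₀ hl.ne']; linarith [hi.2]
  have hNK : ∀ᶠ i in l, (N i : ℝ) ≤ (q - p + 1) * lam i := by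
    filter_upwards [hNb, hlam.eventually_ge_atTop 1] with i hi hl
    nlinarith [hi.2]
  have t1 := fract_lim (A := fun i => - A i) (B := fun i => -(2 * A i * ⌈P i⌉ + B i))
    (c := fun i => -(A i * ⌈P i⌉ ^ 2 + B i * ⌈P i⌉ + c i) - h i) (A0 := -A0) hlam
    (by simpa using hA.neg) (neg_ne_zero.2 hA0) hNK
  have t2 := fract_lim (A := A) (B := fun i => (2 * A i * ⌈P i⌉ + B i))
    (c := fun i => (A i * ⌈P i⌉ ^ 2 + B i * ⌈P i⌉ + c i) - h i) hlam hA hA0 hNK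
  have t3 := ((hh.const_mul 2).mul hNlim).add (t1.add t2)
  rw [add_zero, add_zero] at t3
  refine t3.congr' ?_
  filter_upwards [hh.eventually (lt_mem_nhds hh0)] with i hi
  rw [card_strip _ _ _ _ hi, ← add_div, ← Finset.sum_add_distrib, ← mul_div_assoc, ← add_div]
  congr 1
  have : 2 * h i * (N i : ℝ) = ∑ j ∈ Finset.range (N i), 2 * h i := by
    rw [Finset.sum_const, Finset.card_range, nsmul_eq_mul]; ring
  rw [this, ← Finset.sum_add_distrib]
  refine Finset.sum_congr rfl (fun j _ => ?_)
  have e1 : -A i * (j:ℝ) ^ 2 + -(2 * A i * ⌈P i⌉ + B i) * j + (-(A i * ⌈P i⌉ ^ 2 + B i * ⌈P i⌉ + c i) - h i)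
    = -(A i * (⌈P i⌉ + j) ^ 2 + B i * (⌈P i⌉ + j) + c i) - h i := by ring
  have e2 : A i * (j:ℝ) ^ 2 + (2 * A i * ⌈P i⌉ + B i) * j + ((A i * ⌈P i⌉ ^ 2 + B i * ⌈P i⌉ + c i) - h i)
    = (A i * (⌈P i⌉ + j) ^ 2 + B i * (⌈P i⌉ + j) + c i) - h i := by ring
  rw [e1, e2]; ring
end

open Filter
noncomputable section

def Ir (a b c d e : ℝ) : ℝ := 12 * a * e - 3 * b * d + c ^ 2
def Jr (a b c d e : ℝ) : ℝ :=
  72 * a * c * e + 9 * b * c * d - 27 * a * d ^ 2 - 27 * e * b ^ 2 - 2 * c ^ 3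
def Par (a b c d e u w m : ℝ) : Prop :=
  c = m - 3 * u * b - 6 * u ^ 2 * a ∧
  d = w * (b + 4 * u * a) + 3 * u ^ 2 * b + 8 * u ^ 3 * a - 2 * u * m ∧
  e = (u ^ 2 + w) * (m - a * (u ^ 2 + w) - u * (b + 2 * u * a))
def Dv (a b u w m : ℝ) : ℝ := w * (b + 4 * u * a) ^ 2 - 4 * w * a * m + 4 * w ^ 2 * a ^ 2
def Dl (a b c : ℝ) : ℝ := 8 * a * c - 3 * b ^ 2

lemma Par.I {a b c d e u w m : ℝ} (h : Par a b c d e u w m) : Ir a b c d e = m ^ 2 - 3 * Dv a b u w m := by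
  obtain ⟨rfl, rfl, rfl⟩ := h; unfold Ir Dv; ring
lemma Par.J {a b c d e u w m : ℝ} (h : Par a b c d e u w m) :
    Jr a b c d e = -2 * m * (9 * Dv a b u w m + m ^ 2) := by
  obtain ⟨rfl, rfl, rfl⟩ := h; unfold Jr Dv; ring
lemma Par.Dl {a b c d e u w m : ℝ} (h : Par a b c d e u w m) :
    Dl a b c = 8 * a * m - 3 * (b + 4 * u * a) ^ 2 := by
  obtain ⟨rfl, rfl, rfl⟩ := h; unfold _root_.Dl; ring
lemma J_lin {a b c : ℝ} (d e : ℝ) (h : Dl a b c ≠ 0) : Jr a b c d e = 9 * Dl a b c *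
    (e - (3 * a / Dl a b c * d ^ 2 + -(b * c) / Dl a b c * d + 2 * c ^ 3 / (9 * Dl a b c))) := by
  have : Jr a b c d e = 9 * Dl a b c * e - (27 * a * d ^ 2 - 9 * b * c * d + 2 * c ^ 3) := by
    unfold Jr Dl; ring
  rw [this]; field_simp; ring

def RU (η C L a b c d e : ℝ) : Prop := ∃ u w m, Par a b c d e u w m ∧ 0 ≤ u ∧ u ≤ 1 / 2 ∧
  1 ≤ u ^ 2 + w ∧ 0 < Dv a b u w m ∧ |Ir a b c d e| < L ^ 2 ∧ |Jr a b c d e| < C * L ^ 2 ∧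
  η * L < |a| ∧ η * L ^ 2 < |Dl a b c| ∧ 0 ≤ b + 4 * u * a

def RL (η C L a b c d e : ℝ) : Prop := ∃ u w m, Par a b c d e u w m ∧ 0 < u ∧ u < 1 / 2 ∧
  1 < u ^ 2 + w ∧ 0 < Dv a b u w m ∧ |Ir a b c d e| < L ^ 2 ∧ |Jr a b c d e| < C * L ^ 2 ∧
  η * L < |a| ∧ η * L ^ 2 < |Dl a b c| ∧ 0 < b + 4 * u * a

def L0 (η C : ℝ) : ℝ := 10 * C / η ^ 3 + C / η ^ 2 + 1

set_option maxHeartbeats 1000000 in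
lemma main_bounds {η C L a b c d e u w m : ℝ} (hη : 0 < η) (hC : 0 < C) (hL : L0 η C ≤ L)
    (hP : Par a b c d e u w m) (hu0 : 0 ≤ u) (hu1 : u ≤ 1 / 2) (hw : 1 ≤ u ^ 2 + w)
    (hD : 0 < Dv a b u w m) (hI : |Ir a b c d e| < L ^ 2) (hJ : |Jr a b c d e| < C * L ^ 2)
    (ha : η * L < |a|) :
    |m| ≤ C / η ^ 2 ∧ 3 / 4 ≤ w ∧ w ≤ 1 / η ∧ |b + 4 * u * a| ≤ 2 * L ∧ |a| ≤ L ∧ |b| ≤ 4 * L ∧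
    |c| ≤ 9 * L ∧ |d| ≤ (2 / η + 5) * L ∧ 2 * w ^ 2 * a ^ 2 ≤ Dv a b u w m := by
  have hL1 : 1 ≤ L := by
    refine le_trans ?_ hL; unfold L0
    have : 0 < 10 * C / η ^ 3 + C / η ^ 2 := by positivity
    linarith
  have hLM : C / η ^ 2 ≤ L := by
    refine le_trans ?_ hL; unfold L0
    have : 0 < 10 * C / η ^ 3 := by positivity
    linarith
  have hL3 : 10 * C ≤ η ^ 3 * L := by
    have : 10 * C / η ^ 3 ≤ L := by
      refine le_trans ?_ hL; unfold L0
      have : 0 < C / η ^ 2 := by positivity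
      linarith
    rw [div_le_iff₀ (by positivity)] at this; linarith
  have hw4 : 3 / 4 ≤ w := by nlinarith only [hu0, hu1, hw]
  have ha0 : 0 < |a| := lt_trans (by positivity) ha
  rw [hP.J, abs_mul, abs_mul, abs_neg, abs_two, abs_of_pos (by positivity : 0 < 9 * Dv a b u w m + m ^ 2)] at hJ
  set D := Dv a b u w m with hDdef
  have hm0 := abs_nonneg m
  have hm3 : 2 * |m| ^ 3 < C * L ^ 2 := by
    have : |m| ^ 3 = |m| * m ^ 2 := by rw [← sq_abs m]; ring
    nlinarith only [mul_nonneg hm0 hD.le, this, hJ]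
  have hma : |m| ≤ 3 / 8 * (η * L) := by
    by_contra h
    push Not at h
    have h1 : (3 / 8 * (η * L)) ^ 3 < |m| ^ 3 := by gcongr
    have h2 : 10 * C * L ^ 2 ≤ η ^ 3 * L * L ^ 2 := by gcongr
    nlinarith only [mul_pos hC (pow_pos (lt_of_lt_of_le one_pos hL1) 2), h1, h2, hm3]
  have hwa : 3 / 4 * |a| ≤ w * |a| := by gcongr
  have hmw : 2 * |m| ≤ w * |a| := by linarith only [hma, hwa, ha]
  have hDge : w * (b + 4 * u * a) ^ 2 + 2 * w ^ 2 * a ^ 2 ≤ D := by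
    have e1 : a * m ≤ |a| * |m| := by rw [← abs_mul]; exact le_abs_self _
    have e2 : w * (a * m) ≤ w * (|a| * |m|) := by gcongr
    have e3 : w * |a| * (2 * |m|) ≤ w * |a| * (w * |a|) := by gcongr
    have e4 : a ^ 2 = |a| ^ 2 := (sq_abs a).symm
    rw [hDdef]; unfold Dv; rw [e4]; nlinarith only [e2, e3]
  have hw0 : 0 < w := by linarith
  have hDge2 : 2 * w ^ 2 * a ^ 2 ≤ D := by linarith only [hDge, mul_nonneg hw0.le (sq_nonneg (b + 4 * u * a))]
  have e5 : 2 * w ^ 2 * a ^ 2 = 2 * (w * |a|) ^ 2 := by rw [mul_pow, sq_abs]; ring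
  have hDη : η ^ 2 * L ^ 2 ≤ D := by
    have : (3/4 * (η * L)) ^ 2 ≤ (w * |a|) ^ 2 := by gcongr
    nlinarith only [mul_pos (pow_pos hη 2) (pow_pos (lt_of_lt_of_le one_pos hL1) 2), this, hDge2, e5]
  have hmM : |m| ≤ C / η ^ 2 := by
    rw [le_div_iff₀ (by positivity)]
    have h1 : |m| * (η ^ 2 * L ^ 2) ≤ |m| * D := by gcongr
    have h2 : 0 ≤ |m| * m ^ 2 := by positivity
    have hLL : 0 < L ^ 2 := by positivity
    have : |m| * η ^ 2 * L ^ 2 ≤ C * L ^ 2 := by linarith only [mul_nonneg hm0 hD.le, h1, h2, hJ]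
    exact le_of_mul_le_mul_right this hLL
  have hmL : |m| ≤ L := hmM.trans hLM
  have hDL : D ≤ L ^ 2 := by
    rw [hP.I, abs_lt] at hI
    have : m ^ 2 ≤ L ^ 2 := by rw [← sq_abs m]; gcongr
    linarith [hI.1]
  have hwaL : w * |a| ≤ L := by
    refine abs_le_of_sq_le_sq' (by linarith only [sq_nonneg (w * |a|), e5, hDge2, hDL]) (by linarith) |>.2
  have hs : |b + 4 * u * a| ≤ 2 * L := by
    apply abs_le_of_sq_le_sq _ (by linarith)
    have h1 : 3 / 4 * (b + 4 * u * a) ^ 2 ≤ w * (b + 4 * u * a) ^ 2 := by gcongr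
    have h2 : 0 ≤ 2 * w ^ 2 * a ^ 2 := by positivity
    have h3 := sq_nonneg L
    have h4 : (2 * L) ^ 2 = 4 * L ^ 2 := by ring
    linarith
  have haL : |a| ≤ L := by
    apply abs_le_of_sq_le_sq _ (by linarith)
    have : (3/4 * |a|) ^ 2 ≤ (w * |a|) ^ 2 := by gcongr
    rw [mul_pow, sq_abs] at this
    linarith only [sq_nonneg a, this, e5, hDge2, hDL]
  have hwη : w ≤ 1 / η := by
    rw [le_div_iff₀ hη]
    have : w * (η * L) ≤ L := le_trans (by gcongr) hwaL
    by_contra h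
    nlinarith only [this, h, hL1]
  have hb : |b| ≤ 4 * L := by
    have : |4 * u * a| ≤ 2 * L := by
      rw [abs_mul, abs_of_nonneg (by positivity : 0 ≤ 4 * u)]; nlinarith only [hu0, hu1, haL, ha0]
    calc |b| = |(b + 4 * u * a) - 4 * u * a| := by ring_nf
      _ ≤ _ := abs_sub _ _
      _ ≤ _ := by linarith
  have hub : |u * b| ≤ 2 * L := by rw [abs_mul, abs_of_nonneg hu0]; nlinarith only [abs_nonneg b, hu0, hu1, hb]
  have hu2 : u ^ 2 ≤ 1 / 4 := by nlinarith only [hu0, hu1]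
  have hua : |u ^ 2 * a| ≤ L / 4 := by
    rw [abs_mul, abs_of_nonneg (sq_nonneg u)]; nlinarith only [hu2, haL, ha0]
  have hcc : |c| ≤ 9 * L := by
    rw [hP.1]; rw [abs_le] at *; constructor <;> linarith only [hub.1, hub.2, hua.1, hua.2, hmL.1, hmL.2]
  refine ⟨hmM, hw4, hwη, hs, haL, hb, hcc, ?_, hDge2⟩
  have h1 : |w * (b + 4 * u * a)| ≤ 2 / η * L := by
    rw [abs_mul, abs_of_pos hw0]
    calc w * |b + 4 * u * a| ≤ 1 / η * (2 * L) := by gcongr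
      _ = _ := by ring
  have h2 : |u * (u * b)| ≤ L := by rw [abs_mul, abs_of_nonneg hu0]; nlinarith only [abs_nonneg (u * b), hu0, hu1, hub]
  have h3 : |u * (u ^ 2 * a)| ≤ L / 8 := by rw [abs_mul, abs_of_nonneg hu0]; nlinarith only [abs_nonneg (u^2 * a), hu0, hu1, hua]
  have h4 : |u * m| ≤ L / 2 := by rw [abs_mul, abs_of_nonneg hu0]; nlinarith only [hu0, hu1, hmL, hm0]
  have e : d = w * (b + 4 * u * a) + 3 * (u * (u * b)) + 8 * (u * (u ^ 2 * a)) - 2 * (u * m) := by rw [hP.2.1]; ring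
  have h5 : (2 / η + 5) * L = 2 / η * L + 5 * L := by ring
  rw [h5, e]; rw [abs_le] at *
  constructor <;> linarith only [hL1, h1.1, h1.2, h2.1, h2.2, h3.1, h3.2, h4.1, h4.2]
end

open Filter Topology
noncomputable section

def sg (α β γ : ℝ) : ℝ := √(-Dl α β γ / 3)
def uu (α β γ : ℝ) : ℝ := (sg α β γ - β) / (4 * α)
def w2 (α s : ℝ) : ℝ := (-s ^ 2 + √(s ^ 4 + 16 * α ^ 2 / 3)) / (8 * α ^ 2)
def dd (α β u s w : ℝ) : ℝ := w * s + 3 * u ^ 2 * β + 8 * u ^ 3 * α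

lemma w2_pos {α s : ℝ} (hα : α ≠ 0) : 0 < w2 α s := by
  have : 0 < α ^ 2 := by positivity
  refine div_pos ?_ (by positivity)
  have : s ^ 2 < √(s ^ 4 + 16 * α ^ 2 / 3) := Real.lt_sqrt_of_sq_lt (by nlinarith only [this])
  linarith
lemma w2_eq {α s : ℝ} (hα : α ≠ 0) : w2 α s * s ^ 2 + 4 * w2 α s ^ 2 * α ^ 2 = 1 / 3 := by
  have h := Real.sq_sqrt (show 0 ≤ s ^ 4 + 16 * α ^ 2 / 3 by positivity)
  unfold w2
  set r := √(s ^ 4 + 16 * α ^ 2 / 3)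
  field_simp
  nlinarith only [h]
lemma lt_w2 {α s w : ℝ} (hα : α ≠ 0) (hw : 0 < w) : w < w2 α s ↔ w * s ^ 2 + 4 * w ^ 2 * α ^ 2 < 1 / 3 := by
  have h1 := w2_pos (s := s) hα
  have h2 := w2_eq (s := s) hα
  have ha : 0 < α ^ 2 := by positivity
  constructor
  · intro h
    have h3 : w * s ^ 2 ≤ w2 α s * s ^ 2 := by gcongr
    have h4 : w ^ 2 * α ^ 2 < w2 α s ^ 2 * α ^ 2 := by gcongr
    linarith only [h2, h3, h4]
  · intro h
    by_contra hh
    push Not at hh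
    have h3 : w2 α s * s ^ 2 ≤ w * s ^ 2 := by gcongr
    have h4 : w2 α s ^ 2 * α ^ 2 ≤ w ^ 2 * α ^ 2 := by gcongr
    linarith only [h2, h3, h4, h]

lemma lim_Dl {ι : Type*} {F : Filter ι} {lam a b c : ι → ℝ} {α β γ : ℝ}
    (hl : Tendsto lam F atTop)
    (ha : Tendsto (fun i => a i / lam i) F (𝓝 α)) (hb : Tendsto (fun i => b i / lam i) F (𝓝 β))
    (hc : Tendsto (fun i => c i / lam i) F (𝓝 γ)) :
    Tendsto (fun i => Dl (a i) (b i) (c i) / lam i ^ 2) F (𝓝 (Dl α β γ)) := by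
  have := ((ha.const_mul 8).mul hc).sub ((hb.pow 2).const_mul 3)
  refine this.congr' ?_
  filter_upwards [hl.eventually_gt_atTop 0] with i hi
  unfold Dl; field_simp

lemma U_ultra {ι : Type*} {F : Ultrafilter ι} {lam a b c d e : ι → ℝ} {α β γ η C : ℝ} (hη : 0 < η) (hC : 0 < C)
    (hl : Tendsto lam F atTop)
    (ha : Tendsto (fun i => a i / lam i) F (𝓝 α)) (hb : Tendsto (fun i => b i / lam i) F (𝓝 β))
    (hc : Tendsto (fun i => c i / lam i) F (𝓝 γ))
    (hR : ∀ᶠ i in F, RU η C (lam i) (a i) (b i) (c i) (d i) (e i)) :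
    η ≤ |α| ∧ Dl α β γ ≤ -η ∧ 0 ≤ uu α β γ ∧ uu α β γ ≤ 1 / 2 ∧
    ∃ w0, 3 / 4 ≤ w0 ∧ 1 - uu α β γ ^ 2 ≤ w0 ∧ w0 ≤ w2 α (sg α β γ) ∧
      Tendsto (fun i => d i / lam i) F (𝓝 (dd α β (uu α β γ) (sg α β γ) w0)) := by
  have h1 : ∀ i, RU η C (lam i) (a i) (b i) (c i) (d i) (e i) → _ := fun i h => h
  unfold RU at h1
  choose! u w m hp using h1
  have hpos := hl.eventually_gt_atTop 0
  have hbd := (hR.and (hl.eventually_ge_atTop (L0 η C))).mono fun i hi =>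
    main_bounds hη hC hi.2 (hp i hi.1).1 (hp i hi.1).2.1 (hp i hi.1).2.2.1 (hp i hi.1).2.2.2.1
      (hp i hi.1).2.2.2.2.1 (hp i hi.1).2.2.2.2.2.1 (hp i hi.1).2.2.2.2.2.2.1 (hp i hi.1).2.2.2.2.2.2.2.1
  have hinv : Tendsto (fun i => (lam i)⁻¹) F (𝓝 0) := tendsto_inv_atTop_zero.comp hl
  have hm : Tendsto (fun i => m i / lam i) F (𝓝 0) := by
    have := hinv.const_mul (C / η ^ 2)
    rw [mul_zero] at this
    refine squeeze_zero_norm' ?_ this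
    filter_upwards [hbd, hpos] with i hi hl0
    rw [norm_div, Real.norm_eq_abs, Real.norm_eq_abs, abs_of_pos hl0, div_eq_mul_inv]
    have := hi.1
    gcongr
  have hΔ := lim_Dl hl ha hb hc
  have hs2 : Tendsto (fun i => ((b i + 4 * u i * a i) / lam i) ^ 2) F (𝓝 (-Dl α β γ / 3)) := by
    have := (((ha.const_mul 8).mul hm).sub hΔ).div_const 3
    rw [mul_zero, zero_sub] at this
    refine this.congr' ?_
    filter_upwards [hR, hpos] with i hi hl0
    rw [(hp i hi).1.Dl]; field_simp; ring
  have hs : Tendsto (fun i => (b i + 4 * u i * a i) / lam i) F (𝓝 (sg α β γ)) := by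
    refine hs2.sqrt.congr' ?_
    filter_upwards [hR, hpos] with i hi hl0
    exact Real.sqrt_sq (div_nonneg (hp i hi).2.2.2.2.2.2.2.2.2 hl0.le)
  have hα : η ≤ |α| := by
    refine ge_of_tendsto ha.abs ?_
    filter_upwards [hR, hpos] with i hi hl0
    rw [abs_div, abs_of_pos hl0, le_div_iff₀ hl0]; exact (hp i hi).2.2.2.2.2.2.2.1.le
  have hα0 : α ≠ 0 := by intro h; rw [h, abs_zero] at hα; linarith
  have hΔ1 : η ≤ |Dl α β γ| := by
    refine ge_of_tendsto hΔ.abs ?_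
    filter_upwards [hR, hpos] with i hi hl0
    rw [abs_div, abs_of_pos (by positivity : 0 < lam i ^ 2), le_div_iff₀ (by positivity)]
    exact (hp i hi).2.2.2.2.2.2.2.2.1.le
  have hΔ2 : 0 ≤ -Dl α β γ / 3 := ge_of_tendsto hs2 (Eventually.of_forall fun i => sq_nonneg _)
  have hΔ3 : Dl α β γ ≤ -η := by
    rw [abs_of_nonpos (by linarith)] at hΔ1; linarith
  have hu : Tendsto u F (𝓝 (uu α β γ)) := by
    have := (hs.sub hb).div (ha.const_mul 4) (by simpa using hα0)
    refine this.congr' ?_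
    filter_upwards [hR, hpos, ha.eventually_ne hα0] with i hi hl0 ha0
    have ha1 : a i ≠ 0 := by intro h; simp [h] at ha0
    simp only [Pi.div_apply]
    field_simp; ring
  obtain ⟨w0, hw0m, hw0⟩ : ∃ w0 ∈ Set.Icc (3/4 : ℝ) (1 / η), Tendsto w F (𝓝 w0) := by
    have := isCompact_Icc.ultrafilter_le_nhds' (F.map w) (s := Set.Icc (3/4 : ℝ) (1 / η))
      (Filter.mem_map.2 (hbd.mono fun i hi => ⟨hi.2.1, hi.2.2.1⟩))
    exact this
  refine ⟨hα, hΔ3, ge_of_tendsto hu (hR.mono fun i hi => (hp i hi).2.1),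
    le_of_tendsto hu (hR.mono fun i hi => (hp i hi).2.2.1), w0, hw0m.1, ?_, ?_, ?_⟩
  · refine le_of_tendsto_of_tendsto ((hu.pow 2).const_sub 1) hw0 ?_
    filter_upwards [hR] with i hi
    have := (hp i hi).2.2.2.1; linarith
  · by_contra hcon
    push Not at hcon
    have hD : Tendsto (fun i => Dv (a i) (b i) (u i) (w i) (m i) / lam i ^ 2) F
        (𝓝 (w0 * sg α β γ ^ 2 + 4 * w0 ^ 2 * α ^ 2)) := by
      have := ((hw0.mul (hs.pow 2)).sub (((hw0.const_mul 4).mul ha).mul hm)).add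
        (((hw0.pow 2).const_mul 4).mul (ha.pow 2))
      rw [mul_zero, sub_zero] at this
      refine this.congr' ?_
      filter_upwards [hpos] with i hl0
      unfold Dv; field_simp
    have h2 : 1 / 3 < w0 * sg α β γ ^ 2 + 4 * w0 ^ 2 * α ^ 2 := by
      have h1 := w2_pos (s := sg α β γ) hα0
      rw [← w2_eq (s := sg α β γ) hα0]
      have h3 : w2 α (sg α β γ) * sg α β γ ^ 2 ≤ w0 * sg α β γ ^ 2 := by gcongr
      have ha : 0 < α ^ 2 := by positivity
      have h4 : w2 α (sg α β γ) ^ 2 * α ^ 2 < w0 ^ 2 * α ^ 2 := by gcongr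
      linarith only [h3, h4]
    have h3 : 3 * (w0 * sg α β γ ^ 2 + 4 * w0 ^ 2 * α ^ 2) - 0 ^ 2 ≤ 1 := by
      refine le_of_tendsto ((hD.const_mul 3).sub (hm.pow 2)) ?_
      filter_upwards [hR, hpos] with i hi hl0
      have := (hp i hi).2.2.2.2.2.1
      rw [(hp i hi).1.I, abs_lt] at this
      have e : 3 * (Dv (a i) (b i) (u i) (w i) (m i) / lam i ^ 2) - (m i / lam i) ^ 2 =
        (3 * Dv (a i) (b i) (u i) (w i) (m i) - m i ^ 2) / lam i ^ 2 := by ring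
      rw [e, div_le_one (by positivity)]
      linarith [this.1]
    linarith
  · have := ((hw0.mul hs).add (((hu.pow 2).const_mul 3).mul hb)).add (((hu.pow 3).const_mul 8).mul ha)
    have := this.sub ((hu.const_mul 2).mul hm)
    rw [mul_zero, sub_zero] at this
    refine this.congr' ?_
    filter_upwards [hR, hpos] with i hi hl0
    rw [(hp i hi).1.2.1]; field_simp
end

open Filter Topology
noncomputable section

lemma Par_of_m {a b c d m : ℝ} (ha : a ≠ 0) (hs : 0 < 8 * a * m - Dl a b c) :
    let s := √((8 * a * m - Dl a b c) / 3); let u := (s - b) / (4 * a)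
    let w := (d - 3 * u ^ 2 * b - 8 * u ^ 3 * a + 2 * u * m) / s
    b + 4 * u * a = s ∧ ∃ e, Par a b c d e u w m := by
  intro s u w
  have hs0 : 0 < s := Real.sqrt_pos.2 (by positivity)
  have hss : s ^ 2 = (8 * a * m - Dl a b c) / 3 := Real.sq_sqrt (by positivity)
  have h1 : b + 4 * u * a = s := by simp only [u]; field_simp; ring
  refine ⟨h1, _, ?_, ?_, rfl⟩
  · unfold Dl at hss
    have : 8 * a * c = 8 * a * (m - 3 * u * b - 6 * u ^ 2 * a) := by rw [← h1] at hss; linarith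
    exact mul_left_cancel₀ (by positivity) this
  · rw [h1]; simp only [w]; field_simp; ring

lemma L_ultra {ι : Type*} {F : Ultrafilter ι} {lam a b c d e : ι → ℝ} {α β γ η C w0 : ℝ} (hC : 0 < C)
    (hη : 0 < η) (hl : Tendsto lam F atTop)
    (ha : Tendsto (fun i => a i / lam i) F (𝓝 α)) (hb : Tendsto (fun i => b i / lam i) F (𝓝 β))
    (hc : Tendsto (fun i => c i / lam i) F (𝓝 γ))
    (hα : η < |α|) (hΔ : Dl α β γ < -η) (hu0 : 0 < uu α β γ) (hu1 : uu α β γ < 1 / 2)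
    (hw1 : 1 - uu α β γ ^ 2 < w0) (hw2 : w0 < w2 α (sg α β γ))
    (hd : Tendsto (fun i => d i / lam i) F (𝓝 (dd α β (uu α β γ) (sg α β γ) w0)))
    (hJ : ∀ᶠ i in F, |Jr (a i) (b i) (c i) (d i) (e i)| < C * lam i ^ 2) :
    ∀ᶠ i in F, RL η C (lam i) (a i) (b i) (c i) (d i) (e i) := by
  have hw0 : 0 < w0 := by nlinarith
  have hα0 : α ≠ 0 := by intro h; rw [h, abs_zero] at hα; linarith
  have hpos := hl.eventually_gt_atTop 0
  set σ := sg α β γ with hσ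
  set D0 := w0 * σ ^ 2 + 4 * w0 ^ 2 * α ^ 2 with hD0
  have hD0pos : 0 < D0 := by positivity
  have hD03 : D0 < 1 / 3 := (lt_w2 hα0 hw0).1 hw2
  have hσpos : 0 < σ := Real.sqrt_pos.2 (by linarith)
  set M := C / D0 with hM
  have hM0 : 0 < M := by positivity
  have hinv : Tendsto (fun i => (lam i)⁻¹) F (𝓝 0) := tendsto_inv_atTop_zero.comp hl
  have hΔl := lim_Dl hl ha hb hc
  have haη : ∀ᶠ i in F, η * lam i < |a i| := by
    filter_upwards [ha.abs.eventually (lt_mem_nhds hα), hpos] with i hi hl0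
    rwa [abs_div, abs_of_pos hl0, lt_div_iff₀ hl0] at hi
  have hΔη : ∀ᶠ i in F, η * lam i ^ 2 < -Dl (a i) (b i) (c i) := by
    filter_upwards [hΔl.eventually (gt_mem_nhds hΔ), hpos] with i hi hl0
    rw [div_lt_iff₀ (by positivity)] at hi; linarith
  -- functions of m
  set S : ι → ℝ → ℝ := fun i m => √((8 * a i * m - Dl (a i) (b i) (c i)) / 3)
  set U : ι → ℝ → ℝ := fun i m => (S i m - b i) / (4 * a i)
  set W : ι → ℝ → ℝ := fun i m => (d i - 3 * U i m ^ 2 * b i - 8 * U i m ^ 3 * a i + 2 * U i m * m) / S i m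
  set DD : ι → ℝ → ℝ := fun i m => Dv (a i) (b i) (U i m) (W i m) m
  have key : ∀ m : ι → ℝ, (∀ᶠ i in F, |m i| ≤ M) →
      (Tendsto (fun i => U i (m i)) F (𝓝 (uu α β γ)) ∧ Tendsto (fun i => W i (m i)) F (𝓝 w0) ∧
      Tendsto (fun i => DD i (m i) / lam i ^ 2) F (𝓝 D0) ∧ Tendsto (fun i => m i / lam i) F (𝓝 0)) ∧
      ∀ᶠ i in F, 0 < 8 * a i * m i - Dl (a i) (b i) (c i) := by
    intro m hmM
    have hm : Tendsto (fun i => m i / lam i) F (𝓝 0) := by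
      have := hinv.const_mul M
      rw [mul_zero] at this
      refine squeeze_zero_norm' ?_ this
      filter_upwards [hmM, hpos] with i hi hl0
      rw [norm_div, Real.norm_eq_abs, Real.norm_eq_abs, abs_of_pos hl0, div_eq_mul_inv]
      gcongr
    have hq : Tendsto (fun i => (8 * a i * m i - Dl (a i) (b i) (c i)) / 3 / lam i ^ 2) F (𝓝 (-Dl α β γ / 3)) := by
      have := (((ha.const_mul 8).mul hm).sub hΔl).div_const 3
      rw [mul_zero, zero_sub] at this
      refine this.congr' ?_
      filter_upwards [hpos] with i hl0
      field_simp
    have hqpos : ∀ᶠ i in F, 0 < 8 * a i * m i - Dl (a i) (b i) (c i) := by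
      filter_upwards [hq.eventually (lt_mem_nhds (show (0:ℝ) < -Dl α β γ / 3 by linarith)), hpos] with i hi hl0
      rw [lt_div_iff₀ (by positivity), lt_div_iff₀ (by positivity)] at hi; linarith
    have hS : Tendsto (fun i => S i (m i) / lam i) F (𝓝 σ) := by
      refine hq.sqrt.congr' ?_
      filter_upwards [hpos] with i hl0
      rw [Real.sqrt_div' _ (by positivity), Real.sqrt_sq hl0.le]
    have hane : ∀ᶠ i in F, a i ≠ 0 := by
      filter_upwards [ha.eventually_ne hα0] with i hi h; simp [h] at hi
    have hU : Tendsto (fun i => U i (m i)) F (𝓝 (uu α β γ)) := by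
      have := (hS.sub hb).div (ha.const_mul 4) (by simpa using hα0)
      refine this.congr' ?_
      filter_upwards [hpos, hane] with i hl0 ha1
      simp only [Pi.div_apply, U]
      field_simp
    have hW : Tendsto (fun i => W i (m i)) F (𝓝 w0) := by
      have := (((hd.sub (((hU.pow 2).const_mul 3).mul hb)).sub (((hU.pow 3).const_mul 8).mul ha)).add
        ((hU.const_mul 2).mul hm)).div hS hσpos.ne'
      have e : (dd α β (uu α β γ) σ w0 - 3 * uu α β γ ^ 2 * β - 8 * uu α β γ ^ 3 * α + 2 * uu α β γ * 0) / σ = w0 := by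
        unfold dd; field_simp; ring
      rw [e] at this
      refine this.congr' ?_
      filter_upwards [hpos, hqpos] with i hl0 hq0
      have : 0 < S i (m i) := Real.sqrt_pos.2 (by positivity)
      simp only [Pi.div_apply, W]
      field_simp
    refine ⟨⟨hU, hW, ?_, hm⟩, hqpos⟩
    have := ((hW.mul (hS.pow 2)).sub (((hW.const_mul 4).mul ha).mul hm)).add
      (((hW.pow 2).const_mul 4).mul (ha.pow 2))
    rw [mul_zero, sub_zero] at this
    refine this.congr' ?_
    filter_upwards [hpos, hane, hqpos] with i hl0 ha0 hq0
    simp only [DD]; unfold Dv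
    have := (Par_of_m (d := d i) ha0 hq0).1
    simp only [U, S] at *
    rw [this]
    field_simp
  -- endpoint values
  have kJ : ∀ m : ι → ℝ, (∀ i, |m i| ≤ M) → Tendsto (fun i => (9 * DD i (m i) + m i ^ 2) / lam i ^ 2) F (𝓝 (9 * D0)) := by
    intro m hm
    obtain ⟨⟨-, -, h3, h4⟩, -⟩ := key m (Eventually.of_forall hm)
    have := (h3.const_mul 9).add (h4.pow 2)
    rw [zero_pow two_ne_zero, add_zero] at this
    refine this.congr' ?_
    filter_upwards [hpos] with i hl0
    field_simp
  set JJ : ι → ℝ → ℝ := fun i m => -2 * m * (9 * DD i m + m ^ 2)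
  have hex : ∀ᶠ i in F, ∃ m, |m| ≤ M ∧ JJ i m = Jr (a i) (b i) (c i) (d i) (e i) := by
    have k1 := kJ (fun _ => M) (fun _ => by rw [abs_of_pos hM0])
    have k2 := kJ (fun _ => -M) (fun _ => by rw [abs_neg, abs_of_pos hM0])
    have q1 := (key (fun _ => M) (Eventually.of_forall fun _ => by rw [abs_of_pos hM0])).2
    have q2 := (key (fun _ => -M) (Eventually.of_forall fun _ => by rw [abs_neg, abs_of_pos hM0])).2
    have hh : D0 < 9 * D0 := by linarith
    filter_upwards [k1.eventually (lt_mem_nhds hh), k2.eventually (lt_mem_nhds hh), q1, q2, hpos, hJ,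
      ha.eventually_ne hα0] with i h1 h2 h3 h4 hl0 hJi ha0
    have ha1 : a i ≠ 0 := by intro h; simp [h] at ha0
    rw [lt_div_iff₀ (by positivity)] at h1 h2
    have hqall : ∀ m ∈ Set.Icc (-M) M, 0 < 8 * a i * m - Dl (a i) (b i) (c i) := by
      intro m hm
      rcases le_total 0 (a i) with h | h
      · nlinarith only [hm.1, hm.2, h, h4, h3]
      · nlinarith only [hm.1, hm.2, h, h4, h3]
    have hSc : Continuous (S i) := by simp only [S]; fun_prop
    have hUc : Continuous (U i) := by simp only [U]; fun_prop
    have hWc : ContinuousOn (W i) (Set.Icc (-M) M) := by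
      simp only [W]
      refine ContinuousOn.div (by fun_prop) hSc.continuousOn (fun m hm => ?_)
      have := hqall m hm
      exact (Real.sqrt_pos.2 (by positivity)).ne'
    have hJc : ContinuousOn (JJ i) (Set.Icc (-M) M) := by
      simp only [JJ, DD]; unfold Dv
      fun_prop
    have := intermediate_value_Icc' (by linarith : -M ≤ M) hJc
    have hMC : M * (D0 * lam i ^ 2) = C * lam i ^ 2 := by rw [hM]; field_simp
    rw [abs_lt] at hJi
    obtain ⟨m, hm, hmJ⟩ := this (show Jr (a i) (b i) (c i) (d i) (e i) ∈ _ by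
      constructor
      · have := mul_lt_mul_of_pos_left h1 hM0
        have := mul_pos hC (pow_pos hl0 2)
        simp only [JJ]; nlinarith only [this, hJi.1, hMC, mul_lt_mul_of_pos_left h1 hM0]
      · have := mul_pos hC (pow_pos hl0 2)
        simp only [JJ]; nlinarith only [this, hJi.2, hMC, mul_lt_mul_of_pos_left h2 hM0])
    exact ⟨m, abs_le.2 hm, hmJ⟩
  have hex' : ∀ i, (∃ m, |m| ≤ M ∧ JJ i m = Jr (a i) (b i) (c i) (d i) (e i)) → _ := fun i h => h
  choose! m hm using hex'
  obtain ⟨⟨h1, h2, h3, h4⟩, h5⟩ := key m (hex.mono fun i hi => (hm i hi).1)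
  have h6 := ((h1.pow 2).add h2).eventually (lt_mem_nhds (show 1 < uu α β γ ^ 2 + w0 by linarith))
  have h7 := h3.eventually (lt_mem_nhds hD0pos)
  have h8 := (h3.const_mul 3).eventually (gt_mem_nhds (show 3 * D0 < 1 by linarith))
  have h9 := (h4.pow 2).eventually (gt_mem_nhds (show (0:ℝ) ^ 2 < 1 by norm_num))
  filter_upwards [hex, h1.eventually (lt_mem_nhds hu0), h1.eventually (gt_mem_nhds hu1), h5, h6, h7, h8, h9,
    haη, hΔη, hpos, hJ, ha.eventually_ne hα0] with i hi g1 g2 g5 g6 g7 g8 g9 gη gΔ hl0 gJ ha0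
  have ha1 : a i ≠ 0 := by intro h; simp [h] at ha0
  obtain ⟨p1, e', hP⟩ := Par_of_m (d := d i) ha1 g5
  have hlp : 0 < lam i ^ 2 := by positivity
  have hDl : Dl (a i) (b i) (c i) ≠ 0 := by nlinarith only [gΔ, mul_pos hη hlp]
  have hee : e i = e' := by
    have : Jr (a i) (b i) (c i) (d i) (e i) = Jr (a i) (b i) (c i) (d i) e' := by
      rw [hP.J]; exact (hm i hi).2.symm
    rw [J_lin _ _ hDl, J_lin _ _ hDl] at this
    have := mul_left_cancel₀ (mul_ne_zero (by norm_num) hDl) this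
    linarith
  rw [← hee] at hP
  refine ⟨U i (m i), W i (m i), m i, hP, g1, g2, g6, ?_, ?_, gJ, gη, ?_, ?_⟩
  · rw [lt_div_iff₀ hlp, zero_mul] at g7; exact g7
  · have e1 := hP.I
    rw [← mul_div_assoc, div_lt_one hlp] at g8
    rw [lt_div_iff₀ hlp, zero_mul] at g7
    rw [div_pow, div_lt_one hlp] at g9
    simp only [DD, U, W, S] at g7 g8
    rw [e1, abs_lt]
    constructor <;> nlinarith only [g7, g8, g9, sq_nonneg (m i)]
  · exact gΔ.trans_le (neg_le_abs _)
  · have hSpos : 0 < S i (m i) := Real.sqrt_pos.2 (by positivity)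
    exact lt_of_lt_of_eq hSpos p1.symm
end

open Filter Topology
open scoped ENNReal
noncomputable section

def th (a b c d : ℝ) : ℝ := 3 * a / Dl a b c * d ^ 2 + -(b * c) / Dl a b c * d + 2 * c ^ 3 / (9 * Dl a b c)
def hw (C L a b c : ℝ) : ℝ := C * L ^ 2 / (9 * |Dl a b c|)

lemma J_iff {C L a b c d e : ℝ} (h : Dl a b c ≠ 0) :
    |Jr a b c d e| < C * L ^ 2 ↔ |e - th a b c d| < hw C L a b c := by
  have : 0 < |Dl a b c| := abs_pos.2 h
  rw [J_lin d e h, hw, lt_div_iff₀ (by positivity), abs_mul, abs_mul, abs_of_pos (by norm_num : (0:ℝ) < 9), th, mul_comm]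

def nU (η C L : ℝ) (a b c : ℤ) : ℝ≥0∞ := ({x : ℤ × ℤ | RU η C L a b c x.1 x.2}.encard : ℝ≥0∞)
def nL (η C L : ℝ) (a b c : ℤ) : ℝ≥0∞ := ({x : ℤ × ℤ | RL η C L a b c x.1 x.2}.encard : ℝ≥0∞)

def gg (U : Set ℝ) (C α β γ : ℝ) : ℝ≥0∞ :=
  open Classical in
  if α ≠ 0 ∧ Dl α β γ < 0 ∧ uu α β γ ∈ U then
    ENNReal.ofReal (2 * C / 27 / sg α β γ * (w2 α (sg α β γ) - (1 - uu α β γ ^ 2))) else 0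

lemma Dl_ne {η L a b c : ℝ} (hη : 0 < η) (h : η * L ^ 2 < |Dl a b c|) : Dl a b c ≠ 0 := by
  intro h0; rw [h0, abs_zero] at h
  nlinarith only [mul_nonneg hη.le (sq_nonneg L), h]

lemma RU_strip {η C L a b c : ℝ} {d e : ℤ} (hη : 0 < η) (h : RU η C L a b c d e) {p q : ℝ}
    (h1 : p ≤ d) (h2 : d ≤ q) : (d, e) ∈ strip p q (hw C L a b c) (th a b c) := by
  obtain ⟨u, w, m, -, -, -, -, -, -, hJ, -, hD, -⟩ := h
  exact mem_strip.2 ⟨h1, h2, (J_iff (Dl_ne hη hD)).1 hJ⟩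

lemma strip_lim' {ι : Type*} {l : Filter ι} {lam : ι → ℝ} {a b c : ι → ℤ} {α β γ C p q : ℝ}
    (hC : 0 < C) (hl : Tendsto lam l atTop)
    (ha : Tendsto (fun i => a i / lam i) l (𝓝 α)) (hb : Tendsto (fun i => b i / lam i) l (𝓝 β))
    (hc : Tendsto (fun i => c i / lam i) l (𝓝 γ)) (hα : α ≠ 0) (hΔ : Dl α β γ < 0) (hpq : p ≤ q) :
    Tendsto (fun i => (((strip (lam i * p) (lam i * q) (hw C (lam i) (a i) (b i) (c i))
      (th (a i) (b i) (c i))).card : ℝ≥0∞) / ENNReal.ofReal (lam i))) l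
      (𝓝 (ENNReal.ofReal (2 * (C / (9 * |Dl α β γ|)) * (q - p)))) := by
  have hΔl := lim_Dl hl ha hb hc
  have hpos := hl.eventually_gt_atTop 0
  have hA : Tendsto (fun i => lam i * (3 * a i / Dl (a i) (b i) (c i))) l (𝓝 (3 * α / Dl α β γ)) := by
    refine ((ha.const_mul 3).div hΔl hΔ.ne).congr' ?_
    filter_upwards [hpos] with i hi
    simp only [Pi.div_apply]; field_simp
  have hh : Tendsto (fun i => hw C (lam i) (a i) (b i) (c i)) l (𝓝 (C / (9 * |Dl α β γ|))) := by
    have := (tendsto_const_nhds (x := C) (f := l)).div (hΔl.abs.const_mul 9) (by have := abs_pos.2 hΔ.ne; positivity)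
    refine this.congr' ?_
    filter_upwards [hpos] with i hi
    simp only [Pi.div_apply, hw, abs_div, abs_of_pos (pow_pos hi 2)]; field_simp
  have := strip_lim (B := fun i => -(b i * c i) / Dl (a i) (b i) (c i)) (c := fun i => 2 * c i ^ 3 / (9 * Dl (a i) (b i) (c i)))
    (P := fun i => lam i * p) (Q := fun i => lam i * q) hl hA
    (div_ne_zero (by simpa using hα) hΔ.ne) hh (by have := abs_pos.2 hΔ.ne; positivity) hpq (fun _ => rfl) (fun _ => rfl)
  refine (ENNReal.tendsto_ofReal this).congr' ?_
  filter_upwards [hpos] with i hi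
  rw [ENNReal.ofReal_div_of_pos hi, ENNReal.ofReal_natCast]; rfl

lemma h0_eq {α β γ C : ℝ} (hΔ : Dl α β γ < 0) :
   2 * (C / (9 * |Dl α β γ|)) * sg α β γ = 2 * C / 27 / sg α β γ := by
  have h : 0 < sg α β γ := Real.sqrt_pos.2 (by linarith)
  have h2 : sg α β γ ^ 2 = -Dl α β γ / 3 := Real.sq_sqrt (by linarith)
  have h3 : |Dl α β γ| = 3 * sg α β γ ^ 2 := by rw [h2, abs_of_neg hΔ]; ring
  rw [h3]; field_simp; ring

lemma encard_le_strip {S : Set (ℤ × ℤ)} {T : Finset (ℤ × ℤ)} (h : S ⊆ T) : (S.encard : ℝ≥0∞) ≤ T.card := by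
  have := Set.encard_le_encard h
  rw [Set.encard_coe_eq_coe_finsetCard] at this
  exact_mod_cast this

lemma strip_le_encard {S : Set (ℤ × ℤ)} {T : Finset (ℤ × ℤ)} (h : (T : Set (ℤ × ℤ)) ⊆ S) : (T.card : ℝ≥0∞) ≤ (S.encard : ℝ≥0∞) := by
  have := Set.encard_le_encard h
  rw [Set.encard_coe_eq_coe_finsetCard] at this
  exact_mod_cast this

lemma ofReal_eps (A B s : ℝ) : Tendsto (fun ε : ℝ => ENNReal.ofReal (A * (B + s * ε))) (𝓝[>] 0) (𝓝 (ENNReal.ofReal (A * B))) := by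
  have : Continuous (fun ε : ℝ => ENNReal.ofReal (A * (B + s * ε))) :=
    ENNReal.continuous_ofReal.comp (by fun_prop)
  have := (this.tendsto 0).mono_left (nhdsWithin_le_nhds (s := Set.Ioi 0))
  simpa using this

lemma U_lim {ι : Type*} {l : Filter ι} [NeBot l] {lam : ι → ℝ} {a b c : ι → ℤ} {α β γ η C : ℝ} (hη : 0 < η) (hC : 0 < C)
    (hl : Tendsto lam l atTop)
    (ha : Tendsto (fun i => a i / lam i) l (𝓝 α)) (hb : Tendsto (fun i => b i / lam i) l (𝓝 β))
    (hc : Tendsto (fun i => c i / lam i) l (𝓝 γ)) :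
    limsup (fun i => nU η C (lam i) (a i) (b i) (c i) / ENNReal.ofReal (lam i)) l ≤ gg (Set.Icc 0 (1/2)) C α β γ := by
  have hpos := hl.eventually_gt_atTop 0
  have core : ∀ F : Ultrafilter ι, (F : Filter ι) ≤ l → ∀ d e : ι → ℤ, (∀ᶠ i in F, RU η C (lam i) (a i) (b i) (c i) (d i) (e i)) → _ :=
    fun F hF d e hR => U_ultra hη hC (hl.mono_left hF) (ha.mono_left hF) (hb.mono_left hF) (hc.mono_left hF) hR
  by_cases hcond : α ≠ 0 ∧ Dl α β γ < 0 ∧ uu α β γ ∈ Set.Icc (0:ℝ) (1/2) ∧ 1 - uu α β γ ^ 2 ≤ w2 α (sg α β γ)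
  · obtain ⟨hα, hΔ, hu, hw⟩ := hcond
    have hσ : 0 < sg α β γ := Real.sqrt_pos.2 (by linarith)
    rw [gg, if_pos ⟨hα, hΔ, hu⟩]
    set w1 := 1 - uu α β γ ^ 2
    set D := dd α β (uu α β γ) (sg α β γ)
    have hev : ∀ ε > 0, limsup (fun i => nU η C (lam i) (a i) (b i) (c i) / ENNReal.ofReal (lam i)) l ≤
        ENNReal.ofReal (2 * (C / (9 * |Dl α β γ|)) * ((D (w2 α (sg α β γ)) + ε) - (D w1 - ε))) := by
      intro ε hε
      have hDm : ∀ x y : ℝ, x ≤ y → D x ≤ D y := by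
        intro x y hxy; simp only [D, dd]; gcongr
      have := strip_lim' hC hl ha hb hc hα hΔ (p := D w1 - ε) (q := D (w2 α (sg α β γ)) + ε)
        (by linarith [hDm _ _ hw])
      rw [← this.limsup_eq]
      refine limsup_le_limsup ?_
      refine mem_iff_ultrafilter.2 fun F hF => ?_
      by_contra hcon
      rw [← Ultrafilter.compl_mem_iff_notMem] at hcon
      have : ∀ i ∈ {i | nU η C (lam i) (a i) (b i) (c i) / ENNReal.ofReal (lam i) ≤
            ((strip (lam i * (D w1 - ε)) (lam i * (D (w2 α (sg α β γ)) + ε)) (_root_.hw C (lam i) (a i) (b i) (c i))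
            (th (a i) (b i) (c i))).card : ℝ≥0∞) / ENNReal.ofReal (lam i)}ᶜ,
          ∃ x : ℤ × ℤ, RU η C (lam i) (a i) (b i) (c i) x.1 x.2 ∧ ¬ (lam i * (D w1 - ε) ≤ x.1 ∧ x.1 ≤ lam i * (D (w2 α (sg α β γ)) + ε)) := by
        intro i hi
        by_contra h
        apply hi
        refine ENNReal.div_le_div_right (encard_le_strip fun x hx => ?_) _
        have h' : lam i * (D w1 - ε) ≤ x.1 ∧ x.1 ≤ lam i * (D (w2 α (sg α β γ)) + ε) := by
          by_contra hn; exact h ⟨x, hx, hn⟩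
        exact RU_strip hη hx h'.1 h'.2
      choose! x hx using this
      obtain ⟨h1, h2, h3, h4, w0, h5, h6, h7, h8⟩ := core F hF (fun i => (x i).1) (fun i => (x i).2) (mem_of_superset hcon fun i hi => (hx i hi).1)
      have k1 := h8.eventually (lt_mem_nhds (show D w1 - ε < D w0 by linarith [hDm _ _ h6]))
      have k2 := h8.eventually (gt_mem_nhds (show D w0 < D (w2 α (sg α β γ)) + ε by linarith [hDm _ _ h7]))
      obtain ⟨i, hi⟩ := ((k1.and k2).and ((hpos.filter_mono hF).and hcon)).exists
      obtain ⟨⟨k1, k2⟩, hl0, hi⟩ := hi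
      rw [lt_div_iff₀ hl0] at k1
      rw [div_lt_iff₀ hl0] at k2
      exact (hx i hi).2 ⟨by linarith, by linarith⟩
    have hlim := ofReal_eps (2 * (C / (9 * |Dl α β γ|))) (D (w2 α (sg α β γ)) - D w1) 2
    have e : 2 * (C / (9 * |Dl α β γ|)) * (D (w2 α (sg α β γ)) - D w1) = 2 * C / 27 / sg α β γ * (w2 α (sg α β γ) - w1) := by
      rw [← h0_eq hΔ]; simp only [D, dd]; ring
    rw [e] at hlim
    refine ge_of_tendsto hlim ?_
    filter_upwards [self_mem_nhdsWithin] with ε hε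
    refine (hev ε hε).trans (le_of_eq ?_)
    congr 1; ring
  · have : ∀ᶠ i in l, nU η C (lam i) (a i) (b i) (c i) / ENNReal.ofReal (lam i) = 0 := by
      refine mem_iff_ultrafilter.2 fun F hF => ?_
      by_contra hcon
      rw [← Ultrafilter.compl_mem_iff_notMem] at hcon
      have : ∀ i ∈ {x | nU η C (lam x) (a x) (b x) (c x) / ENNReal.ofReal (lam x) = 0}ᶜ,
          ∃ x : ℤ × ℤ, RU η C (lam i) (a i) (b i) (c i) x.1 x.2 := by
        intro i hi
        by_contra h
        push Not at h
        apply hi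
        have : {x : ℤ × ℤ | RU η C (lam i) (a i) (b i) (c i) x.1 x.2} = ∅ := Set.eq_empty_of_forall_notMem h
        simp [nU, this]
      choose! x hx using this
      obtain ⟨h1, h2, h3, h4, w0, h5, h6, h7, -⟩ := core F hF (fun i => (x i).1) (fun i => (x i).2) (mem_of_superset hcon hx)
      exact hcond ⟨fun h => by rw [h, abs_zero] at h1; linarith, by linarith, ⟨h3, h4⟩, h6.trans h7⟩
    rw [limsup_congr this, limsup_const]
    exact zero_le

lemma L_lim {ι : Type*} {l : Filter ι} [NeBot l] {lam : ι → ℝ} {a b c : ι → ℤ} {α β γ η C : ℝ} (hη : 0 < η) (hC : 0 < C)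
    (hl : Tendsto lam l atTop)
    (ha : Tendsto (fun i => a i / lam i) l (𝓝 α)) (hb : Tendsto (fun i => b i / lam i) l (𝓝 β))
    (hc : Tendsto (fun i => c i / lam i) l (𝓝 γ)) (hαη : η < |α|) (hΔη : Dl α β γ < -η) :
    gg (Set.Ioo 0 (1/2)) C α β γ ≤ liminf (fun i => nL η C (lam i) (a i) (b i) (c i) / ENNReal.ofReal (lam i)) l := by
  have hpos := hl.eventually_gt_atTop 0
  rw [gg]
  split_ifs with hcond
  swap
  · exact zero_le
  obtain ⟨hα, hΔ, hu⟩ := hcond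
  have hσ : 0 < sg α β γ := Real.sqrt_pos.2 (by linarith)
  set w1 := 1 - uu α β γ ^ 2
  by_cases hw : w2 α (sg α β γ) ≤ w1
  · rw [ENNReal.ofReal_of_nonpos]
    · exact zero_le
    · exact mul_nonpos_of_nonneg_of_nonpos (by positivity) (by linarith)
  push Not at hw
  set D := dd α β (uu α β γ) (sg α β γ)
  have hDlt : D w1 < D (w2 α (sg α β γ)) := by simp only [D, dd]; gcongr
  have hlim := ofReal_eps (2 * (C / (9 * |Dl α β γ|))) (D (w2 α (sg α β γ)) - D w1) (-2)
  have e : 2 * (C / (9 * |Dl α β γ|)) * (D (w2 α (sg α β γ)) - D w1) = 2 * C / 27 / sg α β γ * (w2 α (sg α β γ) - w1) := by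
    rw [← h0_eq hΔ]; simp only [D, dd]; ring
  rw [e] at hlim
  refine le_of_tendsto hlim ?_
  filter_upwards [self_mem_nhdsWithin, nhdsWithin_le_nhds (gt_mem_nhds (show 0 < (D (w2 α (sg α β γ)) - D w1) / 2 by linarith))] with ε hε hε2
  have hε : 0 < ε := hε
  have := strip_lim' hC hl ha hb hc hα hΔ (p := D w1 + ε) (q := D (w2 α (sg α β γ)) - ε) (by linarith)
  have e2 : 2 * (C / (9 * |Dl α β γ|)) * (D (w2 α (sg α β γ)) - D w1 + -2 * ε) = 2 * (C / (9 * |Dl α β γ|)) * (D (w2 α (sg α β γ)) - ε - (D w1 + ε)) := by ring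
  rw [e2, ← this.liminf_eq]
  refine liminf_le_liminf ?_
  refine mem_iff_ultrafilter.2 fun F hF => ?_
  by_contra hcon
  rw [← Ultrafilter.compl_mem_iff_notMem] at hcon
  have : ∀ i ∈ {i | ((strip (lam i * (D w1 + ε)) (lam i * (D (w2 α (sg α β γ)) - ε)) (_root_.hw C (lam i) (a i) (b i) (c i))
        (th (a i) (b i) (c i))).card : ℝ≥0∞) / ENNReal.ofReal (lam i) ≤ nL η C (lam i) (a i) (b i) (c i) / ENNReal.ofReal (lam i)}ᶜ,
      ∃ x : ℤ × ℤ, x ∈ strip (lam i * (D w1 + ε)) (lam i * (D (w2 α (sg α β γ)) - ε)) (_root_.hw C (lam i) (a i) (b i) (c i))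
        (th (a i) (b i) (c i)) ∧ ¬ RL η C (lam i) (a i) (b i) (c i) x.1 x.2 := by
    intro i hi
    by_contra h
    push Not at h
    exact hi (ENNReal.div_le_div_right (strip_le_encard fun x hx => h x hx) _)
  choose! x hx using this
  have hx1 : ∀ᶠ i in F, ((x i).1 : ℝ) / lam i ∈ Set.Icc (D w1 + ε) (D (w2 α (sg α β γ)) - ε) := by
    filter_upwards [hcon, hpos.filter_mono hF] with i hi hl0
    obtain ⟨h1, h2, -⟩ := mem_strip.1 (hx i hi).1
    exact ⟨by rw [le_div_iff₀ hl0]; linarith, by rw [div_le_iff₀ hl0]; linarith⟩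
  obtain ⟨d0, hd0, hd0l⟩ : ∃ d0 ∈ Set.Icc (D w1 + ε) (D (w2 α (sg α β γ)) - ε), Tendsto (fun i => ((x i).1 : ℝ) / lam i) F (𝓝 d0) :=
    isCompact_Icc.ultrafilter_le_nhds' (F.map fun i => ((x i).1 : ℝ) / lam i) (Filter.mem_map.2 hx1)
  set w0 := (d0 - 3 * uu α β γ ^ 2 * β - 8 * uu α β γ ^ 3 * α) / sg α β γ with hw0
  have hDw0 : d0 = D w0 := by simp only [D, dd, hw0]; field_simp; ring
  rw [hDw0] at hd0l hd0
  have hlt : ∀ x y : ℝ, D x < D y → x < y := by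
    intro x y hxy; simp only [D, dd] at hxy
    exact lt_of_mul_lt_mul_right (by linarith) hσ.le
  have := L_ultra (e := fun i => ((x i).2 : ℝ)) hC hη (hl.mono_left hF) (ha.mono_left hF) (hb.mono_left hF) (hc.mono_left hF) hαη hΔη hu.1 hu.2
    (hlt w1 w0 (by linarith [hd0.1])) (hlt w0 _ (by linarith [hd0.2])) hd0l (by
      filter_upwards [hcon, (lim_Dl hl ha hb hc).eventually_ne hΔ.ne |>.filter_mono hF] with i hi hne
      obtain ⟨-, -, h3⟩ := mem_strip.1 (hx i hi).1
      exact (J_iff (by intro h; rw [h] at hne; simp at hne)).2 h3)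
  obtain ⟨i, h1, h2⟩ := (this.and hcon).exists
  exact (hx i h2).2 h1
end

open Filter Topology MeasureTheory
open scoped ENNReal
noncomputable section

def fl (L : ℝ) (x : ℝ × ℝ × ℝ) : ℤ × ℤ × ℤ := (⌊L * x.1⌋, ⌊L * x.2.1⌋, ⌊L * x.2.2⌋)

lemma fl_meas (L : ℝ) : Measurable (fl L) := by unfold fl; fun_prop

lemma fl_vol {L : ℝ} (hL : 0 < L) (n : ℤ × ℤ × ℤ) : volume (fl L ⁻¹' {n}) = (ENNReal.ofReal (L ^ 3))⁻¹ := by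
  have h1 : ∀ n : ℤ, ∀ x : ℝ, ⌊L * x⌋ = n ↔ x ∈ Set.Ico (n / L : ℝ) ((n + 1) / L) := by
    intro n x
    rw [Int.floor_eq_iff, Set.mem_Ico, div_le_iff₀ hL, lt_div_iff₀ hL, mul_comm]
  have h2 : fl L ⁻¹' {n} = Set.Ico (n.1 / L : ℝ) ((n.1 + 1) / L) ×ˢ (Set.Ico (n.2.1 / L : ℝ) ((n.2.1 + 1) / L) ×ˢ Set.Ico (n.2.2 / L : ℝ) ((n.2.2 + 1) / L)) := by
    ext x
    simp only [fl, Set.mem_preimage, Set.mem_singleton_iff, Prod.ext_iff, h1, Set.mem_prod]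
  have h3 : ∀ n : ℤ, volume (Set.Ico (n / L : ℝ) ((n + 1) / L)) = ENNReal.ofReal (1 / L) := by
    intro n; rw [Real.volume_Ico]; congr 1; ring
  rw [h2, Measure.volume_eq_prod, Measure.prod_prod, Measure.volume_eq_prod, Measure.prod_prod, h3, h3, h3,
    ← ENNReal.ofReal_inv_of_pos (by positivity), ← ENNReal.ofReal_mul (by positivity), ← ENNReal.ofReal_mul (by positivity)]
  congr 1; field_simp

lemma fl_int {L : ℝ} (hL : 0 < L) (f : ℤ × ℤ × ℤ → ℝ≥0∞) :
    ∫⁻ x, f (fl L x) = (∑' n, f n) / ENNReal.ofReal (L ^ 3) := by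
  rw [← lintegral_map (measurable_of_countable f) (fl_meas L), lintegral_countable', ENNReal.div_eq_inv_mul, ← ENNReal.tsum_mul_left]
  refine tsum_congr fun n => ?_
  rw [Measure.map_apply (fl_meas L) (measurableSet_singleton n), fl_vol hL, mul_comm]

abbrev Z5 := (ℤ × ℤ × ℤ) × ℤ × ℤ

lemma encard_fib {α β : Type*} (S : Set (α × β)) : (S.encard : ℝ≥0∞) = ∑' a, ({b | (a, b) ∈ S}.encard : ℝ≥0∞) := by
  have h : ∀ {γ : Type _} (T : Set γ), (T.encard : ℝ≥0∞) = ∑' x, T.indicator (fun _ => (1:ℝ≥0∞)) x := by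
    intro γ T
    rw [← tsum_subtype T (fun _ => (1:ℝ≥0∞)), ENNReal.tsum_set_one]
  have h' : ∀ {γ : Type _} (T : Set γ), (T.encard : ℝ≥0∞) = ∑' x, T.indicator (fun _ => (1:ℝ≥0∞)) x := by
    intro γ T
    rw [← tsum_subtype T (fun _ => (1:ℝ≥0∞)), ENNReal.tsum_set_one]
  rw [h, ENNReal.tsum_prod']
  refine tsum_congr fun a => ?_
  rw [h']; rfl

def SU (η C L : ℝ) : Set Z5 := {x | RU η C L x.1.1 x.1.2.1 x.1.2.2 x.2.1 x.2.2}
def SL (η C L : ℝ) : Set Z5 := {x | RL η C L x.1.1 x.1.2.1 x.1.2.2 x.2.1 x.2.2}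

lemma SU_eq (η C : ℝ) {L : ℝ} (hL : 0 < L) : ((SU η C L).encard : ℝ≥0∞) / ENNReal.ofReal (L ^ 4) =
    ∫⁻ x, nU η C L (fl L x).1 (fl L x).2.1 (fl L x).2.2 / ENNReal.ofReal L := by
  have := fl_int hL (fun n => nU η C L n.1 n.2.1 n.2.2 / ENNReal.ofReal L)
  rw [this, encard_fib]
  simp_rw [ENNReal.div_eq_inv_mul]
  rw [ENNReal.tsum_mul_left, ← mul_assoc, ← ENNReal.ofReal_inv_of_pos (by positivity), ← ENNReal.ofReal_inv_of_pos (by positivity), ← ENNReal.ofReal_inv_of_pos (by positivity), ← ENNReal.ofReal_mul (by positivity)]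
  congr 2; field_simp

lemma SL_eq (η C : ℝ) {L : ℝ} (hL : 0 < L) : ((SL η C L).encard : ℝ≥0∞) / ENNReal.ofReal (L ^ 4) =
    ∫⁻ x, nL η C L (fl L x).1 (fl L x).2.1 (fl L x).2.2 / ENNReal.ofReal L := by
  have := fl_int hL (fun n => nL η C L n.1 n.2.1 n.2.2 / ENNReal.ofReal L)
  rw [this, encard_fib]
  simp_rw [ENNReal.div_eq_inv_mul]
  rw [ENNReal.tsum_mul_left, ← mul_assoc, ← ENNReal.ofReal_inv_of_pos (by positivity), ← ENNReal.ofReal_inv_of_pos (by positivity), ← ENNReal.ofReal_inv_of_pos (by positivity), ← ENNReal.ofReal_mul (by positivity)]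
  congr 2; field_simp

lemma RU_bd {η C L a b c d e : ℝ} (hη : 0 < η) (hC : 0 < C) (hL : L0 η C ≤ L) (h : RU η C L a b c d e) :
    |a| ≤ 9 * L ∧ |b| ≤ 9 * L ∧ |c| ≤ 9 * L ∧ |d| ≤ (2 / η + 5) * L ∧ η * L ^ 2 < |Dl a b c| := by
  obtain ⟨u, w, m, hP, h1, h2, h3, h4, h5, h6, h7, h8, h9⟩ := h
  obtain ⟨-, -, -, -, k1, k2, k3, k4, -⟩ := main_bounds hη hC hL hP h1 h2 h3 h4 h5 h6 h7
  have := abs_nonneg a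
  exact ⟨by linarith, by linarith, k3, k4, h8⟩

lemma L0_ge {η C L : ℝ} (hη : 0 < η) (hC : 0 < C) (hL : L0 η C ≤ L) : 1 ≤ L := by
  refine le_trans ?_ hL; unfold L0
  have : 0 < 10 * C / η ^ 3 + C / η ^ 2 := by positivity
  linarith

lemma nU_bd {η C L : ℝ} {a b c : ℤ} (hη : 0 < η) (hC : 0 < C) (hL : L0 η C ≤ L) :
    nU η C L a b c / ENNReal.ofReal L ≤ ENNReal.ofReal ((2 * (2 / η + 5) + 1) * (2 * (C / (9 * η)) + 1)) := by
  have hL1 := L0_ge hη hC hL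
  rcases Set.eq_empty_or_nonempty {x : ℤ × ℤ | RU η C L a b c x.1 x.2} with he | ⟨x, hx⟩
  · simp [nU, he]
  have hΔ := (RU_bd hη hC hL hx).2.2.2.2
  have hp : 0 < |Dl a b c| := lt_of_le_of_lt (by positivity) hΔ
  have h1 : nU η C L a b c ≤ ((strip (-((2 / η + 5) * L)) ((2 / η + 5) * L) (hw C L a b c) (th a b c)).card : ℝ≥0∞) := by
    refine encard_le_strip fun y hy => ?_
    have := abs_le.1 (RU_bd hη hC hL hy).2.2.2.1
    exact RU_strip hη hy this.1 this.2
  have hh : hw C L a b c ≤ C / (9 * η) := by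
    unfold hw
    rw [div_le_div_iff₀ (by positivity) (by positivity)]
    nlinarith only [mul_lt_mul_of_pos_left hΔ hC]
  have h2 := strip_le (θ := th a b c) (p := -((2 / η + 5) * L)) (q := (2 / η + 5) * L) (h := hw C L a b c) (by unfold hw; positivity) (by
    have : 0 < (2 / η + 5) * L := by positivity
    linarith)
  have h3 : (((strip (-((2 / η + 5) * L)) ((2 / η + 5) * L) (hw C L a b c) (th a b c)).card : ℝ)) ≤ (2 * (2 / η + 5) + 1) * (2 * (C / (9 * η)) + 1) * L := by
    refine h2.trans ?_
    calc ((2 / η + 5) * L - -((2 / η + 5) * L) + 1) * (2 * hw C L a b c + 1)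
        ≤ ((2 / η + 5) * L - -((2 / η + 5) * L) + L) * (2 * (C / (9 * η)) + 1) := by
          gcongr
          · have : 0 < hw C L a b c := by unfold hw; positivity
            linarith
          · have : 0 < (2 / η + 5) * L := by positivity
            linarith
      _ = _ := by ring
  refine ENNReal.div_le_of_le_mul (h1.trans ?_)
  rw [← ENNReal.ofReal_mul (by positivity), ← ENNReal.ofReal_natCast]
  exact ENNReal.ofReal_le_ofReal h3

lemma fl_le {L x K : ℝ} (hL : 1 ≤ L) (h : |(⌊L * x⌋ : ℝ)| ≤ K * L) : x ∈ Set.Icc (-(K + 1)) (K + 1) := by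
  have h1 := Int.floor_le (L * x)
  have h2 := Int.lt_floor_add_one (L * x)
  obtain ⟨h3, h4⟩ := abs_le.1 h
  constructor
  · by_contra hc
    push Not at hc
    nlinarith only [h1, h2, h3, h4, hL, hc]
  · by_contra hc
    push Not at hc
    nlinarith only [h1, h2, h3, h4, hL, hc]

lemma fl_lim {lam : ℕ → ℝ} (hl : Tendsto lam atTop atTop) (x : ℝ) : Tendsto (fun i => (⌊lam i * x⌋ : ℝ) / lam i) atTop (𝓝 x) := by
  have h0 : Tendsto (fun i => 1 / lam i) atTop (𝓝 0) := by simp only [one_div]; exact hl.inv_tendsto_atTop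
  have h1 : Tendsto (fun i => x - 1 / lam i) atTop (𝓝 x) := by simpa using tendsto_const_nhds.sub h0
  refine tendsto_of_tendsto_of_tendsto_of_le_of_le' h1 tendsto_const_nhds ?_ ?_
  · filter_upwards [hl.eventually_gt_atTop 0] with i hi
    have h2 := Int.lt_floor_add_one (lam i * x)
    rw [le_div_iff₀ hi, sub_mul, one_div, inv_mul_cancel₀ hi.ne']; linarith
  · filter_upwards [hl.eventually_gt_atTop 0] with i hi
    have h1 := Int.floor_le (lam i * x)
    rw [div_le_iff₀ hi]; linarith

def GG (U : Set ℝ) (C : ℝ) : ℝ≥0∞ := ∫⁻ x : ℝ × ℝ × ℝ, gg U C x.1 x.2.1 x.2.2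

lemma U_seq {η C : ℝ} (hη : 0 < η) (hC : 0 < C) {lam : ℕ → ℝ} (hl : Tendsto lam atTop atTop) (hl0 : ∀ n, L0 η C ≤ lam n) :
    limsup (fun n => ((SU η C (lam n)).encard : ℝ≥0∞) / ENNReal.ofReal (lam n ^ 4)) atTop ≤ GG (Set.Icc 0 (1/2)) C := by
  have h0 : ∀ n, 0 < lam n := fun n => one_pos.trans_le (L0_ge hη hC (hl0 n))
  simp_rw [fun n => SU_eq η C (h0 n)]
  set K := ENNReal.ofReal ((2 * (2 / η + 5) + 1) * (2 * (C / (9 * η)) + 1))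
  set S : Set (ℝ × ℝ × ℝ) := Set.Icc (-(9 + 1)) (9 + 1) ×ˢ (Set.Icc (-(9 + 1)) (9 + 1) ×ˢ Set.Icc (-(9 + 1)) (9 + 1))
  refine (limsup_lintegral_le (S.indicator fun _ => K) ?_ ?_ ?_).trans ?_
  · intro n
    exact (measurable_of_countable (fun m : ℤ × ℤ × ℤ => nU η C (lam n) m.1 m.2.1 m.2.2 / ENNReal.ofReal (lam n))).comp (fl_meas _)
  · intro n
    refine Eventually.of_forall fun x => ?_
    by_cases hx : x ∈ S
    · rw [Set.indicator_of_mem hx]; exact nU_bd hη hC (hl0 n)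
    · rw [Set.indicator_of_notMem hx]
      have : {y : ℤ × ℤ | RU η C (lam n) (fl (lam n) x).1 (fl (lam n) x).2.1 (fl (lam n) x).2.2 y.1 y.2} = ∅ := by
        refine Set.eq_empty_of_forall_notMem fun y hy => hx ?_
        obtain ⟨k1, k2, k3, -⟩ := RU_bd hη hC (hl0 n) hy
        have := L0_ge hη hC (hl0 n)
        exact ⟨fl_le this k1, fl_le this k2, fl_le this k3⟩
      simp [nU, this]
  · rw [lintegral_indicator_const ((measurableSet_Icc).prod ((measurableSet_Icc).prod measurableSet_Icc))]
    refine ENNReal.mul_ne_top ENNReal.ofReal_ne_top ?_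
    exact (isCompact_Icc.prod (isCompact_Icc.prod isCompact_Icc)).measure_ne_top
  · exact lintegral_mono fun x => U_lim hη hC hl (fl_lim hl _) (fl_lim hl _) (fl_lim hl _)

theorem U_ev {η C : ℝ} (hη : 0 < η) (hC : 0 < C) {K : ℝ≥0∞} (hK : GG (Set.Icc 0 (1/2)) C < K) :
    ∀ᶠ L : ℝ in atTop, ((SU η C L).encard : ℝ≥0∞) ≤ K * ENNReal.ofReal (L ^ 4) := by
  by_contra h
  have h2 := (not_eventually.1 h).and_eventually (eventually_ge_atTop (L0 η C))
  obtain ⟨lam, hl, hn⟩ := exists_seq_forall_of_frequently h2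
  have := U_seq hη hC hl fun n => (hn n).2
  refine absurd (this.trans_lt hK) (not_lt.2 ?_)
  refine le_limsup_of_frequently_le' (Frequently.of_forall fun n => ?_)
  have hp := one_pos.trans_le (L0_ge hη hC (hn n).2)
  have := (not_le.1 (hn n).1).le
  rwa [ENNReal.le_div_iff_mul_le (by simp [hp]) (by simp)]

lemma Dl_meas : Measurable fun x : ℝ × ℝ × ℝ => Dl x.1 x.2.1 x.2.2 := by unfold Dl; fun_prop

lemma gg_meas {U : Set ℝ} (hU : MeasurableSet U) (C : ℝ) : Measurable fun x : ℝ × ℝ × ℝ => gg U C x.1 x.2.1 x.2.2 := by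
  unfold gg
  refine Measurable.ite ?_ ?_ measurable_const
  · refine MeasurableSet.inter ?_ (MeasurableSet.inter ?_ ?_)
    · exact (measurableSet_singleton (0:ℝ)).compl.preimage measurable_fst
    · exact measurableSet_lt Dl_meas measurable_const
    · exact hU.preimage (by unfold uu sg Dl; fun_prop)
  · unfold w2 uu sg Dl; fun_prop

theorem L_ev {C : ℝ} (hC : 0 < C) {K : ℝ≥0∞} (hK : K < GG (Set.Ioo 0 (1/2)) C) :
    ∃ η > 0, ∀ᶠ L : ℝ in atTop, K * ENNReal.ofReal (L ^ 4) ≤ ((SL η C L).encard : ℝ≥0∞) := by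
  let T : ℕ → Set (ℝ × ℝ × ℝ) := fun n => {x | 1 / (n + 1 : ℝ) < |x.1| ∧ Dl x.1 x.2.1 x.2.2 < - (1 / (n + 1 : ℝ))}
  have hT : ∀ n, MeasurableSet (T n) := fun n => by
    refine MeasurableSet.inter (measurableSet_lt measurable_const (show Measurable fun x : ℝ × ℝ × ℝ => |x.1| by fun_prop)) (measurableSet_lt Dl_meas measurable_const)
  have hmono : Monotone T := by
    intro m n hmn x hx
    have : 1 / (n + 1 : ℝ) ≤ 1 / (m + 1 : ℝ) := by gcongr
    exact ⟨this.trans_lt hx.1, by linarith [hx.2]⟩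
  let g : ℝ × ℝ × ℝ → ℝ≥0∞ := fun x => gg (Set.Ioo 0 (1/2)) C x.1 x.2.1 x.2.2
  have hg : Measurable g := gg_meas measurableSet_Ioo C
  have hsup : GG (Set.Ioo 0 (1/2)) C = ⨆ n, ∫⁻ x, (T n).indicator g x := by
    rw [← lintegral_iSup (fun n => hg.indicator (hT n)) (fun m n hmn => Set.indicator_le_indicator_of_subset (hmono hmn) (fun _ => zero_le))]
    refine lintegral_congr fun x => ?_
    refine le_antisymm ?_ (iSup_le fun n => Set.indicator_le_self _ _ _)
    by_cases hx : x.1 ≠ 0 ∧ Dl x.1 x.2.1 x.2.2 < 0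
    · have hpos : 0 < min |x.1| (-Dl x.1 x.2.1 x.2.2) := lt_min (abs_pos.2 hx.1) (by linarith [hx.2])
      obtain ⟨n, hn⟩ := exists_nat_one_div_lt hpos
      obtain ⟨h1, h2⟩ := lt_min_iff.1 hn
      refine le_trans ?_ (le_iSup _ n)
      rw [Set.indicator_of_mem (show x ∈ T n from ⟨h1, by linarith⟩)]
    · rw [gg, if_neg (fun h => hx ⟨h.1, h.2.1⟩)]; exact zero_le
  rw [hsup, lt_iSup_iff] at hK
  obtain ⟨n, hn⟩ := hK
  have hη : 0 < 1 / (n + 1 : ℝ) := by positivity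
  refine ⟨1 / (n + 1 : ℝ), hη, ?_⟩
  by_contra h
  have h2 := (not_eventually.1 h).and_eventually (eventually_gt_atTop 0)
  obtain ⟨lam, hl, hh⟩ := exists_seq_forall_of_frequently h2
  have h0 : ∀ n, 0 < lam n := fun n => (hh n).2
  have h3 : ∫⁻ x, (T n).indicator g x ≤ liminf (fun k => ((SL (1 / (n + 1 : ℝ)) C (lam k)).encard : ℝ≥0∞) / ENNReal.ofReal (lam k ^ 4)) atTop := by
    simp_rw [fun k => SL_eq (1 / (n + 1 : ℝ)) C (h0 k)]
    refine le_trans (lintegral_mono fun x => ?_) (lintegral_liminf_le ?_)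
    · by_cases hx : x ∈ T n
      · rw [Set.indicator_of_mem hx]
        exact L_lim hη hC hl (fl_lim hl _) (fl_lim hl _) (fl_lim hl _) hx.1 hx.2
      · rw [Set.indicator_of_notMem hx]; exact zero_le
    · intro k
      exact (measurable_of_countable (fun m : ℤ × ℤ × ℤ => nL _ C (lam k) m.1 m.2.1 m.2.2 / ENNReal.ofReal (lam k))).comp (fl_meas _)
  refine absurd (hn.trans_le h3) (not_lt.2 ?_)
  refine liminf_le_of_frequently_le' (Frequently.of_forall fun k => ?_)
  have := (not_le.1 (hh k).1).le
  have hp := h0 k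
  rwa [ENNReal.div_le_iff_le_mul (by simp [hp]) (by simp)]
end

open Filter Topology MeasureTheory
open scoped ENNReal
noncomputable section

lemma swap3 {μ ν ρ : Measure ℝ} [SFinite μ] [SFinite ν] [SFinite ρ] {f : ℝ → ℝ → ℝ → ℝ≥0∞}
    (hf : Measurable fun x : ℝ × ℝ × ℝ => f x.1 x.2.1 x.2.2) :
    ∫⁻ x, ∫⁻ y, ∫⁻ z, f x y z ∂ρ ∂ν ∂μ = ∫⁻ z, ∫⁻ y, ∫⁻ x, f x y z ∂μ ∂ν ∂ρ := by
  have h1 : ∀ x, ∫⁻ y, ∫⁻ z, f x y z ∂ρ ∂ν = ∫⁻ z, ∫⁻ y, f x y z ∂ν ∂ρ := fun x =>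
    lintegral_lintegral_swap (hf.comp (show Measurable fun p : ℝ × ℝ => (x, p.1, p.2) by fun_prop)).aemeasurable
  simp_rw [h1]
  rw [lintegral_lintegral_swap]
  · refine lintegral_congr fun z => ?_
    exact lintegral_lintegral_swap (hf.comp (show Measurable fun p : ℝ × ℝ => (p.1, p.2, z) by fun_prop)).aemeasurable
  · refine Measurable.aemeasurable ?_
    have : Measurable (fun p : (ℝ × ℝ) × ℝ => f p.1.1 p.2 p.1.2) := hf.comp (show Measurable fun p : (ℝ × ℝ) × ℝ => (p.1.1, p.2, p.1.2) by fun_prop)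
    exact this.lintegral_prod_right'

def kk (C α u s : ℝ) : ℝ≥0∞ :=
  open Classical in if 0 < s then ENNReal.ofReal (2 * C / 9 * (w2 α s - (1 - u ^ 2))) else 0

lemma kk_meas (C : ℝ) : Measurable fun x : ℝ × ℝ × ℝ => kk C x.1 x.2.1 x.2.2 := by
  unfold kk
  refine Measurable.ite ?_ (by unfold w2; fun_prop) measurable_const
  exact measurableSet_lt measurable_const (show Measurable fun x : ℝ × ℝ × ℝ => x.2.2 by fun_prop)

lemma F1 {U : Set ℝ} (hU : MeasurableSet U) {C α : ℝ} (hC : 0 < C) (hα : α ≠ 0) (β : ℝ) :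
    ∫⁻ γ, gg U C α β γ = ∫⁻ u in U, kk C α u (β + 4 * u * α) := by
  classical
  set f : ℝ → ℝ := fun u => -3 * u * β - 6 * u ^ 2 * α
  set P : Set ℝ := U ∩ {u | 0 < β + 4 * u * α}
  have hD : ∀ u, Dl α β (f u) = -3 * (β + 4 * u * α) ^ 2 := fun u => by simp only [Dl, f]; ring
  have hsg : ∀ u, 0 < β + 4 * u * α → sg α β (f u) = β + 4 * u * α := fun u h => by
    unfold sg; rw [hD, show -(-3 * (β + 4 * u * α) ^ 2) / 3 = (β + 4 * u * α) ^ 2 by ring, Real.sqrt_sq h.le]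
  have huu : ∀ u, 0 < β + 4 * u * α → uu α β (f u) = u := fun u h => by
    unfold uu; rw [hsg u h]; field_simp; ring
  have hmS : MeasurableSet {u : ℝ | 0 < β + 4 * u * α} := measurableSet_lt measurable_const (by fun_prop)
  have hP : MeasurableSet P := hU.inter hmS
  have himg : f '' P = {γ | Dl α β γ < 0 ∧ uu α β γ ∈ U} := by
    ext γ
    constructor
    · rintro ⟨u, ⟨h1, h2⟩, rfl⟩
      have h2 : 0 < β + 4 * u * α := h2
      refine ⟨?_, ?_⟩
      · rw [hD]; have := pow_pos h2 2; linarith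
      · rw [huu u h2]; exact h1
    · rintro ⟨h1, h2⟩
      have hs : 0 < sg α β γ := Real.sqrt_pos.2 (by linarith)
      have hs2 : sg α β γ ^ 2 = -Dl α β γ / 3 := Real.sq_sqrt (by linarith)
      have e : β + 4 * uu α β γ * α = sg α β γ := by unfold uu; field_simp; ring
      refine ⟨uu α β γ, ⟨h2, ?_⟩, ?_⟩
      · show 0 < β + 4 * uu α β γ * α
        rw [e]; exact hs
      · have h3 := hD (uu α β γ)
        rw [e, hs2] at h3
        have h4 : Dl α β (f (uu α β γ)) = Dl α β γ := by rw [h3]; ring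
        unfold Dl at h4
        have : α * f (uu α β γ) = α * γ := by linarith
        exact mul_left_cancel₀ hα this
  have hinj : Set.InjOn f P := by
    intro x hx y hy hxy
    rw [← huu x hx.2, ← huu y hy.2, hxy]
  have hmeas : MeasurableSet {γ | Dl α β γ < 0 ∧ uu α β γ ∈ U} := by
    refine MeasurableSet.inter (measurableSet_lt (show Measurable fun γ => Dl α β γ by unfold Dl; fun_prop) measurable_const) ?_
    exact hU.preimage (show Measurable fun γ => uu α β γ by unfold uu sg Dl; fun_prop)
  have h1 : ∫⁻ γ, gg U C α β γ = ∫⁻ γ in f '' P, gg U C α β γ := by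
    rw [himg, ← lintegral_indicator hmeas]
    refine lintegral_congr fun γ => ?_
    by_cases h : γ ∈ {γ | Dl α β γ < 0 ∧ uu α β γ ∈ U}
    · rw [Set.indicator_of_mem h]
    · rw [Set.indicator_of_notMem h, gg, if_neg fun hh => h hh.2]
  rw [h1, lintegral_image_eq_lintegral_abs_deriv_mul hP (f' := fun u => -3 * β - 12 * u * α) _ hinj]
  swap
  · intro u _
    refine HasDerivAt.hasDerivWithinAt ?_
    have := (((hasDerivAt_id u).const_mul (-3)).mul_const β).sub (((hasDerivAt_pow 2 u).const_mul 6).mul_const α)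
    refine (this.congr_deriv ?_).congr_of_eventuallyEq (Eventually.of_forall fun y => ?_)
    · push_cast; ring
    · simp [f]
  rw [← lintegral_indicator hP, ← lintegral_indicator hU]
  refine lintegral_congr fun u => ?_
  by_cases hu : u ∈ U
  · by_cases hs : 0 < β + 4 * u * α
    · rw [Set.indicator_of_mem (show u ∈ P from ⟨hu, hs⟩), Set.indicator_of_mem hu, gg, kk, if_pos hs, if_pos, hsg u hs, huu u hs,
        ← ENNReal.ofReal_mul (abs_nonneg _)]
      · congr 1
        rw [show -3 * β - 12 * u * α = -(3 * (β + 4 * u * α)) by ring, abs_neg, abs_of_pos (by positivity)]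
        field_simp; ring
      · rw [huu u hs, hD]
        exact ⟨hα, by have := pow_pos hs 2; linarith, hu⟩
    · rw [Set.indicator_of_notMem (show u ∉ P from fun h => hs h.2), Set.indicator_of_mem hu, kk, if_neg hs]
  · rw [Set.indicator_of_notMem (show u ∉ P from fun h => hu h.1), Set.indicator_of_notMem hu]

lemma F2 {U : Set ℝ} (hU : MeasurableSet U) {C : ℝ} (hC : 0 < C) :
    GG U C = ∫⁻ u in U, ∫⁻ α, ∫⁻ s, kk C α u s := by
  unfold GG
  have h := gg_meas hU C
  rw [Measure.volume_eq_prod, lintegral_prod _ h.aemeasurable]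
  have h2 : ∀ x : ℝ, ∫⁻ y : ℝ × ℝ, gg U C x y.1 y.2 = ∫⁻ β, ∫⁻ γ, gg U C x β γ := fun x => by
    rw [Measure.volume_eq_prod]; exact lintegral_prod (fun y : ℝ × ℝ => gg U C x y.1 y.2) (h.comp (show Measurable fun p : ℝ × ℝ => (x, p) by fun_prop)).aemeasurable
  simp only [h2]
  have hk := kk_meas C
  have h3 : ∫⁻ x, ∫⁻ β, ∫⁻ γ, gg U C x β γ = ∫⁻ α, ∫⁻ u in U, ∫⁻ s, kk C α u s := by
    have hae : ∀ᵐ α : ℝ, α ≠ 0 := by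
      rw [ae_iff]; simp
    refine lintegral_congr_ae ?_
    filter_upwards [hae] with α hα
    simp only [F1 hU hC hα]
    rw [lintegral_lintegral_swap]
    · refine lintegral_congr fun u => ?_
      exact lintegral_add_right_eq_self (fun s => kk C α u s) (4 * u * α)
    · exact (hk.comp (show Measurable fun p : ℝ × ℝ => (α, p.2, p.1 + 4 * p.2 * α) by fun_prop)).aemeasurable
  rw [h3, lintegral_lintegral_swap]
  refine Measurable.aemeasurable ?_
  have : Measurable (fun p : (ℝ × ℝ) × ℝ => kk C p.1.1 p.1.2 p.2) := hk.comp (show Measurable fun p : (ℝ × ℝ) × ℝ => (p.1.1, p.1.2, p.2) by fun_prop)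
  exact this.lintegral_prod_right'

lemma int_half : ∫ x in (0:ℝ)..1, √(1 - x ^ 2) = Real.pi / 4 := by
  have h := integral_sqrt_one_sub_sq
  have hc : Continuous fun x : ℝ => √(1 - x ^ 2) := by fun_prop
  rw [← intervalIntegral.integral_add_adjacent_intervals (b := 0) (hc.intervalIntegrable _ _) (hc.intervalIntegrable _ _)] at h
  have h2 := intervalIntegral.integral_comp_neg (a := 0) (b := 1) (fun x : ℝ => √(1 - x ^ 2))
  simp only [neg_sq, neg_zero] at h2
  linarith

lemma F3 {w : ℝ} (hw : 0 < w) : ∫⁻ s in Set.Ioi 0, ENNReal.ofReal (√(1 / 3 - w * s ^ 2) / w) = ENNReal.ofReal (Real.pi / 12 * w ^ (-(3/2) : ℝ)) := by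
  set k := √(3 * w)
  have hk : 0 < k := Real.sqrt_pos.2 (by positivity)
  have hk2 : k ^ 2 = 3 * w := Real.sq_sqrt (by positivity)
  have h0 : ∀ s, √(1 / 3 - w * s ^ 2) / w = (1 / (√3 * w)) * √(1 - (k * s) ^ 2) := by
    intro s
    have : 1 / 3 - w * s ^ 2 = (1 - (k * s) ^ 2) / 3 := by rw [mul_pow, hk2]; ring
    rw [this, Real.sqrt_div' _ (by norm_num)]; field_simp
  have hc : Continuous fun x : ℝ => √(1 - (k * x) ^ 2) := by fun_prop
  have hsupp : ∀ x ∈ Set.Ioi 0 \ Set.Ioc 0 (1 / k), √(1 - (k * x) ^ 2) = 0 := by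
    intro x hx
    apply Real.sqrt_eq_zero_of_nonpos
    have hx0 : 0 < x := hx.1
    have : 1 / k < x := by
      by_contra hh
      push Not at hh
      exact hx.2 ⟨hx0, hh⟩
    rw [div_lt_iff₀ hk] at this
    nlinarith only [this]
  have h1 : ∫⁻ s in Set.Ioi 0, ENNReal.ofReal (√(1 / 3 - w * s ^ 2) / w) = ∫⁻ s in Set.Ioc 0 (1 / k), ENNReal.ofReal (√(1 / 3 - w * s ^ 2) / w) := by
    rw [← lintegral_indicator measurableSet_Ioi, ← lintegral_indicator measurableSet_Ioc]
    refine lintegral_congr fun x => ?_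
    by_cases h1 : x ∈ Set.Ioc 0 (1 / k)
    · rw [Set.indicator_of_mem h1, Set.indicator_of_mem (show x ∈ Set.Ioi 0 from h1.1)]
    · rw [Set.indicator_of_notMem h1]
      by_cases h2 : x ∈ Set.Ioi 0
      · rw [Set.indicator_of_mem h2, h0, hsupp x ⟨h2, h1⟩]; simp
      · rw [Set.indicator_of_notMem h2]
  have hpos : (0:ℝ) ≤ 1 / k := by positivity
  rw [h1, ← ofReal_integral_eq_lintegral_ofReal, ← intervalIntegral.integral_of_le hpos]
  · congr 1
    simp only [h0]
    rw [intervalIntegral.integral_const_mul, intervalIntegral.integral_comp_mul_left (fun x => √(1 - x ^ 2)) hk.ne', mul_zero, mul_one_div_cancel hk.ne', int_half]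
    have hw3 : w ^ (-(3/2) : ℝ) = 1 / (w * √w) := by
      rw [show (-(3/2) : ℝ) = -(1 + 1/2) by norm_num, Real.rpow_neg hw.le, Real.rpow_add hw, Real.rpow_one, ← Real.sqrt_eq_rpow, one_div]
    have hkk : k = √3 * √w := Real.sqrt_mul (by norm_num) _
    have h3 : √3 ^ 2 = (3:ℝ) := Real.sq_sqrt (by norm_num)
    have hw0 : 0 < √w := Real.sqrt_pos.2 hw
    have h30 : 0 < √(3:ℝ) := Real.sqrt_pos.2 (by norm_num)
    rw [hw3, hkk, smul_eq_mul]
    field_simp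
    nlinarith only [h3]
  · have : Continuous fun s : ℝ => √(1 / 3 - w * s ^ 2) / w := by fun_prop
    exact (this.integrableOn_Icc).mono_set Set.Ioc_subset_Icc_self
  · exact Eventually.of_forall fun x => by positivity

lemma F4 {C u : ℝ} (hC : 0 < C) (hu : 0 < 1 - u ^ 2) :
    ∫⁻ α, ∫⁻ s, kk C α u s = ENNReal.ofReal (C * Real.pi / 27 * (1 / √(1 - u ^ 2))) := by
  classical
  set w1 := 1 - u ^ 2
  set φ : ℝ → ℝ → ℝ → ℝ≥0∞ := fun α s w => if w * s ^ 2 + 4 * w ^ 2 * α ^ 2 < 1 / 3 then 1 else 0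
  have hφ : Measurable fun x : ℝ × ℝ × ℝ => φ x.1 x.2.1 x.2.2 := by
    refine Measurable.ite ?_ measurable_const measurable_const
    exact measurableSet_lt (show Measurable fun x : ℝ × ℝ × ℝ => x.2.2 * x.2.1 ^ 2 + 4 * x.2.2 ^ 2 * x.1 ^ 2 by fun_prop) measurable_const
  have h1 : ∫⁻ α, ∫⁻ s, kk C α u s = ∫⁻ α, ∫⁻ s in Set.Ioi 0, ∫⁻ w in Set.Ioi w1, ENNReal.ofReal (2 * C / 9) * φ α s w := by
    have hae : ∀ᵐ α : ℝ, α ≠ 0 := by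
      rw [ae_iff]; simp
    refine lintegral_congr_ae ?_
    filter_upwards [hae] with α hα
    rw [← lintegral_indicator measurableSet_Ioi]
    refine lintegral_congr fun s => ?_
    by_cases hs : 0 < s
    · rw [Set.indicator_of_mem (show s ∈ Set.Ioi 0 from hs), kk, if_pos hs, lintegral_const_mul' _ _ ENNReal.ofReal_ne_top,
        ENNReal.ofReal_mul (by positivity), ← Real.volume_Ioo, ← lintegral_indicator measurableSet_Ioi]
      congr 1
      rw [← lintegral_indicator_one measurableSet_Ioo]
      refine lintegral_congr fun w => ?_
      by_cases hw : w1 < w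
      · rw [Set.indicator_of_mem (show w ∈ Set.Ioi w1 from hw)]
        simp only [φ, ← lt_w2 (s := s) hα (hu.trans hw), Set.indicator_apply, Set.mem_Ioo, show 1 - u ^ 2 < w from hw, true_and, Pi.one_apply]
      · rw [Set.indicator_of_notMem (show w ∉ Set.Ioi w1 from hw), Set.indicator_of_notMem fun h => hw h.1]
    · rw [Set.indicator_of_notMem (show s ∉ Set.Ioi 0 from hs), kk, if_neg hs]
  have h2 : ∀ w > w1, ∫⁻ s in Set.Ioi 0, ∫⁻ α, ENNReal.ofReal (2 * C / 9) * φ α s w = ENNReal.ofReal (2 * C / 9) * ENNReal.ofReal (Real.pi / 12 * w ^ (-(3/2) : ℝ)) := by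
    intro w hw
    have hw0 : 0 < w := hu.trans hw
    rw [← F3 hw0, ← lintegral_const_mul' _ _ ENNReal.ofReal_ne_top]
    refine lintegral_congr fun s => ?_
    rw [lintegral_const_mul' _ _ ENNReal.ofReal_ne_top]
    congr 1
    have : ∀ α, φ α s w = (Set.Ioo (-(√(1 / 3 - w * s ^ 2) / (2 * w))) (√(1 / 3 - w * s ^ 2) / (2 * w))).indicator 1 α := by
      intro α
      simp only [φ, Set.indicator_apply, Pi.one_apply]
      have : w * s ^ 2 + 4 * w ^ 2 * α ^ 2 < 1 / 3 ↔ α ∈ Set.Ioo (-(√(1 / 3 - w * s ^ 2) / (2 * w))) (√(1 / 3 - w * s ^ 2) / (2 * w)) := by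
        rw [Set.mem_Ioo, ← abs_lt, lt_div_iff₀ (a := |α|) (by positivity), Real.lt_sqrt (by positivity), mul_pow, sq_abs]
        constructor <;> intro h <;> nlinarith only [h]
      simp only [this]
    simp only [this]
    rw [lintegral_indicator_one measurableSet_Ioo, Real.volume_Ioo]
    congr 1; field_simp; ring
  rw [h1, swap3 (hφ.const_mul _), setLIntegral_congr_fun measurableSet_Ioi h2, lintegral_const_mul' _ _ ENNReal.ofReal_ne_top, ← ofReal_integral_eq_lintegral_ofReal, ← ENNReal.ofReal_mul (by positivity)]
  · congr 1
    rw [integral_const_mul, integral_Ioi_rpow_of_lt (by norm_num) hu]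
    have : w1 ^ (-(3/2) + 1 : ℝ) = 1 / √w1 := by
      rw [show (-(3/2) + 1 : ℝ) = -(1/2) by norm_num, Real.rpow_neg hu.le, ← Real.sqrt_eq_rpow, one_div]
    rw [this]
    have : 0 < √w1 := Real.sqrt_pos.2 hu
    field_simp; norm_num
  · exact (integrableOn_Ioi_rpow_of_lt (by norm_num) hu).const_mul _
  · refine (ae_restrict_iff' measurableSet_Ioi).2 (Eventually.of_forall fun w hw => ?_)
    have : 0 < w := hu.trans hw
    show 0 ≤ Real.pi / 12 * w ^ (-(3/2) : ℝ)
    positivity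

lemma F5 {C : ℝ} (hC : 0 < C) : ∫⁻ u in Set.Ioc 0 (1 / 2), ENNReal.ofReal (C * Real.pi / 27 * (1 / √(1 - u ^ 2))) = ENNReal.ofReal (C * Real.pi ^ 2 / 162) := by
  have hcont : ContinuousOn (fun u : ℝ => C * Real.pi / 27 * (1 / √(1 - u ^ 2))) (Set.Icc 0 (1/2)) := by
    refine continuousOn_const.mul (continuousOn_const.div (by fun_prop) fun u hu => ?_)
    exact (Real.sqrt_pos.2 (by nlinarith only [hu.1, hu.2])).ne'
  rw [← ofReal_integral_eq_lintegral_ofReal, ← intervalIntegral.integral_of_le (by norm_num)]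
  · congr 1
    rw [intervalIntegral.integral_const_mul]
    have : ∫ u in (0:ℝ)..(1/2), 1 / √(1 - u ^ 2) = Real.pi / 6 := by
      have := intervalIntegral.integral_eq_sub_of_hasDerivAt (f := Real.arcsin) (f' := fun u => 1 / √(1 - u ^ 2)) (a := 0) (b := 1/2) (fun x hx => by
        rw [Set.uIcc_of_le (by norm_num)] at hx
        exact Real.hasDerivAt_arcsin (by linarith [hx.1]) (by linarith [hx.2])) ?_
      · rw [this, Real.arcsin_zero, sub_zero]
        have : Real.sin (Real.pi / 6) = 1 / 2 := Real.sin_pi_div_six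
        rw [← this, Real.arcsin_sin] <;> linarith [Real.pi_pos]
      · refine ContinuousOn.intervalIntegrable ?_
        rw [Set.uIcc_of_le (by norm_num)]
        refine (continuousOn_const.div (by fun_prop) fun u hu => ?_)
        exact (Real.sqrt_pos.2 (by nlinarith only [hu.1, hu.2])).ne'
    rw [this]; ring
  · exact (hcont.integrableOn_Icc).mono_set Set.Ioc_subset_Icc_self
  · exact Eventually.of_forall fun x => by have := Real.pi_pos; positivity

theorem GG_Icc {C : ℝ} (hC : 0 < C) : GG (Set.Icc 0 (1/2)) C = ENNReal.ofReal (C * Real.pi ^ 2 / 162) := by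
  rw [F2 measurableSet_Icc hC, setLIntegral_congr_fun measurableSet_Icc fun u hu => F4 hC (show 0 < 1 - u ^ 2 by nlinarith only [hu.1, hu.2]),
    ← F5 hC]
  exact setLIntegral_congr Ioc_ae_eq_Icc.symm
theorem GG_Ioo {C : ℝ} (hC : 0 < C) : GG (Set.Ioo 0 (1/2)) C = ENNReal.ofReal (C * Real.pi ^ 2 / 162) := by
  rw [F2 measurableSet_Ioo hC, setLIntegral_congr_fun measurableSet_Ioo fun u hu => F4 hC (show 0 < 1 - u ^ 2 by nlinarith only [hu.1, hu.2]),
    ← F5 hC]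
  exact setLIntegral_congr Ioo_ae_eq_Ioc
end

open Filter Topology MeasureTheory
open scoped ENNReal
noncomputable section

lemma encard_int {S : Set ℤ} {D : ℝ} (hD : 0 ≤ D) (h : ∀ x ∈ S, ∀ y ∈ S, |(x - y : ℝ)| ≤ D) :
    (S.encard : ℝ≥0∞) ≤ ENNReal.ofReal (D + 1) := by
  classical
  rcases S.eq_empty_or_nonempty with rfl | ⟨x0, hx0⟩
  · simp
  obtain ⟨m, hm, hmin⟩ := Int.exists_least_of_bdd (P := (· ∈ S)) ⟨x0 - ⌈D⌉, fun z hz => by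
    have h1 := (abs_le.1 (h z hz x0 hx0)).1
    have h2 := Int.le_ceil D
    have : ((x0 - ⌈D⌉ : ℤ) : ℝ) ≤ z := by push_cast; linarith
    exact_mod_cast this⟩ ⟨x0, hx0⟩
  have hsub : S ⊆ (Finset.Icc m (m + ⌊D⌋) : Finset ℤ) := by
    intro z hz
    have h1 := (abs_le.1 (h z hz m hm)).2
    have h3 : z - m ≤ ⌊D⌋ := Int.le_floor.2 (by push_cast; exact h1)
    simp only [Finset.coe_Icc, Set.mem_Icc]
    exact ⟨hmin z hz, by linarith⟩
  have h1 := Set.encard_le_encard hsub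
  rw [Set.encard_coe_eq_coe_finsetCard, Int.card_Icc] at h1
  have h2 : (S.encard : ℝ≥0∞) ≤ (((m + ⌊D⌋ + 1 - m).toNat : ℕ) : ℝ≥0∞) := by exact_mod_cast h1
  refine h2.trans ?_
  rw [← ENNReal.ofReal_natCast]
  refine ENNReal.ofReal_le_ofReal ?_
  have h5 : 0 ≤ ⌊D⌋ := Int.floor_nonneg.2 hD
  have h4 : (((m + ⌊D⌋ + 1 - m).toNat : ℕ) : ℤ) = ⌊D⌋ + 1 := by omega
  have h6 : (((m + ⌊D⌋ + 1 - m).toNat : ℕ) : ℝ) = ⌊D⌋ + 1 := by exact_mod_cast h4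
  rw [h6]; linarith [Int.floor_le D]

lemma encard_prod_le {α β : Type*} {S : Set (α × β)} {P Q : ℝ≥0∞} (h1 : ({a | ∃ b, (a, b) ∈ S}.encard : ℝ≥0∞) ≤ P)
    (h2 : ∀ a, ({b | (a, b) ∈ S}.encard : ℝ≥0∞) ≤ Q) : (S.encard : ℝ≥0∞) ≤ P * Q := by
  classical
  rw [encard_fib]
  have : ∀ a, ({b | (a, b) ∈ S}.encard : ℝ≥0∞) ≤ {a | ∃ b, (a, b) ∈ S}.indicator (fun _ => (1:ℝ≥0∞)) a * Q := by
    intro a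
    by_cases h : ∃ b, (a, b) ∈ S
    · rw [Set.indicator_of_mem (show a ∈ {a | ∃ b, (a, b) ∈ S} from h), one_mul]; exact h2 a
    · have : {b | (a, b) ∈ S} = ∅ := Set.eq_empty_of_forall_notMem fun b hb => h ⟨b, hb⟩
      simp [this]
  refine (ENNReal.tsum_le_tsum this).trans ?_
  rw [ENNReal.tsum_mul_right, ← tsum_subtype _ (fun _ => (1:ℝ≥0∞)), ENNReal.tsum_set_one]
  gcongr

lemma encard_sq {v k A ρ D : ℝ} (hv : 0 < v) (hρ : 0 ≤ ρ) (hD : 0 ≤ D)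
    (hD2 : 2 * ρ ≤ D ^ 2 ∨ (2 * ρ ≤ |A| ∧ 2 * ρ ≤ D * √|A|)) :
    ({d : ℤ | |(v * d + k) ^ 2 - A| ≤ ρ}.encard : ℝ≥0∞) ≤ ENNReal.ofReal (2 * (D / v + 1)) := by
  have key : ∀ x y : ℝ, |x ^ 2 - A| ≤ ρ → |y ^ 2 - A| ≤ ρ → 0 ≤ x * y → |x - y| ≤ D := by
    intro x y hx hy hxy
    obtain ⟨hx1, hx2⟩ := abs_le.1 hx
    obtain ⟨hy1, hy2⟩ := abs_le.1 hy
    have e : |x - y| * |x + y| ≤ 2 * ρ := by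
      rw [← abs_mul, abs_le]; constructor <;> nlinarith only [hx1, hx2, hy1, hy2]
    have e2 : |x - y| ≤ |x + y| := by
      rw [← sq_le_sq]; nlinarith only [hxy]
    have h0 := abs_nonneg (x - y)
    rcases hD2 with h | ⟨h, h'⟩
    · refine abs_le_of_sq_le_sq ?_ hD
      rw [← sq_abs]
      nlinarith only [mul_le_mul_of_nonneg_left e2 h0, h, e]
    · have hA : 0 ≤ A := by
        by_contra hA
        push Not at hA
        rw [abs_of_neg hA] at h
        nlinarith only [sq_nonneg x, hx2, h, hA, hρ]
      rw [abs_of_nonneg hA] at h h'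
      have h3 : √A ≤ |x + y| := by
        refine Real.sqrt_le_iff.2 ⟨abs_nonneg _, ?_⟩
        rw [sq_abs]; nlinarith only [hx1, hy1, h, hxy]
      rcases hA.eq_or_lt with hA0 | hA0
      · subst hA0
        have hr : ρ = 0 := by linarith only [h, hρ]
        subst hr
        have hx0 : x = 0 := by nlinarith only [hx2, hx1]
        have hy0 : y = 0 := by nlinarith only [hy2, hy1]
        simp [hx0, hy0, hD]
      · have hs : 0 < √A := Real.sqrt_pos.2 hA0
        have : |x - y| * √A ≤ D * √A := by nlinarith only [mul_le_mul_of_nonneg_left h3 h0, e, h']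
        exact le_of_mul_le_mul_right this hs
  have hsub : {d : ℤ | |(v * d + k) ^ 2 - A| ≤ ρ} ⊆ {d : ℤ | |(v * d + k) ^ 2 - A| ≤ ρ ∧ 0 ≤ v * d + k} ∪ {d : ℤ | |(v * d + k) ^ 2 - A| ≤ ρ ∧ v * d + k ≤ 0} := by
    intro d hd
    rcases le_total 0 (v * d + k) with h | h
    · exact Or.inl ⟨hd, h⟩
    · exact Or.inr ⟨hd, h⟩
  have hb : ∀ x y : ℤ, |v * x + k - (v * y + k)| ≤ D → |(x - y : ℝ)| ≤ D / v := by
    intro x y h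
    rw [le_div_iff₀ hv]
    rw [show v * x + k - (v * y + k) = (x - y) * v by ring, abs_mul, abs_of_pos hv] at h
    exact h
  have h1 := encard_int (S := {d : ℤ | |(v * d + k) ^ 2 - A| ≤ ρ ∧ 0 ≤ v * d + k}) (D := D / v) (by positivity)
    fun x hx y hy => hb x y (key _ _ hx.1 hy.1 (mul_nonneg hx.2 hy.2))
  have h2 := encard_int (S := {d : ℤ | |(v * d + k) ^ 2 - A| ≤ ρ ∧ v * d + k ≤ 0}) (D := D / v) (by positivity)
    fun x hx y hy => hb x y (key _ _ hx.1 hy.1 (mul_nonneg_of_nonpos_of_nonpos hx.2 hy.2))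
  have h3 := (Set.encard_le_encard hsub).trans (Set.encard_union_le _ _)
  have h4 : ({d : ℤ | |(v * d + k) ^ 2 - A| ≤ ρ}.encard : ℝ≥0∞) ≤ ({d : ℤ | |(v * d + k) ^ 2 - A| ≤ ρ ∧ 0 ≤ v * d + k}.encard : ℝ≥0∞) + ({d : ℤ | |(v * d + k) ^ 2 - A| ≤ ρ ∧ v * d + k ≤ 0}.encard : ℝ≥0∞) := by
    exact_mod_cast h3
  refine h4.trans ((add_le_add h1 h2).trans (le_of_eq ?_))
  rw [← ENNReal.ofReal_add (by positivity) (by positivity)]; congr 1; ring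

def r4 (x : ℝ) : ℝ := √(√x)
lemma r4_pow {x : ℝ} (hx : 0 ≤ x) : r4 x ^ 4 = x := by
  unfold r4
  rw [show 4 = 2 * 2 by norm_num, pow_mul, Real.sq_sqrt (Real.sqrt_nonneg _), Real.sq_sqrt hx]
lemma r4_nn (x : ℝ) : 0 ≤ r4 x := Real.sqrt_nonneg _
lemma r4_mono {x y : ℝ} (h : x ≤ y) : r4 x ≤ r4 y := Real.sqrt_le_sqrt (Real.sqrt_le_sqrt h)
lemma r4_mul {x y : ℝ} (hx : 0 ≤ x) : r4 (x * y) = r4 x * r4 y := by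
  unfold r4; rw [Real.sqrt_mul hx, Real.sqrt_mul (Real.sqrt_nonneg _)]
lemma r4_one : r4 1 = 1 := by simp [r4]
lemma one_le_r4 {x : ℝ} (h : 1 ≤ x) : 1 ≤ r4 x := r4_one ▸ r4_mono h
lemma r4_le {x y : ℝ} (hy : 0 ≤ y) (h : x ≤ y ^ 4) : r4 x ≤ y := by
  refine (r4_mono h).trans (le_of_eq ?_)
  exact (pow_left_inj₀ (r4_nn _) hy (by norm_num : 4 ≠ 0)).1 (r4_pow (by positivity))

def mj (j : ℤ) : ℝ := max 1 |(j : ℝ)|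
lemma one_le_mj (j : ℤ) : 1 ≤ mj j := le_max_left _ _

lemma S34_aux (n : ℕ) : ∑ j ∈ Finset.Icc (-(n:ℤ)) n, 1 / r4 (mj j) ^ 3 ≤ 1 + 8 * r4 n := by
  induction n with
  | zero => simp [mj, r4]
  | succ n ih =>
    have h : Finset.Icc (-((n + 1 : ℕ) : ℤ)) ((n + 1 : ℕ) : ℤ) = insert (-((n:ℤ) + 1)) (insert ((n:ℤ) + 1) (Finset.Icc (-(n:ℤ)) n)) := by
      ext x; simp only [Finset.mem_Icc, Finset.mem_insert]; push_cast; omega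
    rw [h, Finset.sum_insert (by simp; omega), Finset.sum_insert (by simp)]
    have e1 : mj (-((n:ℤ) + 1)) = n + 1 := by
      unfold mj; push_cast; rw [abs_neg, abs_of_nonneg (by positivity), max_eq_right (by linarith [Nat.cast_nonneg (α := ℝ) n])]
    have e2 : mj (((n:ℤ) + 1)) = n + 1 := by
      unfold mj; push_cast; rw [abs_of_nonneg (by positivity), max_eq_right (by linarith [Nat.cast_nonneg (α := ℝ) n])]
    rw [e1, e2]
    push_cast
    have hx := r4_pow (show (0:ℝ) ≤ n + 1 by positivity)
    have hy := r4_pow (show (0:ℝ) ≤ n by positivity)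
    have h1 : 1 ≤ r4 ((n:ℝ) + 1) := one_le_r4 (by linarith [Nat.cast_nonneg (α := ℝ) n])
    have h0 := r4_nn (n:ℝ)
    have hm : r4 (n:ℝ) ≤ r4 ((n:ℝ) + 1) := r4_mono (by linarith)
    set x := r4 ((n:ℝ) + 1)
    set y := r4 (n:ℝ)
    have : 1 / x ^ 3 ≤ 4 * (x - y) := by
      rw [div_le_iff₀ (by positivity)]
      have e : (x - y) * (x ^ 3 + x ^ 2 * y + x * y ^ 2 + y ^ 3) = 1 := by
        have : (x - y) * (x ^ 3 + x ^ 2 * y + x * y ^ 2 + y ^ 3) = x ^ 4 - y ^ 4 := by ring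
        rw [this, hx, hy]; ring
      have l1 : x ^ 2 * y ≤ x ^ 2 * x := by gcongr
      have l2 : x * y ^ 2 ≤ x * x ^ 2 := by gcongr
      have l3 : y ^ 3 ≤ x ^ 3 := by gcongr
      have := mul_le_mul_of_nonneg_left (show x ^ 3 + x ^ 2 * y + x * y ^ 2 + y ^ 3 ≤ 4 * x ^ 3 by linarith) (sub_nonneg.2 hm)
      linarith
    linarith

lemma S34 {N : ℝ} (hN : 0 ≤ N) (f : ℤ → ℝ≥0∞) (hf : ∀ j, f j ≤ ENNReal.ofReal (1 / r4 (mj j) ^ 3)) (hf0 : ∀ j : ℤ, N < |(j:ℝ)| → f j = 0) :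
    ∑' j : ℤ, f j ≤ ENNReal.ofReal (1 + 8 * r4 N) := by
  rw [tsum_eq_sum (s := Finset.Icc (-(⌊N⌋₊:ℤ)) ⌊N⌋₊)]
  · refine (Finset.sum_le_sum fun j _ => hf j).trans ?_
    rw [← ENNReal.ofReal_sum_of_nonneg (fun j _ => by have := r4_nn (mj j); positivity)]
    refine ENNReal.ofReal_le_ofReal ((S34_aux _).trans ?_)
    gcongr
    exact r4_mono (Nat.floor_le hN)
  · intro j hj
    refine hf0 j ?_
    by_contra h
    push Not at h
    apply hj
    rw [Finset.mem_Icc, ← abs_le]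
    have : (|j|.toNat : ℝ) ≤ N := by
      have : ((|j|.toNat : ℕ) : ℤ) = |j| := by simp
      have h2 : ((|j|.toNat : ℕ) : ℝ) = |(j:ℝ)| := by exact_mod_cast congrArg (Int.cast (R := ℝ)) this
      rw [h2]; exact h
    have := Nat.le_floor this
    omega
end

open Filter Topology MeasureTheory
open scoped ENNReal
noncomputable section

lemma enc_mono {α : Type*} {S T : Set α} (h : S ⊆ T) : (S.encard : ℝ≥0∞) ≤ (T.encard : ℝ≥0∞) := by
  exact_mod_cast Set.encard_le_encard h

lemma syz (a b c d e : ℝ) : 27 * (8 * a ^ 2 * d + (b ^ 3 - 4 * a * b * c)) ^ 2 =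
    -(Dl a b c) ^ 3 + 48 * a ^ 2 * Ir a b c d e * Dl a b c - 64 * a ^ 3 * Jr a b c d e := by
  unfold Dl Ir Jr; ring

def DE (k t a b c : ℝ) : Set (ℤ × ℤ) := {x | |Ir a b c x.1 x.2| ≤ k ^ 2 * t ^ 8 ∧ |Jr a b c x.1 x.2| ≤ k ^ 2 * t ^ 8}

lemma e_count {k t a b c M : ℝ} (hM0 : 0 < M) (hM : M = |a| ∨ M = |Dl a b c|)
    (hMX : M ≤ k ^ 2 * t ^ 8) (d : ℤ) :
    ({e : ℤ | (d, e) ∈ DE k t a b c}.encard : ℝ≥0∞) ≤ ENNReal.ofReal (2 * (k ^ 2 * t ^ 8) / M) := by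
  have hX : 0 < k ^ 2 * t ^ 8 := hM0.trans_le hMX
  refine (encard_int (D := k ^ 2 * t ^ 8 / M) (by positivity) ?_).trans (ENNReal.ofReal_le_ofReal ?_)
  · rintro x ⟨hx1, hx2⟩ y ⟨hy1, hy2⟩
    rw [le_div_iff₀ hM0]
    obtain ⟨p1, p2⟩ := abs_le.1 hx1
    obtain ⟨p3, p4⟩ := abs_le.1 hy1
    obtain ⟨p5, p6⟩ := abs_le.1 hx2
    obtain ⟨p7, p8⟩ := abs_le.1 hy2
    simp only [Ir, Jr] at *
    rcases hM with rfl | rfl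
    · rw [← abs_mul, abs_le]
      constructor <;> nlinarith only [p1, p2, p3, p4, hX]
    · rw [← abs_mul, abs_le]; unfold Dl
      constructor <;> nlinarith only [p5, p6, p7, p8, hX]
  · have : 1 ≤ k ^ 2 * t ^ 8 / M := by rwa [le_div_iff₀ hM0, one_mul]
    have e : 2 * (k ^ 2 * t ^ 8) / M = 2 * (k ^ 2 * t ^ 8 / M) := by ring
    rw [e]; linarith

lemma d_sub {k t a b c M : ℝ} (hM1 : |a| ≤ M) (hM2 : |Dl a b c| ≤ M) :
    {d : ℤ | ∃ e, (d, e) ∈ DE k t a b c} ⊆ {d : ℤ | |(8 * a ^ 2 * d + (b ^ 3 - 4 * a * b * c)) ^ 2 - -(Dl a b c) ^ 3 / 27| ≤ 5 * (k ^ 2 * t ^ 8) * a ^ 2 * M} := by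
  rintro d ⟨e, hI, hJ⟩
  have h := syz a b c d e
  have hM0 : 0 ≤ M := (abs_nonneg _).trans hM1
  have hX : 0 ≤ k ^ 2 * t ^ 8 := (abs_nonneg _).trans hI
  have e1 : (8 * a ^ 2 * d + (b ^ 3 - 4 * a * b * c)) ^ 2 - -(Dl a b c) ^ 3 / 27 = (48 * a ^ 2 * (Ir a b c d e * Dl a b c) - 64 * a ^ 2 * (a * Jr a b c d e)) / 27 := by linarith only [h]
  have h1 : |Ir a b c d e * Dl a b c| ≤ k ^ 2 * t ^ 8 * M := by rw [abs_mul]; gcongr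
  have h2 : |a * Jr a b c d e| ≤ M * (k ^ 2 * t ^ 8) := by rw [abs_mul]; gcongr
  have h3 : 48 * a ^ 2 * |Ir a b c d e * Dl a b c| ≤ 48 * a ^ 2 * (k ^ 2 * t ^ 8 * M) := by gcongr
  have h4 : 64 * a ^ 2 * |a * Jr a b c d e| ≤ 64 * a ^ 2 * (M * (k ^ 2 * t ^ 8)) := by gcongr
  rw [Set.mem_setOf_eq]
  rw [e1, abs_div, abs_of_pos (by norm_num : (0:ℝ) < 27), div_le_iff₀ (by norm_num)]
  refine (abs_sub _ _).trans ?_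
  rw [abs_mul, abs_mul (64 * a ^ 2), abs_of_nonneg (by positivity : 0 ≤ 48 * a ^ 2), abs_of_nonneg (by positivity : 0 ≤ 64 * a ^ 2)]
  have : 0 ≤ a ^ 2 * (k ^ 2 * t ^ 8 * M) := by positivity
  nlinarith only [this, h3, h4]

lemma de_gen {k t a b c M : ℝ} (hk : 1 ≤ k) (ht : 1 ≤ t) (ha : a ≠ 0) (ha1 : |a| ≤ k ^ 2 * t ^ 4)
    (hM1 : |a| ≤ M) (hM2 : |Dl a b c| ≤ M) (hM : M = |a| ∨ M = |Dl a b c|) (hMX : M ≤ k ^ 2 * t ^ 8) :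
    ((DE k t a b c).encard : ℝ≥0∞) ≤ ENNReal.ofReal (3 * (k * t ^ 4 * √M / |a|) * (2 * (k ^ 2 * t ^ 8) / M)) := by
  have ha0 : 0 < |a| := abs_pos.2 ha
  have hM0 : 0 < M := ha0.trans_le hM1
  have hsM := Real.sq_sqrt hM0.le
  have hsM0 : 0 < √M := Real.sqrt_pos.2 hM0
  rw [ENNReal.ofReal_mul (by positivity)]
  refine encard_prod_le ?_ (e_count hM0 hM hMX)
  have h1 := encard_sq (v := 8 * a ^ 2) (k := b ^ 3 - 4 * a * b * c) (A := -(Dl a b c) ^ 3 / 27) (ρ := 5 * (k ^ 2 * t ^ 8) * a ^ 2 * M)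
    (D := 4 * k * t ^ 4 * |a| * √M) (by positivity) (by positivity) (by positivity) (Or.inl (by
      have : (4 * k * t ^ 4 * |a| * √M) ^ 2 = 16 * (k ^ 2 * t ^ 8 * a ^ 2 * M) := by
        rw [← sq_abs a, mul_pow _ √M, hsM]; ring
      rw [this]
      have : 0 ≤ k ^ 2 * t ^ 8 * a ^ 2 * M := by positivity
      linarith only [this]))
  have h2 := le_trans (enc_mono (d_sub (k := k) (t := t) hM1 hM2)) h1
  refine h2.trans (ENNReal.ofReal_le_ofReal ?_)
  have e1 : 4 * k * t ^ 4 * |a| * √M / (8 * a ^ 2) = (k * t ^ 4 * √M / |a|) / 2 := by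
    rw [← sq_abs a]; field_simp; norm_num
  have e2 : 1 ≤ k * t ^ 4 * √M / |a| := by
    rw [le_div_iff₀ ha0, one_mul]
    refine abs_le_of_sq_le_sq' ?_ (by positivity) |>.2
    have : (k * t ^ 4 * √M) ^ 2 = k ^ 2 * t ^ 4 * t ^ 4 * M := by rw [mul_pow _ √M, hsM]; ring
    rw [this, sq]
    have : (1:ℝ) ≤ t ^ 4 := one_le_pow₀ ht
    have h5 : k ^ 2 * t ^ 4 * 1 ≤ k ^ 2 * t ^ 4 * t ^ 4 := by gcongr
    exact mul_le_mul (by linarith) hM1 ha0.le (by positivity)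
  rw [e1]; linarith

lemma de_small {k t a b c : ℝ} (hk : 1 ≤ k) (ht : 1 ≤ t) (ha : a ≠ 0) (ha1 : |a| ≤ k ^ 2 * t ^ 4) (hΔ : |Dl a b c| ≤ |a|) :
    ((DE k t a b c).encard : ℝ≥0∞) ≤ ENNReal.ofReal (6 * k ^ 3 * t ^ 12 / r4 |a| ^ 6) := by
  have ha0 : 0 < |a| := abs_pos.2 ha
  have : k ^ 2 * t ^ 4 ≤ k ^ 2 * t ^ 8 := by gcongr; norm_num
  refine (de_gen hk ht ha ha1 le_rfl hΔ (Or.inl rfl) (ha1.trans this)).trans (ENNReal.ofReal_le_ofReal (le_of_eq ?_))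
  have h1 := r4_pow ha0.le
  have h2 : √|a| = r4 |a| ^ 2 := (Real.sq_sqrt (Real.sqrt_nonneg _)).symm
  have h3 : 0 < r4 |a| := Real.sqrt_pos.2 (Real.sqrt_pos.2 ha0)
  rw [h2]
  set x := r4 |a|
  rw [← h1]; field_simp; norm_num

lemma de_big {k t a b c : ℝ} (hk : 1 ≤ k) (ht : 1 ≤ t) (ha : a ≠ 0) (ha1 : |a| ≤ k ^ 2 * t ^ 4) (hΔ : |a| ≤ |Dl a b c|)
    (hΔ1 : |Dl a b c| ≤ k ^ 2 * t ^ 8) :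
    ((DE k t a b c).encard : ℝ≥0∞) ≤ ENNReal.ofReal (34 * k ^ 4 * t ^ 13 / (r4 |a| ^ 3 * r4 |Dl a b c| ^ 3)) := by
  have ha0 : 0 < |a| := abs_pos.2 ha
  have hM0 := ha0.trans_le hΔ
  have hx := r4_pow ha0.le
  have hx0 : 0 < r4 |a| := Real.sqrt_pos.2 (Real.sqrt_pos.2 ha0)
  have hy := r4_pow hM0.le
  have hy0 : 0 < r4 |Dl a b c| := Real.sqrt_pos.2 (Real.sqrt_pos.2 hM0)
  have hy2 : √|Dl a b c| = r4 |Dl a b c| ^ 2 := (Real.sq_sqrt (Real.sqrt_nonneg _)).symm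
  have hk0 : 0 < k := by linarith
  have ht0 : 0 < t := by linarith
  by_cases hcase : r4 |Dl a b c| ≤ t * r4 |a|
  · refine (de_gen hk ht ha ha1 hΔ le_rfl (Or.inr rfl) hΔ1).trans (ENNReal.ofReal_le_ofReal ?_)
    rw [hy2]
    set x := r4 |a|
    set y := r4 |Dl a b c|
    rw [← hx, ← hy]
    rw [show 3 * (k * t ^ 4 * y ^ 2 / x ^ 4) * (2 * (k ^ 2 * t ^ 8) / y ^ 4) = (6 * k ^ 3 * t ^ 12 / (x ^ 4 * y ^ 3)) * y by field_simp; norm_num,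
      show 34 * k ^ 4 * t ^ 13 / (x ^ 3 * y ^ 3) = (34 * k ^ 4 * t ^ 12 / (x ^ 4 * y ^ 3)) * (t * x) by field_simp]
    gcongr ?_ / _ * ?_
    have h1 : k ^ 3 ≤ k ^ 4 := pow_le_pow_right₀ hk (by norm_num)
    have : 6 * k ^ 3 ≤ 34 * k ^ 4 := by nlinarith only [h1, pow_pos hk0 3]
    gcongr
  · push Not at hcase
    have hA : |-(Dl a b c) ^ 3 / 27| = r4 |Dl a b c| ^ 12 / 27 := by
      rw [abs_div, abs_neg, abs_pow, abs_of_pos (by norm_num : (0:ℝ) < 27)]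
      nth_rw 1 [← hy]; ring
    have hsA : r4 |Dl a b c| ^ 6 / 6 ≤ √(r4 |Dl a b c| ^ 12 / 27) := by
      refine Real.le_sqrt_of_sq_le ?_
      have : 0 < r4 |Dl a b c| ^ 12 := by positivity
      nlinarith only [this]
    have h2 := encard_sq (v := 8 * a ^ 2) (k := b ^ 3 - 4 * a * b * c) (A := -(Dl a b c) ^ 3 / 27) (ρ := 5 * (k ^ 2 * t ^ 8) * a ^ 2 * |Dl a b c|)
      (D := 60 * k ^ 2 * t ^ 8 * a ^ 2 / r4 |Dl a b c| ^ 2) (by positivity) (by positivity) (by positivity) (by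
        have key : 2 * (5 * (k ^ 2 * t ^ 8) * a ^ 2 * |Dl a b c|) ≤ 60 * k ^ 2 * t ^ 8 * a ^ 2 / r4 |Dl a b c| ^ 2 * √(r4 |Dl a b c| ^ 12 / 27) := by
          refine le_trans (le_of_eq ?_) (mul_le_mul_of_nonneg_left hsA (by positivity))
          nth_rw 1 [← hy]; field_simp; norm_num
        rw [hA]
        set ρ := 5 * (k ^ 2 * t ^ 8) * a ^ 2 * |Dl a b c|
        set D := 60 * k ^ 2 * t ^ 8 * a ^ 2 / r4 |Dl a b c| ^ 2
        have hρ : 0 ≤ ρ := by positivity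
        rcases le_or_gt (2 * ρ) (r4 |Dl a b c| ^ 12 / 27) with h | h
        · exact Or.inr ⟨h, key⟩
        · left
          have hAp : 0 < r4 |Dl a b c| ^ 12 / 27 := by positivity
          have hss := Real.sq_sqrt hAp.le
          set A := r4 |Dl a b c| ^ 12 / 27
          have h3 : (2 * ρ) ^ 2 ≤ (D * √A) ^ 2 := by gcongr
          rw [mul_pow D, hss] at h3
          have h4 : 2 * ρ * A ≤ 2 * ρ * (2 * ρ) := by gcongr
          have h5 : 2 * ρ * A ≤ D ^ 2 * A := by nlinarith only [h3, h4]
          exact le_of_mul_le_mul_right h5 hAp)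
    have h3 := le_trans (enc_mono (d_sub (k := k) (t := t) hΔ le_rfl)) h2
    refine (encard_prod_le h3 (e_count hM0 (Or.inr rfl) hΔ1)).trans ?_
    rw [← ENNReal.ofReal_mul (by positivity)]
    refine ENNReal.ofReal_le_ofReal ?_
    have e1 : 60 * k ^ 2 * t ^ 8 * a ^ 2 / r4 |Dl a b c| ^ 2 / (8 * a ^ 2) = 15 / 2 * (k ^ 2 * t ^ 8 / r4 |Dl a b c| ^ 2) := by
      field_simp; norm_num
    have hyk : r4 |Dl a b c| ^ 2 ≤ k * t ^ 4 := by
      rw [← hy2]; refine Real.sqrt_le_iff.2 ⟨by positivity, hΔ1.trans (le_of_eq (by ring))⟩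
    have e2 : 1 ≤ k ^ 2 * t ^ 8 / r4 |Dl a b c| ^ 2 := by
      rw [le_div_iff₀ (by positivity), one_mul]
      refine hyk.trans ?_
      have h1 : k ≤ k ^ 2 := by nlinarith only [hk]
      have h2 : t ^ 4 ≤ t ^ 8 := pow_le_pow_right₀ ht (by norm_num)
      gcongr
    rw [e1]
    set x := r4 |a|
    set y := r4 |Dl a b c|
    have e3 : 2 * (15 / 2 * (k ^ 2 * t ^ 8 / y ^ 2) + 1) ≤ 17 * (k ^ 2 * t ^ 8 / y ^ 2) := by linarith only [e2]
    refine (mul_le_mul_of_nonneg_right e3 (by positivity)).trans ?_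
    rw [← hy]
    have e4 : 17 * (k ^ 2 * t ^ 8 / y ^ 2) * (2 * (k ^ 2 * t ^ 8) / y ^ 4) = 34 * k ^ 4 * t ^ 13 / (x ^ 3 * y ^ 6) * (t * x) ^ 3 := by field_simp; norm_num
    have e5 : 34 * k ^ 4 * t ^ 13 / (x ^ 3 * y ^ 3) = 34 * k ^ 4 * t ^ 13 / (x ^ 3 * y ^ 6) * y ^ 3 := by field_simp
    rw [e4, e5]
    gcongr
end

open Filter Topology MeasureTheory
open scoped ENNReal
noncomputable section

def TT (k t α β : ℝ) : Set Z5 := {x | x.1.1 ≠ 0 ∧ |(x.1.2.1 : ℝ)| ≤ 2 * |(x.1.1 : ℝ)| ∧ |(x.1.1 : ℝ)| ≤ α ^ 4 ∧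
  |Dl x.1.1 x.1.2.1 x.1.2.2| ≤ β ^ 4 ∧ x.2 ∈ DE k t x.1.1 x.1.2.1 x.1.2.2}

def fT (k t α β : ℝ) (a b c : ℤ) : ℝ≥0∞ := ({y | ((a, b, c), y) ∈ TT k t α β}.encard : ℝ≥0∞)

lemma fT_zero {k t α β : ℝ} {a b c : ℤ} (h : ¬ (a ≠ 0 ∧ |(b : ℝ)| ≤ 2 * |(a : ℝ)| ∧ |(a : ℝ)| ≤ α ^ 4 ∧
  |Dl a b c| ≤ β ^ 4)) : fT k t α β a b c = 0 := by
  have : {y | ((a, b, c), y) ∈ TT k t α β} = ∅ := Set.eq_empty_of_forall_notMem fun y hy => h ⟨hy.1, hy.2.1, hy.2.2.1, hy.2.2.2.1⟩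
  simp [fT, this]

lemma fT_le {k t α β : ℝ} {a b c : ℤ} : fT k t α β a b c ≤ ((DE k t a b c).encard : ℝ≥0∞) :=
  enc_mono fun _ hy => hy.2.2.2.2

lemma fT_c {k t α β : ℝ} (hk : 1 ≤ k) (ht : 1 ≤ t) (hβ0 : 0 ≤ β) (hα : α ^ 4 ≤ k ^ 2 * t ^ 4) (hβ : β ^ 4 ≤ k ^ 2 * t ^ 8)
    {a b : ℤ} (ha : a ≠ 0) : ∑' c, fT k t α β a b c ≤ ENNReal.ofReal (40 * k ^ 4 * t ^ 13 / r4 |(a:ℝ)| ^ 6 * (1 + 8 * (β / r4 |(a:ℝ)|))) := by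
  have haR : (a:ℝ) ≠ 0 := by exact_mod_cast ha
  have ha0 : 0 < |(a:ℝ)| := abs_pos.2 haR
  have hx0 : 0 < r4 |(a:ℝ)| := Real.sqrt_pos.2 (Real.sqrt_pos.2 ha0)
  have hx := r4_pow ha0.le
  have ht0 : 0 < t := by linarith
  have hk0 : 0 < k := by linarith
  set c0 : ℤ := round (3 * (b:ℝ) ^ 2 / (8 * a))
  have hc0 : ∀ j : ℤ, j ≠ 0 → 4 * |(a:ℝ)| * |(j:ℝ)| ≤ |Dl a b (j + c0 : ℤ)| := by
    intro j hj
    have h1 := abs_sub_round (3 * (b:ℝ) ^ 2 / (8 * a))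
    have e : Dl a b (j + c0 : ℤ) = 8 * a * (j - (3 * (b:ℝ) ^ 2 / (8 * a) - c0)) := by
      unfold Dl; push_cast; field_simp; ring
    have hj1 : (1:ℝ) ≤ |(j:ℝ)| := by exact_mod_cast Int.one_le_abs hj
    have h2 := abs_sub_abs_le_abs_sub (j:ℝ) (3 * (b:ℝ) ^ 2 / (8 * a) - c0)
    rw [e, abs_mul, abs_mul, abs_of_pos (by norm_num : (0:ℝ) < 8)]
    have h3 : |(j:ℝ)| / 2 ≤ |(j:ℝ) - (3 * (b:ℝ) ^ 2 / (8 * a) - c0)| := by linarith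
    nlinarith only [h3, ha0]
  rw [← (Equiv.addRight c0).tsum_eq]
  have hN : r4 (β ^ 4 / |(a:ℝ)|) ≤ β / r4 |(a:ℝ)| := by
    refine r4_le (by positivity) ?_
    rw [div_pow, hx]
  have h0 : ∀ j : ℤ, fT k t α β a b (j + c0) ≤ ENNReal.ofReal (40 * k ^ 4 * t ^ 13 / r4 |(a:ℝ)| ^ 6) * ENNReal.ofReal (1 / r4 (mj j) ^ 3) := by
    intro j
    by_cases hc : (a ≠ 0 ∧ |(b : ℝ)| ≤ 2 * |(a : ℝ)| ∧ |(a : ℝ)| ≤ α ^ 4 ∧ |Dl a b (j + c0 : ℤ)| ≤ β ^ 4)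
    swap
    · rw [fT_zero hc]; exact zero_le
    obtain ⟨-, -, h3, h4⟩ := hc
    refine fT_le.trans ?_
    have hm := one_le_r4 (one_le_mj j)
    rw [← ENNReal.ofReal_mul (by positivity)]
    by_cases hs : |Dl a b (j + c0 : ℤ)| ≤ |(a:ℝ)|
    · have hj : j = 0 := by
        by_contra hj
        have h1 := hc0 j hj
        have hj1 : (1:ℝ) ≤ |(j:ℝ)| := by exact_mod_cast Int.one_le_abs hj
        nlinarith only [h1, hj1, ha0, hs]
      refine (de_small hk ht haR (h3.trans hα) hs).trans (ENNReal.ofReal_le_ofReal ?_)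
      have : mj j = 1 := by rw [hj]; simp [mj]
      rw [this, r4_one, one_pow, div_one, mul_one]
      gcongr ?_ / _
      have h5 : k ^ 3 ≤ k ^ 4 := pow_le_pow_right₀ hk (by norm_num)
      have h6 : t ^ 12 ≤ t ^ 13 := pow_le_pow_right₀ ht (by norm_num)
      gcongr; norm_num
    · push Not at hs
      refine (de_big hk ht haR (h3.trans hα) hs.le (h4.trans hβ)).trans (ENNReal.ofReal_le_ofReal ?_)
      have hy : r4 |(a:ℝ)| * r4 (mj j) ≤ r4 |Dl a b (j + c0 : ℤ)| := by
        rw [← r4_mul ha0.le]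
        refine r4_mono ?_
        by_cases hj : j = 0
        · rw [hj]; simp only [mj]; simp; rw [hj] at hs; simpa using hs.le
        · have hj1 : (1:ℝ) ≤ |(j:ℝ)| := by exact_mod_cast Int.one_le_abs hj
          rw [mj, max_eq_right hj1]
          have := hc0 j hj
          nlinarith only [this, mul_pos ha0 (one_pos.trans_le hj1)]
      have hy0 : 0 < r4 (mj j) := by linarith
      calc 34 * k ^ 4 * t ^ 13 / (r4 |(a:ℝ)| ^ 3 * r4 |Dl a b (j + c0 : ℤ)| ^ 3)
          ≤ 40 * k ^ 4 * t ^ 13 / (r4 |(a:ℝ)| ^ 3 * (r4 |(a:ℝ)| * r4 (mj j)) ^ 3) := by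
            gcongr; norm_num
        _ = _ := by field_simp
  refine (ENNReal.tsum_le_tsum (f := fun j => fT k t α β a b (Equiv.addRight c0 j)) (g := fun j => ENNReal.ofReal (40 * k ^ 4 * t ^ 13 / r4 |(a:ℝ)| ^ 6) *
      (if |(j:ℝ)| ≤ β ^ 4 / |(a:ℝ)| then ENNReal.ofReal (1 / r4 (mj j) ^ 3) else 0)) fun j => ?_).trans ?_
  · simp only [Equiv.coe_addRight]
    split_ifs with hj
    · exact h0 j
    · rw [fT_zero]; · simp
      rintro ⟨-, -, -, h4⟩
      push Not at hj
      rw [div_lt_iff₀ ha0] at hj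
      have hj0 : j ≠ 0 := by
        rintro rfl
        simp at hj
        have : 0 ≤ β ^ 4 := by positivity
        linarith
      have := hc0 j hj0
      nlinarith only [this, h4, hj, mul_nonneg ha0.le (abs_nonneg (j:ℝ))]
  · rw [ENNReal.tsum_mul_left, ENNReal.ofReal_mul (by positivity)]
    gcongr
    refine (S34 (N := β ^ 4 / |(a:ℝ)|) (by positivity) _ (fun j => ?_) (fun j hj => ?_)).trans (ENNReal.ofReal_le_ofReal (by linarith))
    · split_ifs
      · exact le_rfl
      · exact zero_le
    · rw [if_neg (not_le.2 hj)]

theorem TT_count {k t α β : ℝ} (hk : 1 ≤ k) (ht : 1 ≤ t) (hα0 : 0 ≤ α) (hβ0 : 0 ≤ β) (hα : α ^ 4 ≤ k ^ 2 * t ^ 4) (hβ : β ^ 4 ≤ k ^ 2 * t ^ 8) :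
    ((TT k t α β).encard : ℝ≥0∞) ≤ ENNReal.ofReal (14400 * k ^ 4 * t ^ 13 * (α ^ 2 + α * β)) := by
  have ht0 : 0 < t := by linarith
  have hk0 : 0 < k := by linarith
  rcases lt_or_ge α 1 with h1 | h1
  · have : TT k t α β = ∅ := by
      refine Set.eq_empty_of_forall_notMem fun x hx => ?_
      have h2 : (1:ℝ) ≤ |(x.1.1:ℝ)| := by exact_mod_cast Int.one_le_abs hx.1
      have h3 := hx.2.2.1
      have : α ^ 4 < 1 := pow_lt_one₀ hα0 h1 (by norm_num)
      linarith
    simp [this]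
  rw [encard_fib, ENNReal.tsum_prod']
  have hb : ∀ a : ℤ, ∑' y : ℤ × ℤ, ({z | ((a, y), z) ∈ TT k t α β}.encard : ℝ≥0∞) ≤
      ENNReal.ofReal (200 * k ^ 4 * t ^ 13 * (α + 8 * β)) * (if a ≠ 0 ∧ |(a:ℝ)| ≤ α ^ 4 then ENNReal.ofReal (1 / r4 (mj a) ^ 3) else 0) := by
    intro a
    rw [ENNReal.tsum_prod']
    change ∑' b, ∑' c, fT k t α β a b c ≤ _
    by_cases ha : a ≠ 0 ∧ |(a:ℝ)| ≤ α ^ 4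
    swap
    · rw [if_neg ha, mul_zero]
      refine le_of_eq (ENNReal.tsum_eq_zero.2 fun b => ENNReal.tsum_eq_zero.2 fun c => fT_zero fun h => ha ⟨h.1, h.2.2.1⟩)
    rw [if_pos ha]
    have haR : (a:ℝ) ≠ 0 := by exact_mod_cast ha.1
    have ha0 : 0 < |(a:ℝ)| := abs_pos.2 haR
    have ha1 : (1:ℝ) ≤ |(a:ℝ)| := by exact_mod_cast Int.one_le_abs ha.1
    have hx0 : 0 < r4 |(a:ℝ)| := Real.sqrt_pos.2 (Real.sqrt_pos.2 ha0)
    have hx := r4_pow ha0.le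
    have hmj : mj a = |(a:ℝ)| := max_eq_right ha1
    have h2 : ∀ b, ∑' c, fT k t α β a b c ≤ {b : ℤ | |(b:ℝ)| ≤ 2 * |(a:ℝ)|}.indicator (fun _ => (1:ℝ≥0∞)) b *
        ENNReal.ofReal (40 * k ^ 4 * t ^ 13 / r4 |(a:ℝ)| ^ 6 * (1 + 8 * (β / r4 |(a:ℝ)|))) := by
      intro b
      by_cases hb : |(b:ℝ)| ≤ 2 * |(a:ℝ)|
      · rw [Set.indicator_of_mem (show b ∈ {b : ℤ | |(b:ℝ)| ≤ 2 * |(a:ℝ)|} from hb), one_mul]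
        exact fT_c hk ht hβ0 hα hβ ha.1
      · refine le_trans (le_of_eq (ENNReal.tsum_eq_zero.2 fun c => fT_zero fun h => hb h.2.1)) zero_le
    refine (ENNReal.tsum_le_tsum h2).trans ?_
    rw [ENNReal.tsum_mul_right, ← tsum_subtype _ (fun _ => (1:ℝ≥0∞)), ENNReal.tsum_set_one]
    have h3 := encard_int (S := {b : ℤ | |(b:ℝ)| ≤ 2 * |(a:ℝ)|}) (D := 4 * |(a:ℝ)|) (by positivity) (fun x hx y hy => by
      have hx : |(x:ℝ)| ≤ 2 * |(a:ℝ)| := hx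
      have hy : |(y:ℝ)| ≤ 2 * |(a:ℝ)| := hy
      have := abs_sub (x:ℝ) y
      linarith)
    refine (mul_le_mul_left h3 _).trans ?_
    rw [← ENNReal.ofReal_mul (by positivity), ← ENNReal.ofReal_mul (by positivity)]
    refine ENNReal.ofReal_le_ofReal ?_
    rw [hmj]
    have hxα : r4 |(a:ℝ)| ≤ α := r4_le hα0 ha.2
    set x := r4 |(a:ℝ)|
    have h4 : 4 * |(a:ℝ)| + 1 ≤ 5 * x ^ 4 := by rw [hx]; linarith
    calc (4 * |(a:ℝ)| + 1) * (40 * k ^ 4 * t ^ 13 / x ^ 6 * (1 + 8 * (β / x)))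
        ≤ (5 * x ^ 4) * (40 * k ^ 4 * t ^ 13 / x ^ 6 * (1 + 8 * (β / x))) := by gcongr
      _ = 200 * k ^ 4 * t ^ 13 * (x + 8 * β) * (1 / x ^ 3) := by field_simp; norm_num
      _ ≤ _ := by gcongr
  refine (ENNReal.tsum_le_tsum hb).trans ?_
  rw [ENNReal.tsum_mul_left]
  have h5 := S34 (N := α ^ 4) (by positivity) (fun a : ℤ => if a ≠ 0 ∧ |(a:ℝ)| ≤ α ^ 4 then ENNReal.ofReal (1 / r4 (mj a) ^ 3) else 0)
    (fun j => by
      split_ifs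
      · exact le_rfl
      · exact zero_le) (fun j hj => if_neg fun h => not_le.2 hj h.2)
  refine (mul_le_mul_right h5 _).trans ?_
  rw [← ENNReal.ofReal_mul (by positivity)]
  refine ENNReal.ofReal_le_ofReal ?_
  have h6 : r4 (α ^ 4) ≤ α := r4_le hα0 le_rfl
  have h7 := r4_nn (α ^ 4)
  calc 200 * k ^ 4 * t ^ 13 * (α + 8 * β) * (1 + 8 * r4 (α ^ 4)) ≤ 200 * k ^ 4 * t ^ 13 * (8 * α + 8 * β) * (9 * α) := by
        gcongr <;> linarith
    _ = _ := by ring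
end

open Filter Topology MeasureTheory
open scoped ENNReal
noncomputable section

def TL (η C L : ℝ) : Set Z5 := {x | x.1.1 ≠ 0 ∧ |(x.1.2.1 : ℝ)| ≤ 2 * |(x.1.1 : ℝ)| ∧
  (∃ u w m, Par x.1.1 x.1.2.1 x.1.2.2 x.2.1 x.2.2 u w m ∧ 3 / 4 ≤ w ∧ 0 < Dv x.1.1 x.1.2.1 u w m) ∧
  |Ir x.1.1 x.1.2.1 x.1.2.2 x.2.1 x.2.2| < L ^ 2 ∧ |Jr x.1.1 x.1.2.1 x.1.2.2 x.2.1 x.2.2| < C * L ^ 2 ∧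
  (|(x.1.1 : ℝ)| ≤ η * L ∨ |Dl x.1.1 x.1.2.1 x.1.2.2| ≤ η * L ^ 2)}

lemma tail_bd {C L a b c d e u w m : ℝ} (hC : 0 < C) (hL : 1 ≤ L) (hP : Par a b c d e u w m) (hw : 3 / 4 ≤ w)
    (hD : 0 < Dv a b u w m) (hI : |Ir a b c d e| < L ^ 2) (hJ : |Jr a b c d e| < C * L ^ 2) :
    |a| ≤ 2 * (1 + C) * L ∧ |Dl a b c| ≤ 24 * (1 + C) ^ 2 * L ^ 2 := by
  have hL2 : 1 ≤ L ^ 2 := one_le_pow₀ hL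
  rw [hP.J, abs_mul, abs_mul, abs_neg, abs_two, abs_of_pos (by positivity : 0 < 9 * Dv a b u w m + m ^ 2)] at hJ
  rw [hP.I, abs_lt] at hI
  rw [hP.Dl]
  have hS : Dv a b u w m + m ^ 2 = w * (b + 4 * u * a) ^ 2 + (2 * w * a - m) ^ 2 := by unfold Dv; ring
  set D := Dv a b u w m
  set s := b + 4 * u * a
  have hm0 := abs_nonneg m
  have hm : |m| ≤ (1 + C) * L := by
    by_contra h
    push Not at h
    have h1 : ((1 + C) * L) ^ 3 < |m| ^ 3 := by gcongr
    have h3 : |m| ^ 3 = |m| * m ^ 2 := by rw [← sq_abs m]; ring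
    have h4 : C * L ^ 2 ≤ ((1 + C) * L) ^ 3 := by
      have h5 : ((1 + C) * L) ^ 3 = (1 + C) ^ 3 * L * L ^ 2 := by ring
      have h6 : C ≤ (1 + C) ^ 3 * L := by
        have : C ≤ (1 + C) ^ 3 := by nlinarith only [hC, sq_nonneg C, mul_pos hC (mul_pos hC hC)]
        nlinarith only [this, hL, hC]
      rw [h5]; gcongr
    nlinarith only [mul_nonneg hm0 hD.le, h1, h3, h4, hJ, hm0, mul_nonneg hm0 (sq_nonneg m)]
  have hm2 : m ^ 2 ≤ ((1 + C) * L) ^ 2 := by rw [← sq_abs m]; gcongr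
  have hLL : L ^ 2 ≤ ((1 + C) * L) ^ 2 := by
    gcongr; nlinarith only [hL, hC]
  have hSb : D + m ^ 2 ≤ 2 * ((1 + C) * L) ^ 2 := by linarith [hI.1]
  set M := (1 + C) * L
  have hM : 0 < M := by positivity
  have hs2 : s ^ 2 ≤ 8 / 3 * M ^ 2 := by nlinarith only [hSb, hS, sq_nonneg (2 * w * a - m), mul_nonneg (sub_nonneg.2 hw) (sq_nonneg s)]
  have h2 : |2 * w * a - m| ≤ 3 / 2 * M := by
    apply abs_le_of_sq_le_sq _ (by positivity)
    nlinarith only [hSb, hS, mul_nonneg (by linarith : 0 ≤ w) (sq_nonneg s), sq_nonneg M]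
  have h3 : 2 * w * |a| ≤ 5 / 2 * M := by
    have : |2 * w * a| ≤ |2 * w * a - m| + |m| := by
      have := abs_add_le (2 * w * a - m) m
      rwa [sub_add_cancel] at this
    rw [abs_mul, abs_of_pos (by linarith)] at this
    linarith
  have ha : |a| ≤ 2 * M := by nlinarith only [h3, hw, abs_nonneg a, hM]
  refine ⟨by linarith, ?_⟩
  have h4 : |8 * a * m - 3 * s ^ 2| ≤ 8 * (|a| * |m|) + 3 * s ^ 2 := by
    refine (abs_sub _ _).trans (le_of_eq ?_)
    rw [abs_mul, abs_mul, abs_of_nonneg (by positivity : 0 ≤ 3 * s ^ 2)]; norm_num; ring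
  have h5 : |a| * |m| ≤ 2 * M * M := by gcongr
  have h6 : 24 * (1 + C) ^ 2 * L ^ 2 = 24 * M ^ 2 := by ring
  linarith

lemma TL_sub {C θ t : ℝ} (hC : 0 < C) (hθ : 0 < θ) (ht : 1 ≤ t) {κ : ℝ} (hκ : κ = 24 * (1 + C)) :
    TL (θ ^ 4) C (t ^ 4) ⊆ TT (κ ^ 2) t (θ * t) (κ * t ^ 2) ∪ TT (κ ^ 2) t (κ * t) (θ * t ^ 2) := by
  rintro x ⟨ha0, hb, ⟨u, w, m, hP, hw, hD⟩, hI, hJ, hor⟩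
  obtain ⟨h1, h2⟩ := tail_bd hC (one_le_pow₀ ht) hP hw hD hI hJ
  have hκ1 : 24 ≤ κ := by linarith
  have hκ4 : κ ^ 2 ≤ κ ^ 4 := by gcongr <;> [linarith; norm_num]
  have hκκ : κ ≤ κ ^ 2 := by nlinarith only [hκ1]
  have hk2 : 24 * (1 + C) ^ 2 ≤ κ ^ 4 := by
    refine le_trans ?_ hκ4
    rw [hκ]; nlinarith only [sq_nonneg (1 + C)]
  have hk1 : 2 * (1 + C) ≤ κ ^ 4 := by linarith
  have hkC : C ≤ κ ^ 4 := by linarith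
  have e8 : (t ^ 4) ^ 2 = t ^ 8 := by ring
  have hx2 : x.2 ∈ DE (κ ^ 2) t x.1.1 x.1.2.1 x.1.2.2 := by
    have e : (κ ^ 2) ^ 2 = κ ^ 4 := by ring
    constructor
    · rw [e8] at hI; rw [e]
      have : t ^ 8 ≤ κ ^ 4 * t ^ 8 := le_mul_of_one_le_left (by positivity) (by linarith)
      linarith
    · rw [e8] at hJ; rw [e]
      have : C * t ^ 8 ≤ κ ^ 4 * t ^ 8 := by gcongr
      linarith
  rw [e8] at h2 hor
  have h1' : |(x.1.1 : ℝ)| ≤ (κ * t) ^ 4 := by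
    rw [mul_pow]; exact h1.trans (by gcongr)
  have h2' : |Dl x.1.1 x.1.2.1 x.1.2.2| ≤ (κ * t ^ 2) ^ 4 := by
    have e : (κ * t ^ 2) ^ 4 = κ ^ 4 * t ^ 8 := by ring
    rw [e]; exact h2.trans (by gcongr)
  rcases hor with h | h
  · exact Or.inl ⟨ha0, hb, by rw [mul_pow]; exact h, h2', hx2⟩
  · exact Or.inr ⟨ha0, hb, h1', by rw [show (θ * t ^ 2) ^ 4 = θ ^ 4 * t ^ 8 by ring]; exact h, hx2⟩

lemma TL_ev {C ε : ℝ} (hC : 0 < C) (hε : 0 < ε) : ∃ η > 0, ∀ᶠ L : ℝ in atTop, ((TL η C L).encard : ℝ≥0∞) ≤ ENNReal.ofReal (ε * L ^ 4) := by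
  obtain ⟨κ, hκ⟩ : ∃ κ, κ = 24 * (1 + C) := ⟨_, rfl⟩
  have hκ1 : 24 ≤ κ := by linarith
  set A := 14400 * (κ ^ 2) ^ 4 with hA
  have hA0 : 0 < A := by positivity
  obtain ⟨θ, hθ, hθ1, hθ2⟩ : ∃ θ > 0, θ ≤ 1 ∧ A * (4 * κ * θ) ≤ ε := by
    refine ⟨min 1 (ε / (A * (4 * κ))), by positivity, min_le_left _ _, ?_⟩
    have : min 1 (ε / (A * (4 * κ))) ≤ ε / (A * (4 * κ)) := min_le_right _ _
    rw [le_div_iff₀ (by positivity)] at this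
    linarith
  refine ⟨θ ^ 4, by positivity, ?_⟩
  set T := (1 + κ ^ 2) / (2 * κ * θ) + 1 with hT
  have hT1 : 1 ≤ T := by
    have : 0 < (1 + κ ^ 2) / (2 * κ * θ) := by positivity
    linarith
  filter_upwards [eventually_ge_atTop (T ^ 4)] with L hL
  have hL0 : 0 ≤ L := le_trans (by positivity) hL
  obtain ⟨t, rfl⟩ : ∃ t, t = r4 L := ⟨_, rfl⟩
  have hrt := r4_pow hL0
  set t := r4 L
  have hTt : T ≤ t := by
    rw [← hrt] at hL
    exact le_of_pow_le_pow_left₀ (by norm_num) (r4_nn _) hL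
  have ht : 1 ≤ t := hT1.trans hTt
  rw [← hrt]
  refine (enc_mono (TL_sub hC hθ ht hκ)).trans ?_
  have hun : ∀ S T : Set Z5, ((S ∪ T).encard : ℝ≥0∞) ≤ S.encard + T.encard := fun S T => by
    exact_mod_cast (Set.encard_union_le S T)
  refine (hun _ _).trans ?_
  have hk : 1 ≤ κ ^ 2 := one_le_pow₀ (by linarith)
  have hκ4 : 1 ≤ κ ^ 4 := one_le_pow₀ (by linarith)
  have hθ4 : θ ^ 4 ≤ 1 := pow_le_one₀ hθ.le hθ1
  have q1 : (θ * t) ^ 4 ≤ (κ ^ 2) ^ 2 * t ^ 4 := by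
    rw [mul_pow]; gcongr; nlinarith
  have q2 : (κ * t ^ 2) ^ 4 ≤ (κ ^ 2) ^ 2 * t ^ 8 := by apply le_of_eq; ring
  have q3 : (κ * t) ^ 4 ≤ (κ ^ 2) ^ 2 * t ^ 4 := by apply le_of_eq; ring
  have q4 : (θ * t ^ 2) ^ 4 ≤ (κ ^ 2) ^ 2 * t ^ 8 := by
    rw [mul_pow, show (t ^ 2) ^ 4 = t ^ 8 by ring]; gcongr; nlinarith
  refine (add_le_add (TT_count hk ht (by positivity) (by positivity) q1 q2) (TT_count hk ht (by positivity) (by positivity) q3 q4)).trans ?_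
  rw [← ENNReal.ofReal_add (by positivity) (by positivity)]
  refine ENNReal.ofReal_le_ofReal ?_
  have hTe : 1 + κ ^ 2 ≤ 2 * κ * θ * t := by
    have : (1 + κ ^ 2) / (2 * κ * θ) ≤ t := by linarith
    rw [div_le_iff₀ (by positivity)] at this
    linarith
  have hθ22 : θ ^ 2 ≤ 1 := pow_le_one₀ hθ.le hθ1
  calc 14400 * (κ ^ 2) ^ 4 * t ^ 13 * ((θ * t) ^ 2 + θ * t * (κ * t ^ 2)) + 14400 * (κ ^ 2) ^ 4 * t ^ 13 * ((κ * t) ^ 2 + κ * t * (θ * t ^ 2))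
      = A * t ^ 15 * ((θ ^ 2 + κ ^ 2) + 2 * κ * θ * t) := by rw [hA]; ring
    _ ≤ A * t ^ 15 * (2 * κ * θ * t + 2 * κ * θ * t) := by gcongr; linarith
    _ = A * (4 * κ * θ) * t ^ 16 := by ring
    _ ≤ ε * t ^ 16 := by gcongr
    _ = _ := by ring
end

open Filter Topology MeasureTheory
open scoped ENNReal
noncomputable section

attribute [ext] BQF

def act (p q r s : ℤ) (f : BQF) : BQF where
  a := f.evalZ p q
  b := 4 * f.a * p ^ 3 * r + f.b * (3 * p ^ 2 * r * q + p ^ 3 * s) + f.c * (2 * p * r * q ^ 2 + 2 * p ^ 2 * q * s) +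
    f.d * (r * q ^ 3 + 3 * p * q ^ 2 * s) + 4 * f.e * q ^ 3 * s
  c := 6 * f.a * p ^ 2 * r ^ 2 + f.b * (3 * p * r ^ 2 * q + 3 * p ^ 2 * r * s) + f.c * (r ^ 2 * q ^ 2 + 4 * p * q * r * s + p ^ 2 * s ^ 2) +
    f.d * (3 * q ^ 2 * s * r + 3 * q * s ^ 2 * p) + 6 * f.e * q ^ 2 * s ^ 2
  d := 4 * f.a * p * r ^ 3 + f.b * (r ^ 3 * q + 3 * p * r ^ 2 * s) + f.c * (2 * p * r * s ^ 2 + 2 * r ^ 2 * q * s) +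
    f.d * (p * s ^ 3 + 3 * r * s ^ 2 * q) + 4 * f.e * q * s ^ 3
  e := f.evalZ r s

def evC (f : BQF) (x y : ℂ) : ℂ := f.a * x ^ 4 + f.b * x ^ 3 * y + f.c * x ^ 2 * y ^ 2 + f.d * x * y ^ 3 + f.e * y ^ 4

lemma act_evalZ (p q r s : ℤ) (f : BQF) (x y : ℤ) : (act p q r s f).evalZ x y = f.evalZ (x * p + y * r) (x * q + y * s) := by
  simp only [act, BQF.evalZ]; ring

lemma act_evC (p q r s : ℤ) (f : BQF) (x y : ℂ) : evC (act p q r s f) x y = evC f (x * p + y * r) (x * q + y * s) := by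
  simp only [act, BQF.evalZ, evC]; push_cast; ring

lemma bqf_ext {f g : BQF} (h : ∀ x y, f.evalZ x y = g.evalZ x y) : f = g := by
  have h1 := h 1 0
  have h2 := h 0 1
  have h3 := h 1 1
  have h4 := h 1 (-1)
  have h5 := h 2 1
  simp only [BQF.evalZ] at *
  norm_num at *
  ext <;> lia

lemma equiv_iff {f g : BQF} : BQF.Equivalent f g ↔ ∃ p q r s, IsUnit (p * s - q * r) ∧ g = act p q r s f := by
  constructor
  · rintro ⟨γ, h1, h2⟩
    refine ⟨γ 0 0, γ 0 1, γ 1 0, γ 1 1, by rwa [← Matrix.det_fin_two], bqf_ext fun x y => ?_⟩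
    rw [h2, act_evalZ]
  · rintro ⟨p, q, r, s, h1, rfl⟩
    refine ⟨!![p, q; r, s], by rwa [Matrix.det_fin_two_of], fun x y => ?_⟩
    rw [act_evalZ]; simp

lemma act_I (p q r s : ℤ) (f : BQF) : (act p q r s f).I = (p * s - q * r) ^ 4 * f.I := by
  simp only [act, BQF.evalZ, BQF.I]; ring

set_option maxHeartbeats 4000000 in
lemma act_J (p q r s : ℤ) (f : BQF) : (act p q r s f).J = (p * s - q * r) ^ 6 * f.J := by
  simp only [act, BQF.evalZ, BQF.J]; ring

lemma eqv_I {f g : BQF} (h : BQF.Equivalent f g) : g.I = f.I := by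
  obtain ⟨p, q, r, s, h', rfl⟩ := equiv_iff.1 h
  rw [act_I]; rcases Int.isUnit_iff.1 h' with h | h <;> rw [h] <;> norm_num

lemma eqv_J {f g : BQF} (h : BQF.Equivalent f g) : g.J = f.J := by
  obtain ⟨p, q, r, s, h', rfl⟩ := equiv_iff.1 h
  rw [act_J]; rcases Int.isUnit_iff.1 h' with h | h <;> rw [h] <;> norm_num

lemma eqv_equivalence : Equivalence BQF.Equivalent where
  refl f := ⟨1, by simp, by simp⟩
  symm := by
    rintro f g ⟨γ, h1, h2⟩
    refine ⟨γ⁻¹, Matrix.isUnit_nonsing_inv_det _ h1, fun x y => ?_⟩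
    have h3 : γ⁻¹ * γ = 1 := Matrix.nonsing_inv_mul _ h1
    have e := fun i j => congrFun (congrFun h3 i) j
    have e00 := e 0 0
    have e01 := e 0 1
    have e10 := e 1 0
    have e11 := e 1 1
    simp only [Matrix.mul_apply, Fin.sum_univ_two, Matrix.one_apply] at e00 e01 e10 e11
    norm_num at e00 e01 e10 e11
    rw [h2]
    congr 1
    · linear_combination (-x) * e00 - y * e10
    · linear_combination (-x) * e01 - y * e11
  trans := by
    rintro f g k ⟨γ, h1, h2⟩ ⟨δ, h3, h4⟩
    refine ⟨δ * γ, by rw [Matrix.det_mul]; exact h3.mul h1, fun x y => ?_⟩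
    rw [h4, h2]
    congr 1 <;> simp only [Matrix.mul_apply, Fin.sum_univ_two] <;> ring

end

open Filter Topology MeasureTheory
open scoped ENNReal
noncomputable section

abbrev PF (f : BQF) (u w m : ℝ) : Prop := Par (f.a : ℝ) f.b f.c f.d f.e u w m
abbrev DF (f : BQF) (u w m : ℝ) : ℝ := Dv (f.a : ℝ) f.b u w m

lemma PF.fact {f : BQF} {u w m : ℝ} (h : PF f u w m) (x y : ℂ) : evC f x y = ((x - u * y) ^ 2 + w * y ^ 2) *
    (f.a * x ^ 2 + (f.b + 2 * u * f.a) * x * y + (m - f.a * (u ^ 2 + w) - u * (f.b + 2 * u * f.a)) * y ^ 2) := by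
  obtain ⟨h1, h2, h3⟩ := h
  have h1 := congrArg (fun x : ℝ => (x : ℂ)) h1
  have h2 := congrArg (fun x : ℝ => (x : ℂ)) h2
  have h3 := congrArg (fun x : ℝ => (x : ℂ)) h3
  push_cast at h1 h2 h3
  unfold evC
  rw [h1, h2, h3]; ring

lemma PF.root {f : BQF} {u v m : ℝ} (h : PF f u (v ^ 2) m) : evC f ⟨u, v⟩ 1 = 0 := by
  rw [h.fact]
  have : ((⟨u, v⟩ : ℂ) - u * 1) ^ 2 + ((v ^ 2 : ℝ) : ℂ) * 1 ^ 2 = 0 := by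
    apply Complex.ext <;> simp [pow_two]
  rw [this, zero_mul]

lemma root_PF {f : BQF} {u v : ℝ} (hv : v ≠ 0) (h : evC f ⟨u, v⟩ 1 = 0) : PF f u (v ^ 2) (f.c + 3 * u * f.b + 6 * u ^ 2 * f.a) := by
  set m : ℝ := f.c + 3 * u * f.b + 6 * u ^ 2 * f.a with hm
  set z : ℂ := ⟨u, v⟩ with hz
  have hq : (z - u) ^ 2 + (v:ℂ) ^ 2 = 0 := by
    apply Complex.ext <;> simp [pow_two, hz]
  set A : ℝ := f.d - (v ^ 2 * (f.b + 4 * u * f.a) + 3 * u ^ 2 * f.b + 8 * u ^ 3 * f.a - 2 * u * m) with hA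
  set B : ℝ := f.e - ((u ^ 2 + v ^ 2) * (m - f.a * (u ^ 2 + v ^ 2) - u * (f.b + 2 * u * f.a))) with hB
  have e : (A : ℂ) * z + B = 0 := by
    rw [hA, hB, hm, ← h]; unfold evC; push_cast
    linear_combination (-(f.a * z ^ 2 + (f.b + 2 * u * f.a) * z + (f.c + 3 * u * f.b + 6 * u ^ 2 * f.a - f.a * (u ^ 2 + v ^ 2) - u * (f.b + 2 * u * f.a)))) * hq
  have hA0 : A = 0 := by
    have := congrArg Complex.im e
    simp [hz, hv] at this; exact this
  have hB0 : B = 0 := by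
    have := congrArg Complex.re e
    simpa [hz, hA0] using this
  refine ⟨by rw [hm]; ring, by linarith, by linarith⟩

lemma PF.disc {f : BQF} {u w m : ℝ} (h : PF f u w m) : 4 * (f.I : ℝ) ^ 3 - (f.J : ℝ) ^ 2 = -108 * DF f u w m * (m ^ 2 + DF f u w m) ^ 2 := by
  have h1 : (f.I : ℝ) = Ir f.a f.b f.c f.d f.e := by unfold BQF.I Ir; push_cast; ring
  have h2 : (f.J : ℝ) = Jr f.a f.b f.c f.d f.e := by unfold BQF.J Jr; push_cast; ring
  rw [h1, h2, h.I, h.J]; ring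

lemma BQF.Ir_eq (f : BQF) : Ir (f.a:ℝ) f.b f.c f.d f.e = (f.I : ℝ) := by unfold BQF.I Ir; push_cast; ring
lemma BQF.Jr_eq (f : BQF) : Jr (f.a:ℝ) f.b f.c f.d f.e = (f.J : ℝ) := by unfold BQF.J Jr; push_cast; ring

lemma DF_iff {f : BQF} {u w m : ℝ} (h : PF f u w m) : 0 < DF f u w m ↔ 4 * (f.I : ℝ) ^ 3 - (f.J : ℝ) ^ 2 < 0 := by
  rw [h.disc]
  constructor
  · intro hD; have : 0 < DF f u w m * (m ^ 2 + DF f u w m) ^ 2 := by positivity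
    linarith
  · intro h1
    by_contra h2
    push Not at h2
    nlinarith [mul_nonneg (neg_nonneg.2 h2) (sq_nonneg (m ^ 2 + DF f u w m))]

def qpoly (f : BQF) : Polynomial ℚ := Polynomial.C (f.a : ℚ) * Polynomial.X ^ 4 +
      Polynomial.C (f.b : ℚ) * Polynomial.X ^ 3 +
      Polynomial.C (f.c : ℚ) * Polynomial.X ^ 2 +
      Polynomial.C (f.d : ℚ) * Polynomial.X + Polynomial.C (f.e : ℚ)

lemma irred_no_root {f : BQF} (h : f.Irred) {x y : ℤ} (hxy : ¬ (x = 0 ∧ y = 0)) : f.evalZ x y ≠ 0 := by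
  obtain ⟨ha, hi⟩ := h
  have hi : Irreducible (qpoly f) := hi
  intro h0
  by_cases hy : y = 0
  · subst hy
    simp [BQF.evalZ, ha] at h0
    exact hxy ⟨h0, rfl⟩
  · have hyq : (y:ℚ) ≠ 0 := by exact_mod_cast hy
    have h1 : (qpoly f).IsRoot ((x:ℚ) / y) := by
      have h0 : ((f.evalZ x y : ℤ) : ℚ) = 0 := by rw [h0]; simp
      unfold BQF.evalZ at h0; push_cast at h0
      simp only [qpoly, Polynomial.IsRoot, Polynomial.eval_add, Polynomial.eval_mul, Polynomial.eval_C, Polynomial.eval_pow, Polynomial.eval_X]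
      field_simp
      linear_combination h0
    have h2 := Polynomial.degree_eq_one_of_irreducible_of_root hi h1
    have haq : (f.a:ℚ) ≠ 0 := by exact_mod_cast ha
    have h3 : (qpoly f).degree = 4 := by
      unfold qpoly; compute_degree!
    rw [h3] at h2; norm_num at h2

lemma irred_simple {f : BQF} (h : f.Irred) {r : ℝ} (hr : f.evalR r 1 = 0) : 4 * f.a * r ^ 3 + 3 * f.b * r ^ 2 + 2 * f.c * r + f.d ≠ 0 := by
  obtain ⟨ha, hi⟩ := h
  have hi : Irreducible (qpoly f) := hi
  have hs := hi.separable
  have h1 := hs.aeval_derivative_ne_zero (x := r) (by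
    simp [qpoly, BQF.evalR] at hr ⊢; linarith)
  intro h2
  apply h1
  simp [qpoly]
  linarith

lemma two_roots {f : BQF} (h : f.Irred) (h2 : f.realRoots.ncard = 2) : ∃ u v m, 0 < v ∧ PF f u (v ^ 2) m ∧ 0 < DF f u (v ^ 2) m := by
  obtain ⟨r1, r2, h12, hR⟩ := Set.ncard_eq_two.1 h2
  have ha : (f.a : ℝ) ≠ 0 := by exact_mod_cast h.1
  have e1 : f.evalR r1 1 = 0 := by
    have : r1 ∈ f.realRoots := by rw [hR]; simp
    exact this
  have e2 : f.evalR r2 1 = 0 := by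
    have : r2 ∈ f.realRoots := by rw [hR]; simp
    exact this
  have s1 := irred_simple h e1
  have s2 := irred_simple h e2
  have hall : ∀ r, f.evalR r 1 = 0 → r = r1 ∨ r = r2 := by
    intro r hr
    have : r ∈ f.realRoots := hr
    rw [hR] at this; simpa using this
  simp only [BQF.evalR] at e1 e2 hall
  unfold PF DF
  generalize (f.a : ℝ) = a at *
  generalize (f.b : ℝ) = b at *
  generalize (f.c : ℝ) = c at *
  generalize (f.d : ℝ) = d at *
  generalize (f.e : ℝ) = e at *
  obtain ⟨β, hβ⟩ : ∃ β, b = β - a * (r1 + r2) := ⟨b + a * (r1 + r2), by ring⟩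
  obtain ⟨γ, hγ⟩ : ∃ γ, c = γ - β * (r1 + r2) + a * r1 * r2 := ⟨c + β * (r1 + r2) - a * r1 * r2, by ring⟩
  obtain ⟨d', hd'⟩ : ∃ d', d = d' - γ * (r1 + r2) + β * r1 * r2 := ⟨d + γ * (r1 + r2) - β * r1 * r2, by ring⟩
  obtain ⟨e', he'⟩ : ∃ e', e = e' + γ * r1 * r2 := ⟨e - γ * r1 * r2, by ring⟩
  have k1 : d' * r1 + e' = 0 := by rw [hβ, hγ, hd', he'] at e1; linear_combination e1
  have k2 : d' * r2 + e' = 0 := by rw [hβ, hγ, hd', he'] at e2; linear_combination e2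
  have kd : d' = 0 := by
    have : d' * (r1 - r2) = 0 := by linear_combination k1 - k2
    exact (mul_eq_zero.1 this).resolve_right (sub_ne_zero.2 h12)
  have ke : e' = 0 := by simpa [kd] using k1
  rw [kd, zero_sub] at hd'
  rw [ke, zero_add] at he'
  have hno : ∀ r, a * r ^ 2 + β * r + γ ≠ 0 := by
    intro r hr
    have h0 : a * r ^ 4 + b * r ^ 3 * 1 + c * r ^ 2 * 1 ^ 2 + d * r * 1 ^ 3 + e * 1 ^ 4 = 0 := by
      rw [hβ, hγ, hd', he']; linear_combination (r - r1) * (r - r2) * hr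
    rcases hall r h0 with h | h
    · apply s1; rw [hβ, hγ, hd']; rw [h] at hr; linear_combination (r1 - r2) * hr
    · apply s2; rw [hβ, hγ, hd']; rw [h] at hr; linear_combination (r2 - r1) * hr
  have hneg : 0 < 4 * a * γ - β ^ 2 := by
    by_contra hn
    push Not at hn
    apply hno ((-β + √(β ^ 2 - 4 * a * γ)) / (2 * a))
    have := Real.sq_sqrt (show 0 ≤ β ^ 2 - 4 * a * γ by linarith)
    generalize √(β ^ 2 - 4 * a * γ) = y at *
    field_simp
    linear_combination this
  have hw : 0 < (4 * a * γ - β ^ 2) / (4 * a ^ 2) := by positivity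
  refine ⟨-β / (2 * a), √((4 * a * γ - β ^ 2) / (4 * a ^ 2)), c + 3 * (-β / (2 * a)) * b + 6 * (-β / (2 * a)) ^ 2 * a, Real.sqrt_pos.2 hw, ?_, ?_⟩
  · rw [Real.sq_sqrt hw.le]
    refine ⟨by ring, ?_, ?_⟩
    · rw [hd', hγ, hβ]; field_simp; ring
    · rw [he', hγ, hβ]; field_simp; ring
  · rw [Real.sq_sqrt hw.le]
    have : Dv a b (-β / (2 * a)) ((4 * a * γ - β ^ 2) / (4 * a ^ 2)) (c + 3 * (-β / (2 * a)) * b + 6 * (-β / (2 * a)) ^ 2 * a) =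
        (4 * a * γ - β ^ 2) / (4 * a ^ 2) * a ^ 2 * (r1 - r2) ^ 2 := by
      unfold Dv; rw [hγ, hβ]; field_simp; ring
    have h3 := sub_ne_zero.2 h12
    rw [this]; positivity
end

open Filter Topology MeasureTheory
open scoped ENNReal
noncomputable section

def toZb (f : BQF) : Z5 := ((f.a, f.b, f.c), f.d, f.e)
def bneg (f : BQF) : BQF := ⟨-f.a, -f.b, -f.c, -f.d, -f.e⟩

lemma toZb_inj : Function.Injective toZb := by
  intro f g h
  simp only [toZb, Prod.mk.injEq] at h
  ext <;> tauto

lemma bneg_inj : Function.Injective bneg := by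
  intro f g h
  simp only [bneg, BQF.mk.injEq, neg_inj] at h
  ext <;> tauto

lemma PF.neg {f : BQF} {u w m : ℝ} (h : PF f u w m) : PF (bneg f) u w (-m) := by
  obtain ⟨h1, h2, h3⟩ := h
  unfold PF bneg; push_cast
  refine ⟨by rw [h1]; ring, by rw [h2]; ring, by rw [h3]; ring⟩
lemma DF_neg {f : BQF} {u w m : ℝ} : DF (bneg f) u w (-m) = DF f u w m := by
  unfold DF Dv bneg; push_cast; ring
lemma I_neg (f : BQF) : (bneg f).I = f.I := by unfold BQF.I bneg; ring
lemma J_neg (f : BQF) : (bneg f).J = -f.J := by unfold BQF.J bneg; ring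

lemma exists_rep1 {f : BQF} {u v m : ℝ} (hv : 0 < v) (h : PF f u (v ^ 2) m) (hD : 0 < DF f u (v ^ 2) m) :
    ∃ g u w m, f.Equivalent g ∧ PF g u w m ∧ 0 < DF g u w m ∧ |u| ≤ 1 / 2 ∧ 1 ≤ u ^ 2 + w := by
  set z : UpperHalfPlane := UpperHalfPlane.mk ⟨u, v⟩ hv with hz
  obtain ⟨γ, hγ1, hγ2⟩ := ModularGroup.exists_smul_mem_fd z
  have hroot := h.root
  have hdet := γ.det_coe
  rw [Matrix.det_fin_two] at hdet
  have hsm := UpperHalfPlane.coe_specialLinearGroup_apply γ z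
  have hzc : (z : ℂ) = ⟨u, v⟩ := rfl
  rw [← hzc] at hroot
  have hpos := (γ • z).im_pos
  set z' : ℂ := ((γ • z : UpperHalfPlane) : ℂ) with hz'
  have hre : (γ • z).re = z'.re := rfl
  have him : (γ • z).im = z'.im := rfl
  rw [hre] at hγ2
  rw [him] at hpos
  simp only [algebraMap_int_eq, eq_intCast, Complex.ofReal_intCast] at hsm
  have hden : ((γ 1 0 : ℤ) : ℂ) * z + (γ 1 1 : ℤ) ≠ 0 := by
    intro h0
    rw [h0, div_zero] at hsm
    rw [hsm] at hpos; simp at hpos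
  rw [eq_div_iff hden] at hsm
  set g := act (γ 1 1) (- γ 1 0) (- γ 0 1) (γ 0 0) f with hg
  have hfg : f.Equivalent g := equiv_iff.2 ⟨_, _, _, _, by rw [Int.isUnit_iff]; left; linarith, hg⟩
  have hgr : evC g z' 1 = 0 := by
    have hdc : ((γ 0 0 : ℤ) : ℂ) * (γ 1 1 : ℤ) - (γ 0 1 : ℤ) * (γ 1 0 : ℤ) = 1 := by exact_mod_cast hdet
    have e : evC g z' 1 * (((γ 1 0 : ℤ) : ℂ) * z + (γ 1 1 : ℤ)) ^ 4 = evC f z 1 := by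
      rw [hg, act_evC]
      have q1 : (z' * (γ 1 1 : ℤ) + 1 * (- γ 0 1 : ℤ)) * (((γ 1 0 : ℤ) : ℂ) * z + (γ 1 1 : ℤ)) = z := by
        push_cast
        linear_combination (γ 1 1 : ℂ) * hsm + (z:ℂ) * hdc
      have q2 : (z' * (- γ 1 0 : ℤ) + 1 * (γ 0 0 : ℤ)) * (((γ 1 0 : ℤ) : ℂ) * z + (γ 1 1 : ℤ)) = 1 := by
        push_cast
        linear_combination (-γ 1 0 : ℂ) * hsm + hdc
      have hom : ∀ x y k : ℂ, evC f x y * k ^ 4 = evC f (x * k) (y * k) := fun x y k => by unfold evC; ring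
      rw [hom, q1, q2]
    rw [hroot] at e
    exact (mul_eq_zero.1 e).resolve_right (pow_ne_zero _ hden)
  have hgP := root_PF (f := g) (u := z'.re) (v := z'.im) hpos.ne' hgr
  refine ⟨g, _, _, _, hfg, hgP, ?_, hγ2, ?_⟩
  · rw [DF_iff hgP, eqv_I hfg, eqv_J hfg, ← DF_iff h]; exact hD
  · rw [Complex.normSq_apply] at hγ1; linarith

lemma exists_rep2 {f : BQF} {u v m : ℝ} (hv : 0 < v) (h : PF f u (v ^ 2) m) (hD : 0 < DF f u (v ^ 2) m) :
    ∃ g u w m, f.Equivalent g ∧ PF g u w m ∧ 0 < DF g u w m ∧ 0 ≤ u ∧ u ≤ 1 / 2 ∧ 1 ≤ u ^ 2 + w := by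
  obtain ⟨g, u, w, m, h1, h2, h3, h4, h5⟩ := exists_rep1 hv h hD
  rw [abs_le] at h4
  rcases le_total 0 u with hu | hu
  · exact ⟨g, u, w, m, h1, h2, h3, hu, h4.2, h5⟩
  · have hE : g.Equivalent (act (-1) 0 0 1 g) := equiv_iff.2 ⟨_, _, _, _, by simp, rfl⟩
    have hP : PF (act (-1) 0 0 1 g) (-u) w m := by
      obtain ⟨e1, e2, e3⟩ := h2
      unfold PF act BQF.evalZ; push_cast
      refine ⟨by rw [e1]; ring, by rw [e2]; ring, by rw [e3]; ring⟩
    refine ⟨act (-1) 0 0 1 g, -u, w, m, eqv_equivalence.trans h1 hE, hP, ?_, by linarith, by linarith, by linarith⟩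
    rw [DF_iff hP, eqv_I hE, eqv_J hE, ← DF_iff h2]; exact h3

lemma b_translate {g : BQF} {u w m : ℝ} (h : PF g u w m) (n : ℤ) :
    g.Equivalent (act 1 0 n 1 g) ∧ PF (act 1 0 n 1 g) (u - n) w m ∧ (act 1 0 n 1 g).a = g.a ∧ (act 1 0 n 1 g).b = g.b + 4 * n * g.a ∧
    Dl (act 1 0 n 1 g).a (act 1 0 n 1 g).b (act 1 0 n 1 g).c = Dl g.a g.b g.c := by
  refine ⟨equiv_iff.2 ⟨_, _, _, _, by simp, rfl⟩, ?_, ?_, ?_, ?_⟩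
  · obtain ⟨e1, e2, e3⟩ := h
    unfold PF act BQF.evalZ; push_cast
    refine ⟨by rw [e1]; ring, by rw [e1, e2]; ring, by rw [e1, e2, e3]; ring⟩
  · simp [act, BQF.evalZ]
  · simp [act]; ring
  · simp [act, BQF.evalZ, Dl]; ring

lemma rep_up {f : BQF} {η C L : ℝ} (h : f.Irred) (h2 : f.realRoots.ncard = 2) (hI : |(f.I:ℝ)| < L ^ 2) (hJ : |(f.J:ℝ)| < C * L ^ 2) :
    ∃ g, f.Equivalent g ∧ (toZb g ∈ SU η C L ∨ toZb (bneg g) ∈ SU η C L ∨ toZb g ∈ TL η C L) := by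
  obtain ⟨u, v, m, hv, hP, hD⟩ := two_roots h h2
  obtain ⟨g, u, w, m, hfg, hgP, hgD, hu0, hu1, huw⟩ := exists_rep2 hv hP hD
  by_cases hc : η * L < |(g.a:ℝ)| ∧ η * L ^ 2 < |Dl g.a g.b g.c|
  · refine ⟨g, hfg, ?_⟩
    rcases le_total 0 ((g.b:ℝ) + 4 * u * g.a) with hs | hs
    · left
      refine ⟨u, w, m, hgP, hu0, hu1, huw, hgD, ?_, ?_, hc.1, hc.2, hs⟩
      · simp only [toZb, BQF.Ir_eq]; rwa [eqv_I hfg]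
      · simp only [toZb, BQF.Jr_eq]; rwa [eqv_J hfg]
    · right; left
      refine ⟨u, w, -m, hgP.neg, hu0, hu1, huw, ?_, ?_, ?_, ?_, ?_, ?_⟩
      · have := DF_neg (f := g) (u := u) (w := w) (m := m)
        rw [← this] at hgD; exact hgD
      · simp only [toZb, BQF.Ir_eq]; rwa [I_neg, eqv_I hfg]
      · simp only [toZb, BQF.Jr_eq]; rw [J_neg, eqv_J hfg]; push_cast; rwa [abs_neg]
      · simp only [toZb, bneg]; push_cast; rw [abs_neg]; exact hc.1
      · have : Dl (bneg g).a (bneg g).b (bneg g).c = Dl g.a g.b g.c := by simp only [Dl, bneg]; push_cast; ring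
        simp only [toZb]; rw [this]; exact hc.2
      · simp only [toZb, bneg]; push_cast; linarith
  · have ha : g.a ≠ 0 := by
      obtain ⟨p, q, r, s, hu, rfl⟩ := equiv_iff.1 hfg
      refine irred_no_root h fun hpq => ?_
      rw [hpq.1, hpq.2] at hu; simp at hu
    have haR : (g.a:ℝ) ≠ 0 := by exact_mod_cast ha
    obtain ⟨t1, t2, t3, t4, t5⟩ := b_translate hgP (-round ((g.b:ℝ) / (4 * g.a)))
    set n := round ((g.b:ℝ) / (4 * g.a)) with hn
    set k := act 1 0 (-n) 1 g with hk
    have hfk := eqv_equivalence.trans hfg t1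
    refine ⟨k, hfk, Or.inr (Or.inr ⟨?_, ?_, ⟨_, _, _, t2, ?_, ?_⟩, ?_, ?_, ?_⟩)⟩
    · simp only [toZb]; rw [t3]; exact ha
    · simp only [toZb]; rw [t3, t4]; push_cast
      have h1 := abs_sub_round ((g.b:ℝ) / (4 * g.a))
      have e : (g.b:ℝ) + 4 * -n * g.a = 4 * g.a * ((g.b:ℝ) / (4 * g.a) - n) := by field_simp; ring
      rw [e, abs_mul, abs_mul]
      have : |(4:ℝ)| = 4 := by norm_num
      rw [this]
      nlinarith [abs_nonneg (g.a:ℝ)]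
    · nlinarith
    · have : 0 < DF k (u - (-n : ℤ)) w m := by
        rw [DF_iff t2, eqv_I t1, eqv_J t1, ← DF_iff hgP]; exact hgD
      exact this
    · simp only [toZb, BQF.Ir_eq]; rwa [eqv_I hfk]
    · simp only [toZb, BQF.Jr_eq]; rwa [eqv_J hfk]
    · simp only [toZb]; rw [t5, t3]
      by_cases h1 : η * L < |(g.a:ℝ)|
      · exact Or.inr (not_lt.1 fun h => hc ⟨h1, h⟩)
      · exact Or.inl (not_lt.1 h1)
end

open Filter Topology MeasureTheory
open scoped ENNReal
noncomputable section

lemma fdo_uniq {x1 y1 x2 y2 : ℝ} (h1 : 0 < y1) (h2 : 0 < y2) (a1 : |x1| < 1 / 2) (a2 : |x2| < 1 / 2)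
    (n1 : 1 < x1 ^ 2 + y1 ^ 2) (n2 : 1 < x2 ^ 2 + y2 ^ 2) {p q r s : ℤ} (hu : IsUnit (p * s - q * r))
    (h : (⟨x1, y1⟩ : ℂ) * p + r = ⟨x2, y2⟩ * (⟨x1, y1⟩ * q + s)) : q = 0 ∧ r = 0 ∧ p = s ∧ (p = 1 ∨ p = -1) := by
  have hre := congrArg Complex.re h
  have him := congrArg Complex.im h
  simp at hre him
  have hdet : p * s - q * r = 1 := by
    rcases Int.isUnit_iff.1 hu with h | h
    · exact h
    exfalso
    have hR : (p:ℝ) * s - q * r = -1 := by exact_mod_cast h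
    have e : y2 * ((x1 * q + s) ^ 2 + (y1 * q) ^ 2) = ((p:ℝ) * s - q * r) * y1 := by
      linear_combination (-(x1 * q + s)) * him + (y1 * q) * hre
    rw [hR] at e
    nlinarith [mul_nonneg h2.le (add_nonneg (sq_nonneg (x1 * q + s)) (sq_nonneg (y1 * q)))]
  set z1 : UpperHalfPlane := UpperHalfPlane.mk ⟨x1, y1⟩ h1 with hz1
  set z2 : UpperHalfPlane := UpperHalfPlane.mk ⟨x2, y2⟩ h2 with hz2
  let γ : Matrix.SpecialLinearGroup (Fin 2) ℤ := ⟨!![p, r; q, s], by rw [Matrix.det_fin_two_of]; linarith⟩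
  have hden : ((q : ℤ) : ℂ) * z1 + (s : ℤ) ≠ 0 := by
    intro h0
    have h0' : (⟨x1, y1⟩ : ℂ) * q + s = 0 := by rw [← h0, mul_comm]
    have i1 := congrArg Complex.im h0'
    have i2 := congrArg Complex.re h0'
    simp [h1.ne'] at i1
    simp [i1] at i2
    rw [i1, i2] at hdet; simp at hdet
  have hg : γ • z1 = z2 := by
    apply UpperHalfPlane.ext
    rw [UpperHalfPlane.coe_specialLinearGroup_apply]
    simp only [algebraMap_int_eq, eq_intCast, Complex.ofReal_intCast]
    have : γ 0 0 = p ∧ γ 0 1 = r ∧ γ 1 0 = q ∧ γ 1 1 = s := ⟨rfl, rfl, rfl, rfl⟩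
    rw [this.1, this.2.1, this.2.2.1, this.2.2.2, div_eq_iff hden]
    have hc1 : (z1 : ℂ) = ⟨x1, y1⟩ := rfl
    have hc2 : (z2 : ℂ) = ⟨x2, y2⟩ := rfl
    rw [hc1, hc2]
    linear_combination h
  have m1 : z1 ∈ ModularGroup.fdo := ⟨by rw [Complex.normSq_apply]; show 1 < x1 * x1 + y1 * y1; linarith, a1⟩
  have m2 : γ • z1 ∈ ModularGroup.fdo := by
    rw [hg]; exact ⟨by rw [Complex.normSq_apply]; show 1 < x2 * x2 + y2 * y2; linarith, a2⟩
  rcases ModularGroup.eq_one_or_neg_one_of_mem_fdo_mem_fdo m1 m2 with h | h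
  · have e := fun i j => congrArg (fun g : Matrix.SpecialLinearGroup (Fin 2) ℤ => g i j) h
    have e00 := e 0 0
    have e01 := e 0 1
    have e10 := e 1 0
    have e11 := e 1 1
    simp [γ] at e00 e01 e10 e11
    exact ⟨e10, e01, by rw [e00, e11], Or.inl e00⟩
  · have e := fun i j => congrArg (fun g : Matrix.SpecialLinearGroup (Fin 2) ℤ => g i j) h
    have e00 := e 0 0
    have e01 := e 0 1
    have e10 := e 1 0
    have e11 := e 1 1
    simp [γ] at e00 e01 e10 e11
    exact ⟨e10, e01, by rw [e00, e11], Or.inr e00⟩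

def GD (f : BQF) : Prop := f.a ≠ 0 ∧ ∃ u w m, PF f u w m ∧ 0 < DF f u w m ∧ 0 < u ∧ u < 1 / 2 ∧ 1 < u ^ 2 + w

lemma quad_split {f : BQF} {u w m : ℝ} (hw : 0 < w) (ha : f.a ≠ 0) (hD : 0 < DF f u w m) :
    ∃ r1 r2 : ℝ, r1 ≠ r2 ∧ (f.b : ℝ) + 2 * u * f.a = - f.a * (r1 + r2) ∧ m - f.a * (u ^ 2 + w) - u * (f.b + 2 * u * f.a) = f.a * r1 * r2 := by
  have haR : (f.a:ℝ) ≠ 0 := by exact_mod_cast ha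
  unfold DF Dv at hD
  generalize (f.a : ℝ) = a at *
  generalize (f.b : ℝ) = b at *
  set E := (b + 4 * u * a) ^ 2 - 4 * a * m + 4 * w * a ^ 2 with hE
  have hE0 : 0 < E := by
    by_contra h
    nlinarith
  have hs := Real.sq_sqrt hE0.le
  have hs0 := Real.sqrt_pos.2 hE0
  set y := √E
  refine ⟨(-(b + 2 * u * a) + y) / (2 * a), (-(b + 2 * u * a) - y) / (2 * a), ?_, ?_, ?_⟩
  · intro h
    rw [div_left_inj' (by positivity)] at h
    linarith
  · field_simp; ring
  · field_simp
    rw [hE] at hs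
    linear_combination hs

lemma GD_uniq {f g : BQF} (hf : GD f) (hg : GD g) (h : f.Equivalent g) : f = g := by
  obtain ⟨ha, u, w, m, hP, hD, hu0, hu1, hw⟩ := hf
  obtain ⟨-, u', w', m', hP', -, hu0', hu1', hw'⟩ := hg
  obtain ⟨p, q, r, s, hdet, rfl⟩ := equiv_iff.1 h
  have hw0 : 0 < w := by nlinarith
  have hw0' : 0 < w' := by nlinarith
  obtain ⟨v, hv, rfl⟩ : ∃ v, 0 < v ∧ v ^ 2 = w := ⟨√w, Real.sqrt_pos.2 hw0, Real.sq_sqrt hw0.le⟩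
  obtain ⟨v', hv', rfl⟩ : ∃ v, 0 < v ∧ v ^ 2 = w' := ⟨√w', Real.sqrt_pos.2 hw0', Real.sq_sqrt hw0'.le⟩
  have hr := hP'.root
  have hdR : (p:ℝ) * s - q * r ≠ 0 := by
    have := hdet.ne_zero; exact_mod_cast this
  rw [act_evC, hP.fact] at hr
  simp only [one_mul] at hr
  rcases mul_eq_zero.1 hr with hr | hr
  · have e : (((⟨u', v'⟩ : ℂ) * p + r) - ⟨u, v⟩ * (⟨u', v'⟩ * q + s)) * (((⟨u', v'⟩ : ℂ) * p + r) - ⟨u, -v⟩ * (⟨u', v'⟩ * q + s)) = 0 := by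
      have e1 : (⟨u, v⟩ : ℂ) = u + v * Complex.I := by apply Complex.ext <;> simp
      have e2 : (⟨u, -v⟩ : ℂ) = u - v * Complex.I := by apply Complex.ext <;> simp
      rw [e1, e2, ← hr]; push_cast
      linear_combination (- (v:ℂ) ^ 2 * ((⟨u', v'⟩ : ℂ) * q + s) ^ 2) * Complex.I_sq
    rcases mul_eq_zero.1 e with e | e
    · obtain ⟨rfl, rfl, rfl, h1⟩ := fdo_uniq hv' hv (by rw [abs_of_pos hu0']; exact hu1') (by rw [abs_of_pos hu0]; exact hu1) hw' hw hdet (sub_eq_zero.1 e)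
      rcases h1 with rfl | rfl <;> ext <;> simp [act, BQF.evalZ]
    · exfalso
      have e' : (⟨u', v'⟩ : ℂ) * (-p : ℤ) + (-r : ℤ) = ⟨-u, v⟩ * (⟨u', v'⟩ * q + s) := by
        have e2 : (⟨-u, v⟩ : ℂ) = - ⟨u, -v⟩ := by apply Complex.ext <;> simp
        rw [e2]; push_cast; linear_combination -e
      obtain ⟨rfl, hr0, hps, h1⟩ := fdo_uniq hv' hv (by rw [abs_of_pos hu0']; exact hu1') (by rw [abs_neg, abs_of_pos hu0]; exact hu1) hw' (by rw [neg_sq]; exact hw) (by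
        have := hdet.neg
        rw [show -p * s - q * -r = -(p * s - q * r) by ring]; exact this) e'
      have hre := congrArg Complex.re e'
      simp [hr0, ← hps] at hre
      have hp0 : (p:ℝ) ≠ 0 := by
        rintro h0
        have : p = 0 := by exact_mod_cast h0
        rw [this] at h1; simp at h1
      have h3 : (p:ℝ) * (u + u') = 0 := by linear_combination -hre
      rcases mul_eq_zero.1 h3 with h3 | h3
      · exact hp0 h3
      · linarith
  · exfalso
    obtain ⟨r1, r2, -, k1, k2⟩ := quad_split hw0 ha hD
    have k1 := congrArg (fun x : ℝ => (x : ℂ)) k1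
    have k2 := congrArg (fun x : ℝ => (x : ℂ)) k2
    push_cast at k1 k2 hr
    have haC : (f.a:ℂ) ≠ 0 := by exact_mod_cast ha
    set Z := (⟨u', v'⟩ : ℂ) with hZ
    have e : (f.a:ℂ) * ((Z * p + r - r1 * (Z * q + s)) * (Z * p + r - r2 * (Z * q + s))) = 0 := by
      rw [k2] at hr
      linear_combination hr - (Z * p + r) * (Z * q + s) * k1
    have key : ∀ ρ : ℝ, Z * p + r - ρ * (Z * q + s) ≠ 0 := by
      intro ρ h0
      have i1 := congrArg Complex.im h0
      have i2 := congrArg Complex.re h0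
      simp [hZ] at i1 i2
      have i3 : (p:ℝ) = ρ * q := by
        have : v' * (p - ρ * q) = 0 := by linear_combination i1
        have := (mul_eq_zero.1 this).resolve_left hv'.ne'
        linarith
      apply hdR
      rw [i3] at i2 ⊢
      linear_combination (-(q:ℝ)) * i2
    rcases mul_eq_zero.1 ((mul_eq_zero.1 e).resolve_left haC) with h | h
    · exact key _ h
    · exact key _ h

lemma GD_ncard {f : BQF} (hf : GD f) : f.realRoots.ncard = 2 := by
  obtain ⟨ha, u, w, m, hP, hD, hu0, hu1, hw⟩ := hf
  have hw0 : 0 < w := by nlinarith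
  obtain ⟨r1, r2, h12, k1, k2⟩ := quad_split hw0 ha hD
  have haR : (f.a:ℝ) ≠ 0 := by exact_mod_cast ha
  have : f.realRoots = {r1, r2} := by
    ext x
    have e : f.evalR x 1 = ((x - u) ^ 2 + w) * (f.a * ((x - r1) * (x - r2))) := by
      obtain ⟨h1, h2, h3⟩ := hP
      unfold BQF.evalR; rw [h1, h2, h3, k2]
      rw [show m = f.a * r1 * r2 + f.a * (u ^ 2 + w) + u * (f.b + 2 * u * f.a) by linarith, show (f.b:ℝ) = -f.a * (r1 + r2) - 2 * u * f.a by linarith]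
      ring
    have h0 : (x - u) ^ 2 + w ≠ 0 := by positivity
    have : x ∈ f.realRoots ↔ f.evalR x 1 = 0 := Iff.rfl
    rw [this, e]
    simp [h0, haR, sub_eq_zero]
  rw [this, Set.ncard_pair h12]

lemma SL_GD {η C L : ℝ} (hη : 0 < η) (hL : 0 < L) {f : BQF} (h : toZb f ∈ SL η C L) : GD f := by
  obtain ⟨u, w, m, hP, hu0, hu1, hw, hD, hI, hJ, ha, -, -⟩ := h
  refine ⟨?_, u, w, m, hP, hD, hu0, hu1, hw⟩
  rintro h0
  simp [toZb, h0] at ha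
  nlinarith [mul_pos hη hL]

lemma GD_neg {f : BQF} (h : GD f) : GD (bneg f) := by
  obtain ⟨ha, u, w, m, hP, hD, h⟩ := h
  exact ⟨by simpa [bneg] using ha, u, w, -m, hP.neg, by rw [DF_neg]; exact hD, h⟩

lemma PF.uniq {f : BQF} (ha : f.a ≠ 0) {u v m u' v' m' : ℝ} (hv : 0 < v) (hv' : 0 < v') (hP : PF f u (v ^ 2) m) (hD : 0 < DF f u (v ^ 2) m) (hP' : PF f u' (v' ^ 2) m') : u = u' := by
  have hr := hP'.root
  have hw0 : 0 < v ^ 2 := by positivity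
  obtain ⟨r1, r2, -, k1, k2⟩ := quad_split hw0 ha hD
  have k1 := congrArg (fun x : ℝ => (x : ℂ)) k1
  have k2 := congrArg (fun x : ℝ => (x : ℂ)) k2
  rw [hP.fact] at hr
  push_cast at k1 k2 hr
  have haC : (f.a:ℂ) ≠ 0 := by exact_mod_cast ha
  set Z := (⟨u', v'⟩ : ℂ) with hZ
  have e : ((Z - u) ^ 2 + v ^ 2) * ((f.a:ℂ) * ((Z - r1) * (Z - r2))) = 0 := by
    rw [k2] at hr
    linear_combination hr - ((Z - u) ^ 2 + v ^ 2) * Z * k1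
  have key : ∀ ρ : ℝ, Z - ρ ≠ 0 := by
    intro ρ h0
    have i1 := congrArg Complex.im h0
    simp [hZ] at i1
    exact hv'.ne' i1
  have e2 := (mul_eq_zero.1 e).resolve_right (mul_ne_zero haC (mul_ne_zero (key _) (key _)))
  have i1 := congrArg Complex.im e2
  simp [hZ, pow_two] at i1
  have : v' * (u' - u) = 0 := by linear_combination i1 / 2
  have := (mul_eq_zero.1 this).resolve_left hv'.ne'
  linarith
end

open Filter Topology MeasureTheory
open scoped ENNReal
noncomputable section

def Lin (f : BQF) (p q A B G E : ℤ) : Prop := f.a = p * A ∧ f.b = p * B + q * A ∧ f.c = p * G + q * B ∧ f.d = p * E + q * G ∧ f.e = q * E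
def Quad (f : BQF) (p q r p' q' r' : ℤ) : Prop := f.a = p * p' ∧ f.b = p * q' + q * p' ∧ f.c = p * r' + q * q' + r * p' ∧
  f.d = q * r' + r * q' ∧ f.e = r * r'

section
open Polynomial

def zpoly (f : BQF) : ℤ[X] := C f.a * X ^ 4 + C f.b * X ^ 3 + C f.c * X ^ 2 + C f.d * X + C f.e

lemma zpoly_map (f : BQF) : (zpoly f).map (Int.castRingHom ℚ) = qpoly f := by
  simp [zpoly, qpoly]

lemma zpoly_coeffs {f : BQF} {a b c d e : ℤ} (h : zpoly f = C a * X ^ 4 + C b * X ^ 3 + C c * X ^ 2 + C d * X + C e) :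
    f.a = a ∧ f.b = b ∧ f.c = c ∧ f.d = d ∧ f.e = e := by
  have h := fun n => congrArg (fun p => coeff p n) h
  have h0 := h 0
  have h1 := h 1
  have h2 := h 2
  have h3 := h 3
  have h4 := h 4
  simp only [zpoly, coeff_add, coeff_C_mul, coeff_X_pow, coeff_X, coeff_C] at h0 h1 h2 h3 h4
  norm_num at h0 h1 h2 h3 h4
  exact ⟨h4, h3, h2, h1, h0⟩

lemma red_cases {f : BQF} (ha : f.a ≠ 0) (h : ¬ f.Irred) : (∃ p q A B G E, Lin f p q A B G E) ∨ (∃ p q r p' q' r', Quad f p q r p' q' r') := by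
  have h1 : ¬ Irreducible (qpoly f) := fun hi => h ⟨ha, hi⟩
  have hdeg : (zpoly f).natDegree = 4 := by
    unfold zpoly; compute_degree!
  have h0 : zpoly f ≠ 0 := by
    intro h0; rw [h0] at hdeg; simp at hdeg
  have hcont : (zpoly f).content ≠ 0 := by simpa [content_eq_zero_iff] using h0
  set P := (zpoly f).primPart with hP
  have hPp : P.IsPrimitive := isPrimitive_primPart _
  have hfac : zpoly f = C (zpoly f).content * P := eq_C_content_mul_primPart _
  have hP1 : ¬ Irreducible P := by
    rw [IsPrimitive.Int.irreducible_iff_irreducible_map_cast hPp]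
    intro hi
    apply h1
    rw [← zpoly_map, hfac, Polynomial.map_mul, map_C]
    have : IsUnit (C ((Int.castRingHom ℚ) (zpoly f).content)) := by
      rw [isUnit_C, isUnit_iff_ne_zero]; simpa using hcont
    exact (associated_unit_mul_left _ _ this).irreducible_iff.2 hi
  have hPdeg : P.natDegree = 4 := by rw [hP, natDegree_primPart, hdeg]
  have hPu : ¬ IsUnit P := by
    intro hu
    have := natDegree_eq_zero_of_isUnit hu
    omega
  rw [irreducible_iff] at hP1
  push Not at hP1
  obtain ⟨G, H, hGH, hG, hH⟩ := hP1 hPu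
  have hdg : ∀ G : ℤ[X], G ∣ P → ¬ IsUnit G → 1 ≤ G.natDegree := by
    intro G hd hu
    by_contra hc
    have : G.natDegree = 0 := by omega
    rw [natDegree_eq_zero] at this
    obtain ⟨n, rfl⟩ := this
    exact hu (isUnit_C.2 (hPp n hd))
  have hG1 := hdg G ⟨H, hGH⟩ hG
  have hH1 := hdg H ⟨G, by rw [hGH, mul_comm]⟩ hH
  have hP0 : P ≠ 0 := hPp.ne_zero
  have hG0 : G ≠ 0 := fun h => hP0 (by rw [hGH, h, zero_mul])
  have hH0 : H ≠ 0 := fun h => hP0 (by rw [hGH, h, mul_zero])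
  have hsum : G.natDegree + H.natDegree = 4 := by rw [← natDegree_mul hG0 hH0, ← hGH, hPdeg]
  have key1 : ∀ G H : ℤ[X], P = G * H → G.natDegree = 1 → H.natDegree = 3 → (∃ p q A B G E, Lin f p q A B G E) := by
    intro G H hGH d1 d2
    rw [hGH, G.as_sum_range_C_mul_X_pow' (n := 2) (by omega), H.as_sum_range_C_mul_X_pow' (n := 4) (by omega)] at hfac
    simp only [Finset.sum_range_succ, Finset.sum_range_zero] at hfac
    set k := (zpoly f).content
    refine ⟨G.coeff 1, G.coeff 0, k * H.coeff 3, k * H.coeff 2, k * H.coeff 1, k * H.coeff 0, zpoly_coeffs ?_⟩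
    rw [hfac]; simp only [C_mul, C_add]; ring
  have key2 : G.natDegree = 2 → H.natDegree = 2 → (∃ p q r p' q' r', Quad f p q r p' q' r') := by
    intro d1 d2
    rw [hGH, G.as_sum_range_C_mul_X_pow' (n := 3) (by omega), H.as_sum_range_C_mul_X_pow' (n := 3) (by omega)] at hfac
    simp only [Finset.sum_range_succ, Finset.sum_range_zero] at hfac
    set k := (zpoly f).content
    refine ⟨G.coeff 2, G.coeff 1, G.coeff 0, k * H.coeff 2, k * H.coeff 1, k * H.coeff 0, zpoly_coeffs ?_⟩
    rw [hfac]; simp only [C_mul, C_add]; ring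
  rcases (by omega : (G.natDegree = 1 ∧ H.natDegree = 3) ∨ (G.natDegree = 2 ∧ H.natDegree = 2) ∨ (H.natDegree = 1 ∧ G.natDegree = 3)) with h | h | h
  · exact Or.inl (key1 G H hGH h.1 h.2)
  · exact Or.inr (key2 h.1 h.2)
  · exact Or.inl (key1 H G (by rw [hGH, mul_comm]) h.1 h.2)
end

/-- coefficient bounds -/
def CB (K η L : ℝ) (f : BQF) : Prop := η * L < |(f.a:ℝ)| ∧ |(f.a:ℝ)| ≤ K * L ∧ |(f.b:ℝ)| ≤ K * L ∧ |(f.c:ℝ)| ≤ K * L ∧ |(f.d:ℝ)| ≤ K * L ∧ |(f.e:ℝ)| ≤ K * L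

lemma SL_CB {η C : ℝ} (hη : 0 < η) (hC : 0 < C) : ∃ K ≥ 1, ∀ L, L0 η C ≤ L → ∀ f, toZb f ∈ SL η C L → CB K η L f := by
  obtain ⟨κ, hκ⟩ : ∃ κ, κ = 1 / 4 + 1 / η := ⟨_, rfl⟩
  have hη1 : 0 < 1 / η := by positivity
  have hκ0 : 0 < κ := by linarith
  refine ⟨9 + (2 / η + 5) + κ * (1 + κ + 5), by nlinarith [show 0 < 2 / η by positivity], fun L hL f hf => ?_⟩
  obtain ⟨u, w, m, hP, h1, h2, h3, h4, h5, h6, h7, h8, h9⟩ := hf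
  obtain ⟨k0, k1, k2, -, k5, k6, k7, k8, -⟩ := main_bounds hη hC hL hP h1.le h2.le h3.le h4 h5 h6 h7
  have hL1 := L0_ge hη hC hL
  simp only [toZb] at *
  have q1 : 0 < 2 / η := by positivity
  have q2 : 0 < κ * (1 + κ + 5) := by positivity
  have q3 : 0 < 2 / η * L := by positivity
  have q4 : 0 < κ * (1 + κ + 5) * L := by positivity
  refine ⟨h7, by linarith, by linarith, by linarith, by linarith, ?_⟩
  have hmL : |m| ≤ L := by
    refine k0.trans (le_trans ?_ hL); unfold L0
    have : 0 < 10 * C / η ^ 3 := by positivity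
    linarith
  have hw : |u ^ 2 + w| ≤ κ := by
    rw [abs_of_pos (by linarith)]; nlinarith only [h1, h2, k2, hκ]
  have ha0 := abs_nonneg (f.a:ℝ)
  rw [hP.2.2, abs_mul]
  have t1 : |(f.a:ℝ) * (u ^ 2 + w)| ≤ L * κ := by rw [abs_mul]; gcongr
  have t2 : |u * ((f.b:ℝ) + 2 * u * f.a)| ≤ 5 * L := by
    rw [abs_mul, abs_of_pos h1]
    have : |(f.b:ℝ) + 2 * u * f.a| ≤ 5 * L := by
      refine (abs_add_le _ _).trans ?_
      rw [abs_mul, abs_of_pos (by linarith : 0 < 2 * u)]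
      nlinarith
    nlinarith [abs_nonneg ((f.b:ℝ) + 2 * u * f.a)]
  have t3 : |m - f.a * (u ^ 2 + w) - u * (f.b + 2 * u * f.a)| ≤ L + L * κ + 5 * L :=
    (abs_sub _ _).trans (add_le_add ((abs_sub _ _).trans (add_le_add hmL t1)) t2)
  have t4 : |u ^ 2 + w| * |m - f.a * (u ^ 2 + w) - u * (f.b + 2 * u * f.a)| ≤ κ * (L + L * κ + 5 * L) := by gcongr
  linarith

lemma root_bd {K η L : ℝ} (hK : 1 ≤ K) (hη : 0 < η) (hL : 0 < L) {f : BQF} (h : CB K η L f) {z : ℂ} (hz : evC f z 1 = 0) : ‖z‖ ≤ 1 + 4 * K / η := by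
  obtain ⟨h1, h2, h3, h4, h5, h6⟩ := h
  have h0 : 0 < 4 * K / η := by positivity
  by_contra hc
  push Not at hc
  have hz1 : 1 ≤ ‖z‖ := by linarith
  have hz2 : 4 * K / η < ‖z‖ := by linarith
  rw [div_lt_iff₀ hη] at hz2
  have e : (f.a:ℂ) * z ^ 4 = -((f.b:ℂ) * z ^ 3 + f.c * z ^ 2 + f.d * z + f.e) := by
    unfold evC at hz; linear_combination hz
  have hn : ∀ n : ℤ, ‖(n:ℂ)‖ = |(n:ℝ)| := fun n => by simp
  have e2 : |(f.a:ℝ)| * ‖z‖ ^ 4 ≤ 4 * (K * L * ‖z‖ ^ 3) := by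
    have h7 := congrArg norm e
    rw [norm_neg, norm_mul, norm_pow, hn] at h7
    rw [h7]
    have m1 : ‖(f.b:ℂ) * z ^ 3‖ ≤ K * L * ‖z‖ ^ 3 := by rw [norm_mul, norm_pow, hn]; gcongr
    have m2 : ‖(f.c:ℂ) * z ^ 2‖ ≤ K * L * ‖z‖ ^ 3 := by
      rw [norm_mul, norm_pow, hn]; gcongr; norm_num
    have m3 : ‖(f.d:ℂ) * z‖ ≤ K * L * ‖z‖ ^ 3 := by
      rw [norm_mul, hn]; gcongr; exact le_self_pow₀ hz1 (by norm_num)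
    have m4 : ‖(f.e:ℂ)‖ ≤ K * L * ‖z‖ ^ 3 := by
      rw [hn]; refine h6.trans (le_mul_of_one_le_right (by positivity) (one_le_pow₀ hz1))
    have := norm_add_le ((f.b:ℂ) * z ^ 3 + f.c * z ^ 2 + f.d * z) f.e
    have := norm_add_le ((f.b:ℂ) * z ^ 3 + f.c * z ^ 2) (f.d * z)
    have := norm_add_le ((f.b:ℂ) * z ^ 3) (f.c * z ^ 2)
    linarith
  have e3 : |(f.a:ℝ)| * ‖z‖ ≤ 4 * (K * L) := by
    have : 0 < ‖z‖ ^ 3 := by positivity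
    refine le_of_mul_le_mul_right ?_ this
    linarith [e2, show |(f.a:ℝ)| * ‖z‖ ^ 4 = |(f.a:ℝ)| * ‖z‖ * ‖z‖ ^ 3 by ring]
  have e4 : η * L * ‖z‖ ≤ |(f.a:ℝ)| * ‖z‖ := by gcongr
  nlinarith
end

open Filter Topology MeasureTheory
open scoped ENNReal
noncomputable section

lemma box {M : ℝ} (hM : 1 ≤ M) : ({n : ℤ | |(n:ℝ)| ≤ M}.encard : ℝ≥0∞) ≤ ENNReal.ofReal (3 * M) := by
  refine (encard_int (D := 2 * M) (by linarith) fun x hx y hy => ?_).trans (ENNReal.ofReal_le_ofReal (by linarith))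
  have hx : |(x:ℝ)| ≤ M := hx
  have hy : |(y:ℝ)| ≤ M := hy
  have := abs_sub (x:ℝ) y
  linarith

lemma enc_prod {α β : Type*} {S : Set α} {T : Set β} {P Q : ℝ} (hP : 0 ≤ P) (h1 : (S.encard : ℝ≥0∞) ≤ ENNReal.ofReal P) (h2 : (T.encard : ℝ≥0∞) ≤ ENNReal.ofReal Q) :
    ((S ×ˢ T).encard : ℝ≥0∞) ≤ ENNReal.ofReal (P * Q) := by
  rw [ENNReal.ofReal_mul hP]
  refine encard_prod_le ((enc_mono ?_).trans h1) fun a => (enc_mono ?_).trans h2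
  · rintro a ⟨b, hb⟩; exact hb.1
  · rintro b hb; exact hb.2

lemma fib_sum {β : Type*} {S : Set (ℤ × β)} {F N : ℝ} (hF : 0 ≤ F) (hN : 0 ≤ N) (h0 : ∀ p y, (p, y) ∈ S → p ≠ 0 ∧ |(p:ℝ)| ≤ N)
    (h : ∀ p : ℤ, p ≠ 0 → |(p:ℝ)| ≤ N → ({y | (p, y) ∈ S}.encard : ℝ≥0∞) ≤ ENNReal.ofReal (F / |(p:ℝ)|)) :
    (S.encard : ℝ≥0∞) ≤ ENNReal.ofReal (F * (1 + 8 * r4 N)) := by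
  classical
  rw [encard_fib]
  have hb : ∀ p : ℤ, ({y | (p, y) ∈ S}.encard : ℝ≥0∞) ≤ ENNReal.ofReal F * (if p ≠ 0 ∧ |(p:ℝ)| ≤ N then ENNReal.ofReal (1 / r4 (mj p) ^ 3) else 0) := by
    intro p
    by_cases hp : p ≠ 0 ∧ |(p:ℝ)| ≤ N
    · rw [if_pos hp, ← ENNReal.ofReal_mul hF]
      refine (h p hp.1 hp.2).trans (ENNReal.ofReal_le_ofReal ?_)
      have h1 : (1:ℝ) ≤ |(p:ℝ)| := by exact_mod_cast Int.one_le_abs hp.1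
      have hm : mj p = |(p:ℝ)| := by unfold mj; exact max_eq_right h1
      rw [hm, mul_one_div]
      have hr := one_le_r4 h1
      have h4 := r4_pow (abs_nonneg (p:ℝ))
      gcongr
      nth_rewrite 2 [← h4]
      exact pow_le_pow_right₀ hr (by norm_num)
    · rw [if_neg hp, mul_zero]
      have : {y | (p, y) ∈ S} = ∅ := Set.eq_empty_of_forall_notMem fun y hy => hp (h0 p y hy)
      simp [this]
  refine (ENNReal.tsum_le_tsum hb).trans ?_
  rw [ENNReal.tsum_mul_left, ENNReal.ofReal_mul hF]
  refine mul_le_mul_right (S34 hN _ (fun j => by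
      split_ifs
      · exact le_rfl
      · exact zero_le) (fun j hj => if_neg fun h => not_le.2 hj h.2)) _

lemma quad_bd {p q r : ℤ} (hp : p ≠ 0) {R : ℝ} (hR : 0 ≤ R) (h : ∀ z : ℂ, p * z ^ 2 + q * z + r = 0 → ‖z‖ ≤ R) : |(q:ℝ)| ≤ 2 * R * |(p:ℝ)| ∧ |(r:ℝ)| ≤ R ^ 2 * |(p:ℝ)| := by
  have hpC : (p:ℂ) ≠ 0 := by exact_mod_cast hp
  obtain ⟨s, hs⟩ := IsAlgClosed.exists_pow_nat_eq ((q:ℂ) ^ 2 - 4 * p * r) (n := 2) (by norm_num)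
  set z1 : ℂ := (-q + s) / (2 * p) with hz1
  set z2 : ℂ := (-q - s) / (2 * p) with hz2
  have r1 := h z1 (by rw [hz1]; field_simp; linear_combination hs)
  have r2 := h z2 (by rw [hz2]; field_simp; linear_combination hs)
  have e1 : (q:ℂ) = -(p * (z1 + z2)) := by rw [hz1, hz2]; field_simp; ring
  have e2 : (r:ℂ) = p * (z1 * z2) := by rw [hz1, hz2]; field_simp; linear_combination hs
  have hn : ∀ n : ℤ, ‖(n:ℂ)‖ = |(n:ℝ)| := fun n => by simp
  have f1 := congrArg norm e1
  have f2 := congrArg norm e2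
  rw [norm_neg, norm_mul, hn, hn] at f1
  rw [norm_mul, norm_mul, hn, hn] at f2
  have h1 := norm_add_le z1 z2
  have hp0 := abs_nonneg (p:ℝ)
  rw [f1, f2]
  constructor
  · nlinarith
  · have : ‖z1‖ * ‖z2‖ ≤ R * R := by gcongr
    nlinarith

def mkL (x : ℤ × ((ℤ × ℤ × ℤ × ℤ) × ℤ)) : BQF :=
  ⟨x.1 * x.2.1.2.1, x.1 * x.2.1.2.2.1 + x.2.1.1 * x.2.1.2.1, x.1 * x.2.1.2.2.2 + x.2.1.1 * x.2.1.2.2.1, x.1 * x.2.2 + x.2.1.1 * x.2.1.2.2.2, x.2.1.1 * x.2.2⟩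
def mkQ (x : ℤ × ((ℤ × ℤ) × (ℤ × ℤ × ℤ))) : BQF :=
  ⟨x.1 * x.2.2.1, x.1 * x.2.2.2.1 + x.2.1.1 * x.2.2.1, x.1 * x.2.2.2.2 + x.2.1.1 * x.2.2.2.1 + x.2.1.2 * x.2.2.1,
    x.2.1.1 * x.2.2.2.2 + x.2.1.2 * x.2.2.2.1, x.2.1.2 * x.2.2.2.2⟩

abbrev bx (M : ℝ) : Set ℤ := {n : ℤ | |(n:ℝ)| ≤ M}

def WQ (M N : ℝ) : Set (ℤ × ((ℤ × ℤ) × (ℤ × ℤ × ℤ))) := {x | x.1 ≠ 0 ∧ |(x.1:ℝ)| ≤ N ∧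
  x.2 ∈ (bx (M * |(x.1:ℝ)|) ×ˢ bx (M * |(x.1:ℝ)|)) ×ˢ (bx (M * N / |(x.1:ℝ)|) ×ˢ bx (M * N / |(x.1:ℝ)|) ×ˢ bx (M * N / |(x.1:ℝ)|))}

lemma WQ_count {M N : ℝ} (hM : 1 ≤ M) (hN : 0 ≤ N) : ((WQ M N).encard : ℝ≥0∞) ≤ ENNReal.ofReal (243 * M ^ 5 * N ^ 3 * (1 + 8 * r4 N)) := by
  refine fib_sum (by positivity) hN (fun p y h => ⟨h.1, h.2.1⟩) fun p hp hpN => ?_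
  have h1 : (1:ℝ) ≤ |(p:ℝ)| := by exact_mod_cast Int.one_le_abs hp
  have b1 : 1 ≤ M * |(p:ℝ)| := by nlinarith
  have b2 : 1 ≤ M * N / |(p:ℝ)| := by
    rw [le_div_iff₀ (by linarith)]; nlinarith
  refine (enc_mono (T := (bx (M * |(p:ℝ)|) ×ˢ bx (M * |(p:ℝ)|)) ×ˢ (bx (M * N / |(p:ℝ)|) ×ˢ bx (M * N / |(p:ℝ)|) ×ˢ bx (M * N / |(p:ℝ)|))) fun y hy => hy.2.2).trans ?_
  refine (enc_prod (by positivity) (enc_prod (by positivity) (box b1) (box b1)) (enc_prod (by positivity) (box b2) (enc_prod (by positivity) (box b2) (box b2)))).trans (ENNReal.ofReal_le_ofReal (le_of_eq ?_))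
  field_simp; ring

def WL (η C M N L : ℝ) : Set (ℤ × ((ℤ × ℤ × ℤ × ℤ) × ℤ)) := {x | x.1 ≠ 0 ∧ |(x.1:ℝ)| ≤ N ∧
  x.2.1 ∈ bx (M * |(x.1:ℝ)|) ×ˢ bx (M * N / |(x.1:ℝ)|) ×ˢ bx (M * N / |(x.1:ℝ)|) ×ˢ bx (M * N / |(x.1:ℝ)|) ∧
  |((mkL x).J : ℝ)| < C * L ^ 2 ∧ η * L < |((mkL x).a : ℝ)|}

lemma WL_count {η C M N t : ℝ} (hη : 0 < η) (hC : 0 < C) (hM : 1 ≤ M) (hN : 0 ≤ N) (ht : 1 ≤ t) :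
    ((WL η C M N (t ^ 4)).encard : ℝ≥0∞) ≤ ENNReal.ofReal (81 * M ^ 4 * N ^ 3 * (2 * (2 + C / η) * t ^ 2) * (1 + 8 * r4 N)) := by
  have hCη : 0 < C / η := by positivity
  refine fib_sum (by positivity) hN (fun p y h => ⟨h.1, h.2.1⟩) fun p hp hpN => ?_
  have h1 : (1:ℝ) ≤ |(p:ℝ)| := by exact_mod_cast Int.one_le_abs hp
  have b1 : 1 ≤ M * |(p:ℝ)| := by nlinarith
  have b2 : 1 ≤ M * N / |(p:ℝ)| := by
    rw [le_div_iff₀ (by linarith)]; nlinarith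
  have hfin : 3 * (M * |(p:ℝ)|) * (3 * (M * N / |(p:ℝ)|) * (3 * (M * N / |(p:ℝ)|) * (3 * (M * N / |(p:ℝ)|)))) * (2 * (2 + C / η) * t ^ 2)
      ≤ 81 * M ^ 4 * N ^ 3 * (2 * (2 + C / η) * t ^ 2) / |(p:ℝ)| := by
    have : 3 * (M * |(p:ℝ)|) * (3 * (M * N / |(p:ℝ)|) * (3 * (M * N / |(p:ℝ)|) * (3 * (M * N / |(p:ℝ)|)))) = 81 * M ^ 4 * N ^ 3 / |(p:ℝ)| / |(p:ℝ)| := by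
      field_simp; ring
    rw [this]
    have h2 : 81 * M ^ 4 * N ^ 3 / |(p:ℝ)| / |(p:ℝ)| ≤ 81 * M ^ 4 * N ^ 3 / |(p:ℝ)| := div_le_self (by positivity) h1
    calc _ ≤ 81 * M ^ 4 * N ^ 3 / |(p:ℝ)| * (2 * (2 + C / η) * t ^ 2) := by gcongr
      _ = _ := by ring
  refine le_trans ?_ (ENNReal.ofReal_le_ofReal hfin)
  rw [ENNReal.ofReal_mul (by positivity)]
  refine encard_prod_le ((enc_mono (T := bx (M * |(p:ℝ)|) ×ˢ bx (M * N / |(p:ℝ)|) ×ˢ bx (M * N / |(p:ℝ)|) ×ˢ bx (M * N / |(p:ℝ)|)) ?_).trans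
    (enc_prod (by positivity) (box b1) (enc_prod (by positivity) (box b2) (enc_prod (by positivity) (box b2) (box b2))))) ?_
  · rintro a ⟨b, hb⟩; exact hb.2.2.1
  rintro ⟨q, A, B, G⟩
  by_cases ha : η * t ^ 4 < |((p * A : ℤ) : ℝ)|
  swap
  · have : {b | b ∈ ({y | (p, y) ∈ WL η C M N (t ^ 4)} : Set ((ℤ × ℤ × ℤ × ℤ) × ℤ)).preimage (fun b => ((q, A, B, G), b))} = ∅ :=
      Set.eq_empty_of_forall_notMem fun y hy => ha hy.2.2.2.2
    have h' : {b | ((q, A, B, G), b) ∈ {y | (p, y) ∈ WL η C M N (t ^ 4)}} = ∅ := this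
    rw [h']; simp
  have hpR : (p:ℝ) ≠ 0 := by exact_mod_cast hp
  have haR : ((p * A : ℤ) : ℝ) ≠ 0 := by
    intro h0; rw [h0, abs_zero] at ha
    have : 0 < η * t ^ 4 := by positivity
    linarith
  set a : ℤ := p * A with had
  set b : ℤ := p * B + q * A with hbd
  set c : ℤ := p * G + q * B with hcd
  set β : ℝ := 72 * a * c * q + 9 * b * c * p - 54 * a * p * q * G - 27 * q * b ^ 2 with hβ
  set γ : ℝ := 9 * b * c * q * G - 27 * a * (q * G) ^ 2 - 2 * c ^ 3 with hγ
  set k : ℝ := -β / (54 * a * p ^ 2) with hk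
  set A0 : ℝ := γ / (27 * a * p ^ 2) + k ^ 2 with hA0
  set ρ : ℝ := C / (27 * η) * t ^ 4 with hρ
  have hs := encard_sq (v := 1) (k := k) (A := A0) (ρ := ρ) (D := (1 + C / η) * t ^ 2) one_pos (by positivity) (by positivity) (Or.inl (by
    rw [hρ]
    have e1 : C / (27 * η) = C / η / 27 := by field_simp
    rw [e1]
    have : 2 * (C / η / 27) ≤ (1 + C / η) ^ 2 := by nlinarith
    calc _ = 2 * (C / η / 27) * t ^ 4 := by ring
      _ ≤ (1 + C / η) ^ 2 * t ^ 4 := by gcongr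
      _ = _ := by ring))
  refine (enc_mono (fun E hE => ?_)).trans (hs.trans (ENNReal.ofReal_le_ofReal ?_))
  · have hJ : |((mkL (p, (q, A, B, G), E)).J : ℝ)| < C * (t ^ 4) ^ 2 := hE.2.2.2.1
    have e : ((mkL (p, (q, A, B, G), E)).J : ℝ) = -(27 * a * p ^ 2) * ((1 * (E:ℝ) + k) ^ 2 - A0) := by
      have : ((mkL (p, (q, A, B, G), E)).J : ℝ) = -(27 * a * p ^ 2) * E ^ 2 + β * E + γ := by
        rw [hβ, hγ]; simp only [mkL, BQF.J, ← had, ← hbd, ← hcd]; push_cast; ring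
      rw [this, hA0, hk]; field_simp; ring
    rw [e, abs_mul, abs_neg, abs_mul, abs_mul] at hJ
    show |(1 * (E:ℝ) + k) ^ 2 - A0| ≤ ρ
    have hp2 : 1 ≤ |(p:ℝ) ^ 2| := by rw [abs_pow]; exact one_le_pow₀ h1
    have h27 : |(27:ℝ)| = 27 := by norm_num
    rw [h27] at hJ
    by_contra hcon
    push Not at hcon
    have h3 : 27 * (η * t ^ 4) * 1 ≤ 27 * |(a:ℝ)| * |(p:ℝ) ^ 2| := by gcongr
    have hρ0 : 0 ≤ ρ := by positivity
    have h4 : 27 * (η * t ^ 4) * 1 * ρ ≤ 27 * |(a:ℝ)| * |(p:ℝ) ^ 2| * |(1 * (E:ℝ) + k) ^ 2 - A0| := by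
      gcongr
    have h5 : 27 * (η * t ^ 4) * 1 * ρ = C * (t ^ 4) ^ 2 := by rw [hρ]; field_simp
    linarith
  · have : 1 ≤ t ^ 2 := one_le_pow₀ ht
    rw [div_one]; nlinarith
end

open Filter Topology MeasureTheory
open scoped ENNReal
noncomputable section

lemma lin_sub {K η L C R : ℝ} (hK : 1 ≤ K) (hη : 0 < η) (hL : 0 < L) (hR : R = 1 + 4 * K / η) {f : BQF} (h : CB K η L f) (hJ : |(f.J:ℝ)| < C * L ^ 2)
    {p q A B G E : ℤ} (hl : Lin f p q A B G E) : f ∈ mkL '' WL η C (3 * R ^ 2) (K * L) L := by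
  obtain ⟨l1, l2, l3, l4, l5⟩ := hl
  have hf : mkL (p, (q, A, B, G), E) = f := by
    ext
    · exact l1.symm
    · exact l2.symm
    · exact l3.symm
    · exact l4.symm
    · exact l5.symm
  obtain ⟨c0, c1, c2, c3, -, -⟩ := id h
  have ha0 : f.a ≠ 0 := by
    intro h0; rw [h0] at c0; simp at c0
    have : 0 < η * L := by positivity
    linarith only [this, c0]
  have hp : p ≠ 0 := by rintro rfl; simp at l1; exact ha0 l1
  have hA : A ≠ 0 := by rintro rfl; simp at l1; exact ha0 l1
  have p1 : (1:ℝ) ≤ |(p:ℝ)| := by exact_mod_cast Int.one_le_abs hp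
  have A1 : (1:ℝ) ≤ |(A:ℝ)| := by exact_mod_cast Int.one_le_abs hA
  have hR1 : 1 ≤ R := by rw [hR]; have : 0 < 4 * K / η := by positivity
                         linarith only [this]
  have hq : |(q:ℝ)| ≤ R * |(p:ℝ)| := by
    have hpC : (p:ℂ) ≠ 0 := by exact_mod_cast hp
    have := root_bd hK hη hL h (z := -(q:ℂ) / p) (by
      unfold evC; rw [l1, l2, l3, l4, l5]; push_cast; field_simp; ring)
    rw [norm_div, norm_neg, ← hR] at this
    have hn : ∀ n : ℤ, ‖(n:ℂ)‖ = |(n:ℝ)| := fun n => by simp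
    rw [hn, hn, div_le_iff₀ (by linarith only [p1])] at this
    exact this
  have e1 : |(p:ℝ)| * |(A:ℝ)| ≤ K * L := by rw [← abs_mul]; rw [l1] at c1; push_cast at c1; exact c1
  have qA : |(q:ℝ)| * |(A:ℝ)| ≤ R * (K * L) := by
    calc _ ≤ R * |(p:ℝ)| * |(A:ℝ)| := by gcongr
      _ = R * (|(p:ℝ)| * |(A:ℝ)|) := by ring
      _ ≤ _ := by gcongr
  have e2 : |(p:ℝ)| * |(B:ℝ)| ≤ (1 + R) * (K * L) := by
    have : (p:ℝ) * B = f.b - q * A := by rw [l2]; push_cast; ring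
    rw [← abs_mul, this]
    have := abs_sub (f.b:ℝ) (q * A)
    rw [abs_mul] at this
    linarith only [this, c2, qA]
  have qB : |(q:ℝ)| * |(B:ℝ)| ≤ R * ((1 + R) * (K * L)) := by
    calc _ ≤ R * |(p:ℝ)| * |(B:ℝ)| := by gcongr
      _ = R * (|(p:ℝ)| * |(B:ℝ)|) := by ring
      _ ≤ _ := by gcongr
  have e3 : |(p:ℝ)| * |(G:ℝ)| ≤ (1 + R + R ^ 2) * (K * L) := by
    have : (p:ℝ) * G = f.c - q * B := by rw [l3]; push_cast; ring
    rw [← abs_mul, this]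
    have := abs_sub (f.c:ℝ) (q * B)
    rw [abs_mul] at this
    linarith only [this, c3, qB]
  have hKL : 0 < K * L := by positivity
  have hRR : R ≤ R ^ 2 := by nlinarith only [hR1]
  have m1 : R ≤ 3 * R ^ 2 := by linarith
  have m3 : 1 + R + R ^ 2 ≤ 3 * R ^ 2 := by linarith
  have dv : ∀ {x k : ℝ}, |(p:ℝ)| * x ≤ k * (K * L) → k ≤ 3 * R ^ 2 → x ≤ 3 * R ^ 2 * (K * L) / |(p:ℝ)| := by
    intro x k h1 h2
    rw [le_div_iff₀ (by linarith only [p1]), mul_comm]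
    exact h1.trans (by gcongr)
  refine ⟨(p, (q, A, B, G), E), ⟨hp, ?_, ⟨?_, ?_, ?_, ?_⟩, ?_, ?_⟩, hf⟩
  · show |(p:ℝ)| ≤ _
    nlinarith only [p1, A1, e1]
  · show |(q:ℝ)| ≤ 3 * R ^ 2 * |(p:ℝ)|
    exact hq.trans (by gcongr)
  · exact dv (k := 1) (by linarith only [e1]) (by linarith only [m1, hR1])
  · exact dv e2 (by linarith only [m3, hRR, hR1])
  · exact dv e3 m3
  · rw [hf]; exact hJ
  · rw [hf]; exact c0

lemma quadf_sub {K η L R : ℝ} (hK : 1 ≤ K) (hη : 0 < η) (hL : 0 < L) (hR : R = 1 + 4 * K / η) {f : BQF} (h : CB K η L f)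
    {p q r p' q' r' : ℤ} (hl : Quad f p q r p' q' r') : f ∈ mkQ '' WQ (3 * R ^ 2) (K * L) := by
  obtain ⟨l1, l2, l3, l4, l5⟩ := hl
  have hf : mkQ (p, (q, r), (p', q', r')) = f := by
    ext
    · exact l1.symm
    · exact l2.symm
    · exact l3.symm
    · exact l4.symm
    · exact l5.symm
  obtain ⟨c0, c1, -⟩ := id h
  have ha0 : f.a ≠ 0 := by
    intro h0; rw [h0] at c0; simp at c0
    have : 0 < η * L := by positivity
    linarith only [this, c0]
  have hp : p ≠ 0 := by rintro rfl; simp at l1; exact ha0 l1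
  have hA : p' ≠ 0 := by rintro rfl; simp at l1; exact ha0 l1
  have p1 : (1:ℝ) ≤ |(p:ℝ)| := by exact_mod_cast Int.one_le_abs hp
  have A1 : (1:ℝ) ≤ |(p':ℝ)| := by exact_mod_cast Int.one_le_abs hA
  have hR1 : 1 ≤ R := by rw [hR]; have : 0 < 4 * K / η := by positivity
                         linarith only [this]
  have hfac : ∀ z : ℂ, evC f z 1 = (p * z ^ 2 + q * z + r) * (p' * z ^ 2 + q' * z + r') := by
    intro z; unfold evC; rw [l1, l2, l3, l4, l5]; push_cast; ring
  obtain ⟨b1, b2⟩ := quad_bd hp (R := R) (by linarith) fun z hz => by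
    rw [hR]; exact root_bd hK hη hL h (by rw [hfac, hz, zero_mul])
  obtain ⟨b3, b4⟩ := quad_bd hA (R := R) (by linarith) fun z hz => by
    rw [hR]; exact root_bd hK hη hL h (by rw [hfac, hz, mul_zero])
  have e1 : |(p':ℝ)| ≤ K * L / |(p:ℝ)| := by
    rw [le_div_iff₀ (by linarith only [p1]), ← abs_mul, mul_comm]; rw [l1] at c1; push_cast at c1; exact c1
  have hKL : 0 < K * L := by positivity
  have hRR : R ≤ R ^ 2 := by nlinarith only [hR1]
  have dv : ∀ {x k : ℝ}, x ≤ k * |(p':ℝ)| → k ≤ 3 * R ^ 2 → x ≤ 3 * R ^ 2 * (K * L) / |(p:ℝ)| := by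
    intro x k h1 h2
    rw [mul_div_assoc]
    exact h1.trans (by gcongr)
  refine ⟨(p, (q, r), (p', q', r')), ⟨hp, ?_, ⟨?_, ?_⟩, ?_, ?_, ?_⟩, hf⟩
  · show |(p:ℝ)| ≤ _
    rw [le_div_iff₀ (by linarith only [p1])] at e1
    nlinarith only [p1, A1, e1]
  · exact b1.trans (by gcongr; linarith only [hRR, hR1])
  · exact b2.trans (by gcongr; nlinarith only [hRR, hR1])
  · exact dv (k := 1) (by linarith only) (by linarith only [hRR, hR1])
  · exact dv b3 (by linarith only [hRR, hR1])
  · exact dv b4 (by linarith only [hRR, hR1])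

lemma red_ev {η C δ : ℝ} (hη : 0 < η) (hC : 0 < C) (hδ : 0 < δ) :
    ∀ᶠ L : ℝ in atTop, (({f : BQF | toZb f ∈ SL η C L ∧ ¬ f.Irred}).encard : ℝ≥0∞) ≤ ENNReal.ofReal (δ * L ^ 4) := by
  obtain ⟨K, hK, hCB⟩ := SL_CB hη hC
  set R : ℝ := 1 + 4 * K / η with hR
  have hR1 : 1 ≤ R := by
    have : 0 < 4 * K / η := by positivity
    linarith only [this, hR]
  set M : ℝ := 3 * R ^ 2 with hM
  have hM1 : 1 ≤ M := by nlinarith only [hR1, hM]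
  set Z : ℝ := (81 * M ^ 4 * K ^ 3 * (2 * (2 + C / η)) + 243 * M ^ 5 * K ^ 3) * (1 + 8 * K) with hZ
  have hZ0 : 0 < Z := by positivity
  filter_upwards [eventually_ge_atTop (L0 η C), eventually_ge_atTop 1, eventually_ge_atTop ((Z / δ) ^ 4)] with L h1 h2 h3
  have hL : 0 < L := by linarith
  set t := r4 L with ht
  have ht1 : 1 ≤ t := one_le_r4 h2
  have htL : t ^ 4 = L := r4_pow hL.le
  have hZt : Z ≤ δ * t := by
    have : Z / δ ≤ t := by
      have := r4_mono h3
      refine le_trans (le_of_eq ?_) this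
      exact (pow_left_inj₀ (by positivity) (r4_nn _) (by norm_num : 4 ≠ 0)).1 (r4_pow (by positivity)).symm
    rw [div_le_iff₀ hδ] at this; linarith only [this]
  have hr : r4 (K * L) ≤ K * t := by
    refine r4_le (by positivity) ?_
    rw [mul_pow, htL]
    gcongr
    exact le_self_pow₀ hK (by norm_num)
  have hsub : {f : BQF | toZb f ∈ SL η C L ∧ ¬ f.Irred} ⊆ mkL '' WL η C M (K * L) L ∪ mkQ '' WQ M (K * L) := by
    rintro f ⟨hf, hi⟩
    have hcb := hCB L h1 f hf
    have hJ : |(f.J:ℝ)| < C * L ^ 2 := by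
      obtain ⟨u, w, m, -, -, -, -, -, -, hJ, -⟩ := hf
      rw [← BQF.Jr_eq]; exact hJ
    have ha0 : f.a ≠ 0 := (SL_GD hη hL hf).1
    rcases red_cases ha0 hi with ⟨p, q, A, B, G, E, hl⟩ | ⟨p, q, r, p', q', r', hl⟩
    · exact Or.inl (lin_sub hK hη hL hR hcb hJ hl)
    · exact Or.inr (quadf_sub hK hη hL hR hcb hl)
  have cL := WL_count (M := M) (N := K * L) (t := t) hη hC hM1 (by positivity) ht1
  rw [htL] at cL
  have cQ := WQ_count (M := M) (N := K * L) hM1 (by positivity)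
  have hs : (({f : BQF | toZb f ∈ SL η C L ∧ ¬ f.Irred}).encard : ℝ≥0∞) ≤ ((WL η C M (K * L) L).encard : ℝ≥0∞) + ((WQ M (K * L)).encard : ℝ≥0∞) := by
    have := (Set.encard_mono hsub).trans ((Set.encard_union_le _ _).trans (add_le_add (Set.encard_image_le _ _) (Set.encard_image_le _ _)))
    exact_mod_cast this
  refine hs.trans ((add_le_add cL cQ).trans ?_)
  rw [← ENNReal.ofReal_add (by have := r4_nn (K * L); positivity) (by have := r4_nn (K * L); positivity)]
  refine ENNReal.ofReal_le_ofReal ?_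
  have hCη : 0 < C / η := by positivity
  have g1 : 1 + 8 * r4 (K * L) ≤ (1 + 8 * K) * t := by nlinarith only [hr, ht1, hK]
  have g0 := r4_nn (K * L)
  calc _ = (81 * M ^ 4 * (K * L) ^ 3 * (2 * (2 + C / η) * t ^ 2) + 243 * M ^ 5 * (K * L) ^ 3 * 1) * (1 + 8 * r4 (K * L)) := by ring
    _ ≤ (81 * M ^ 4 * (K * L) ^ 3 * (2 * (2 + C / η) * t ^ 2) + 243 * M ^ 5 * (K * L) ^ 3 * t ^ 2) * ((1 + 8 * K) * t) := by
        gcongr; exact one_le_pow₀ ht1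
    _ = Z * (t ^ 3 * L ^ 3) := by rw [hZ]; ring
    _ ≤ (δ * t) * (t ^ 3 * L ^ 3) := by gcongr
    _ = δ * (t ^ 4 * L ^ 3) := by ring
    _ = δ * L ^ 4 := by rw [htL]; ring
end

open Filter Topology MeasureTheory
open scoped ENNReal
noncomputable section

def PX (C L : ℝ) (f : BQF) : Prop := f.Irred ∧ f.realRoots.ncard = 2 ∧ |(f.I:ℝ)| < L ^ 2 ∧ |(f.J:ℝ)| < C * L ^ 2
abbrev QX (C L : ℝ) := Quot fun f g : {h : BQF // PX C L h} => BQF.Equivalent f.1 g.1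

lemma pre_le {S : Set Z5} {φ : BQF → Z5} (hφ : Function.Injective φ) : (φ ⁻¹' S).encard ≤ S.encard := by
  rw [← hφ.encard_image]
  exact Set.encard_mono (Set.image_preimage_subset _ _)

lemma pre_eq {S : Set Z5} {φ : BQF → Z5} (hφ : Function.Injective φ) (hs : Function.Surjective φ) : (φ ⁻¹' S).encard = S.encard := by
  rw [← hφ.encard_image, Set.image_preimage_eq _ hs]

lemma toZb_surj : Function.Surjective toZb := fun x => ⟨⟨x.1.1, x.1.2.1, x.1.2.2, x.2.1, x.2.2⟩, rfl⟩
lemma bneg_bneg (f : BQF) : bneg (bneg f) = f := by ext <;> simp [bneg]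

lemma up_card (η C L : ℝ) : ENat.card (QX C L) ≤ (SU η C L).encard + ((SU η C L).encard + (TL η C L).encard) := by
  choose F hF1 hF2 using fun x : {h : BQF // PX C L h} => rep_up (η := η) x.2.1 x.2.2.1 x.2.2.2.1 x.2.2.2.2
  let G : Set BQF := toZb ⁻¹' SU η C L ∪ ((toZb ∘ bneg) ⁻¹' SU η C L ∪ toZb ⁻¹' TL η C L)
  have hG : G.encard ≤ (SU η C L).encard + ((SU η C L).encard + (TL η C L).encard) :=
    (Set.encard_union_le _ _).trans (add_le_add (pre_le toZb_inj) ((Set.encard_union_le _ _).trans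
      (add_le_add (pre_le (toZb_inj.comp bneg_inj)) (pre_le toZb_inj))))
  refine le_trans ?_ hG
  have hinj : Function.Injective (fun x : QX C L => (⟨F x.out, hF2 x.out⟩ : G)) := by
    intro x y h
    have h : F x.out = F y.out := congrArg Subtype.val h
    rw [← x.out_eq, ← y.out_eq]
    apply Quot.sound
    exact eqv_equivalence.trans (hF1 x.out) (h ▸ eqv_equivalence.symm (hF1 y.out))
  exact (ENat.card_le_card_of_injective hinj)

lemma irred_neg {f : BQF} (h : f.Irred) : (bneg f).Irred := by
  refine ⟨by simpa [bneg] using h.1, ?_⟩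
  have h2 : Irreducible (qpoly f) := h.2
  have e : qpoly (bneg f) = -qpoly f := by
    simp only [qpoly, bneg]; push_cast; simp only [Polynomial.C_neg]; ring
  show Irreducible (qpoly (bneg f))
  rw [e]
  exact (Associated.refl (qpoly f)).neg_right.irreducible h2

lemma low_card {η C L : ℝ} (hη : 0 < η) (hL : 0 < L) :
    (SL η C L).encard + (SL η C L).encard ≤ ENat.card (QX C L) +
      ({f : BQF | toZb f ∈ SL η C L ∧ ¬ f.Irred}.encard + {f : BQF | toZb f ∈ SL η C L ∧ ¬ f.Irred}.encard) := by
  set Rd : Set BQF := {f : BQF | toZb f ∈ SL η C L ∧ ¬ f.Irred} with hRd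
  set A : Set BQF := {f | toZb f ∈ SL η C L ∧ f.Irred} with hA
  set B : Set BQF := {f | toZb (bneg f) ∈ SL η C L ∧ f.Irred} with hB
  have bs : Function.Surjective bneg := fun f => ⟨bneg f, bneg_bneg f⟩
  have h1 : (SL η C L).encard ≤ A.encard + Rd.encard := by
    rw [← pre_eq (S := SL η C L) toZb_inj toZb_surj]
    refine (Set.encard_mono ?_).trans (Set.encard_union_le _ _)
    intro f hf
    by_cases hi : f.Irred
    · exact Or.inl ⟨hf, hi⟩
    · exact Or.inr ⟨hf, hi⟩
  have h2 : (SL η C L).encard ≤ B.encard + Rd.encard := by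
    rw [← pre_eq (S := SL η C L) (toZb_inj.comp bneg_inj) (toZb_surj.comp bs), ← bneg_inj.encard_image Rd]
    refine (Set.encard_mono ?_).trans (Set.encard_union_le _ _)
    intro f hf
    by_cases hi : f.Irred
    · exact Or.inl ⟨hf, hi⟩
    · exact Or.inr ⟨bneg f, ⟨hf, fun h => hi (bneg_bneg f ▸ irred_neg h)⟩, bneg_bneg f⟩
  have hdis : Disjoint A B := by
    rw [Set.disjoint_left]
    rintro f ⟨hf, -⟩ ⟨hg, -⟩
    have ha := (SL_GD hη hL hf).1
    obtain ⟨u, w, m, hP, hu0, hu1, hw, hD, -, -, -, -, hs⟩ := hf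
    obtain ⟨u', w', m', hP', hu0', hu1', hw', -, -, -, -, -, hs'⟩ := hg
    have hw1 : 0 < w := by nlinarith only [hu0, hu1, hw]
    have hw1' : 0 < w' := by nlinarith only [hu0', hu1', hw']
    have hP2 : PF (bneg (bneg f)) u' w' (-m') := PF.neg (f := bneg f) hP'
    rw [bneg_bneg] at hP2
    have e1 := Real.sq_sqrt hw1.le
    have e2 := Real.sq_sqrt hw1'.le
    have hu : u = u' := by
      refine PF.uniq (f := f) ha (m := m) (m' := -m') (Real.sqrt_pos.2 hw1) (Real.sqrt_pos.2 hw1') ?_ ?_ ?_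
      · rw [e1]; exact hP
      · rw [e1]; exact hD
      · rw [e2]; exact hP2
    subst hu
    simp only [toZb, bneg] at hs hs'
    push_cast at hs'
    linarith
  have hGD : ∀ f ∈ A ∪ B, GD f ∧ PX C L f := by
    have key : ∀ f, toZb f ∈ SL η C L → |(f.I:ℝ)| < L ^ 2 ∧ |(f.J:ℝ)| < C * L ^ 2 := by
      rintro f ⟨u, w, m, -, -, -, -, -, hI, hJ, -⟩
      exact ⟨by rw [← BQF.Ir_eq]; exact hI, by rw [← BQF.Jr_eq]; exact hJ⟩
    rintro f (⟨hf, hi⟩ | ⟨hf, hi⟩)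
    · have hg := SL_GD hη hL hf
      exact ⟨hg, hi, GD_ncard hg, key f hf⟩
    · have hg := GD_neg (SL_GD hη hL hf)
      rw [bneg_bneg] at hg
      have hk := key _ hf
      rw [I_neg, J_neg] at hk
      push_cast at hk
      rw [abs_neg] at hk
      exact ⟨hg, hi, GD_ncard hg, hk⟩
  have hinj : Function.Injective (fun x : (A ∪ B : Set BQF) => (Quot.mk _ ⟨x.1, (hGD x.1 x.2).2⟩ : QX C L)) := by
    intro x y h
    have he : Equivalence (fun f g : {h : BQF // PX C L h} => BQF.Equivalent f.1 g.1) :=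
      ⟨fun x => eqv_equivalence.refl _, fun h => eqv_equivalence.symm h, fun h h' => eqv_equivalence.trans h h'⟩
    have h3 := (he.quot_mk_eq_iff _ _).1 h
    exact Subtype.ext (GD_uniq (hGD x.1 x.2).1 (hGD y.1 y.2).1 h3)
  have h4 : (A ∪ B).encard ≤ ENat.card (QX C L) := ENat.card_le_card_of_injective hinj
  rw [Set.encard_union_eq hdis] at h4
  calc _ ≤ (A.encard + Rd.encard) + (B.encard + Rd.encard) := add_le_add h1 h2
    _ = (A.encard + B.encard) + (Rd.encard + Rd.encard) := by abel
    _ ≤ _ := by gcongr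

lemma main_L {C : ℝ} (hC : 0 < C) : Tendsto (fun L : ℝ => (Nat.card (QX C L) : ℝ) / L ^ 4) atTop (𝓝 (2 * C * (Real.pi ^ 2 / 6) / 27)) := by
  set Λ := C * Real.pi ^ 2 / 162 with hΛ
  have hΛ0 : 0 < Λ := by positivity
  have e : 2 * C * (Real.pi ^ 2 / 6) / 27 = 2 * Λ := by rw [hΛ]; ring
  rw [e, Metric.tendsto_nhds]
  intro ε0 hε0
  obtain ⟨ε, hε⟩ : ∃ ε, ε = ε0 / 5 := ⟨_, rfl⟩
  have hε1 : 0 < ε := by rw [hε]; positivity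
  obtain ⟨η, hη, hT⟩ := TL_ev hC hε1
  have hU := U_ev hη hC (K := ENNReal.ofReal (Λ + ε)) (by
    rw [GG_Icc hC]; exact (ENNReal.ofReal_lt_ofReal_iff (by positivity)).2 (by linarith))
  obtain ⟨η', hη', hLL⟩ := L_ev hC (K := ENNReal.ofReal (Λ - ε)) (by
    rw [GG_Ioo hC]; exact (ENNReal.ofReal_lt_ofReal_iff hΛ0).2 (by linarith))
  have hR := red_ev hη' hC hε1
  filter_upwards [hT, hU, hLL, hR, eventually_gt_atTop 0] with L hT hU hLL hR hL
  have hL4 : 0 < L ^ 4 := by positivity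
  have hup : ((ENat.card (QX C L) : ℕ∞) : ℝ≥0∞) ≤ ENNReal.ofReal ((2 * Λ + 3 * ε) * L ^ 4) := by
    have h0 : ((ENat.card (QX C L) : ℕ∞) : ℝ≥0∞) ≤ ((SU η C L).encard : ℝ≥0∞) + (((SU η C L).encard : ℝ≥0∞) + ((TL η C L).encard : ℝ≥0∞)) := by
      exact_mod_cast up_card η C L
    refine h0.trans ((add_le_add hU (add_le_add hU hT)).trans (le_of_eq ?_))
    rw [← ENNReal.ofReal_mul (by positivity), ← ENNReal.ofReal_add (by positivity) (by positivity), ← ENNReal.ofReal_add (by positivity) (by positivity)]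
    congr 1; ring
  have hfin : Finite (QX C L) := by
    rw [← ENat.card_lt_top]
    have := hup.trans_lt ENNReal.ofReal_lt_top
    exact_mod_cast this
  have hcard : ((ENat.card (QX C L) : ℕ∞) : ℝ≥0∞) = ENNReal.ofReal (Nat.card (QX C L)) := by
    rw [ENat.card_eq_coe_natCard, ENNReal.ofReal_natCast]; rfl
  rw [hcard] at hup
  have u1 := (ENNReal.ofReal_le_ofReal_iff (by positivity)).1 hup
  have l0 : ((SL η' C L).encard : ℝ≥0∞) + ((SL η' C L).encard : ℝ≥0∞) ≤ ENNReal.ofReal (Nat.card (QX C L)) + (ENNReal.ofReal (ε * L ^ 4) + ENNReal.ofReal (ε * L ^ 4)) := by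
    rw [← hcard]
    refine le_trans ?_ (add_le_add le_rfl (add_le_add hR hR))
    exact_mod_cast low_card hη' hL
  rw [← ENNReal.ofReal_add (by positivity) (by positivity), ← ENNReal.ofReal_add (by positivity) (by positivity)] at l0
  have l1 := (add_le_add hLL hLL).trans l0
  rw [← ENNReal.ofReal_mul' hL4.le] at l1
  have l2 : 2 * ((Λ - ε) * L ^ 4) ≤ Nat.card (QX C L) + (ε * L ^ 4 + ε * L ^ 4) := by
    rw [← ENNReal.ofReal_le_ofReal_iff (by positivity)]
    refine le_trans ?_ l1
    rw [two_mul]; exact ENNReal.ofReal_add_le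
  rw [Real.dist_eq, abs_lt]
  constructor
  · have : 2 * Λ - 4 * ε ≤ (Nat.card (QX C L) : ℝ) / L ^ 4 := by
      rw [le_div_iff₀ hL4]; linarith
    linarith
  · have : (Nat.card (QX C L) : ℝ) / L ^ 4 ≤ 2 * Λ + 3 * ε := by
      rw [div_le_iff₀ hL4]; linarith
    linarith
end

theorem count_classes_two_real_roots (C : ℝ) (hC : 0 < C) :
    Tendsto (fun X : ℝ =>
        ((classCount fun f => f.Irred ∧ f.realRoots.ncard = 2 ∧
            max |(f.I : ℝ)| (|(f.J : ℝ)| / C) < X) : ℝ) / X ^ 2)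
      atTop (nhds (2 * C * (Real.pi ^ 2 / 6) / 27)) := by
  refine ((main_L hC).comp Real.tendsto_sqrt_atTop).congr' ?_
  filter_upwards [eventually_ge_atTop 0] with X hX
  have h1 : √X ^ 2 = X := Real.sq_sqrt hX
  have h2 : √X ^ 4 = X ^ 2 := by rw [show 4 = 2 * 2 by norm_num, pow_mul, h1]
  have h3 : (fun f : BQF => f.Irred ∧ f.realRoots.ncard = 2 ∧ max |(f.I : ℝ)| (|(f.J : ℝ)| / C) < X) = PX C (√X) := by
    funext f
    rw [PX, h1, max_lt_iff, div_lt_iff₀ hC, mul_comm X C]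
  show (Nat.card (QX C (√X)) : ℝ) / √X ^ 4 = _
  rw [h2, h3, classCount]
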